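/- In the braid group B_{n+1} with the Garside structure (G, M, Δ) and parabolic substructures (H, N, Λ) and (G₁, M₁, Δ₁) described above, the pair (H, G₁) satisfies Condition A with constant ζ = 1 and Condition B with constant ζ = 1. -/

import Mathlib

namespace GarsideOrder

variable {G : Type*} [Group G]

/-- `a ≤_R b` iff `b * a⁻¹ ∈ M`. -/
def leR (M : Submonoid G) (a b : G) : Prop := b * a⁻¹ ∈ M

/-- `a ≤_L b` iff `a⁻¹ * b ∈ M`. -/
def leL (M : Submonoid G) (a b : G) : Prop := a⁻¹ * b ∈ M

/-- Right divisors (in `M`) of `a`. -/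
def DivR (M : Submonoid G) (a : G) : Set G := {b : G | b ∈ M ∧ leR M b a}

/-- Left divisors (in `M`) of `a`. -/
def DivL (M : Submonoid G) (a : G) : Set G := {b : G | b ∈ M ∧ leL M b a}

/-- `a` is balanced if its sets of right and left divisors coincide. -/
def Balanced (M : Submonoid G) (a : G) : Prop := DivR M a = DivL M a

open Classical in
/-- The `N`-tail of `a`: the unique `b ∈ N` having the same right divisors lying in `N`
as `a` (w.r.t. the divisibility of the ambient monoid `M`). -/
noncomputable def tail (M N : Submonoid G) (a : G) : G :=
  if h : ∃ b : G, b ∈ N ∧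
      {c : G | c ∈ N ∧ leR M c a} = {c : G | c ∈ N ∧ leR M c b} then
    h.choose
  else 1

/-- Iterated stripping of alternating tails: first the `M₁`-tail, then the `N`-tail, etc. -/
noncomputable def strip (M M₁ N : Submonoid G) : ℕ → G → G
  | 0, a => a
  | i + 1, a =>
      strip M M₁ N i a *
        (tail M (if i % 2 = 0 then M₁ else N) (strip M M₁ N i a))⁻¹

/-- The breadth of `a`: the length of the alternating form of `a`, i.e. the least `p ≥ 1`
such that stripping alternating tails `p` times reaches `1`. -/
noncomputable def bh (M M₁ N : Submonoid G) (a : G) : ℕ :=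
  sInf {p : ℕ | 1 ≤ p ∧ strip M M₁ N p a = 1}

/-- The depth of `a`: `(bh a - 1)/2` if `bh a` is odd, `bh a / 2` if `bh a` is even;
in both cases this is `bh a / 2` with natural division. -/
noncomputable def dpt (M M₁ N : Submonoid G) (a : G) : ℕ := bh M M₁ N a / 2

/-- `a ∈ M` is unmovable if `Δ` does not right-divide it. -/
def Unmovable (M : Submonoid G) (Δ a : G) : Prop := a ∈ M ∧ ¬ leR M Δ a

/-- `α` is `(H, G₁)`-negative: its `Δ`-form is `a Δ^{-k}` with `k ≥ 1` and
`dpt a < dpt (Δ^k)`. -/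
def Negative (M M₁ N : Submonoid G) (Δ : G) (α : G) : Prop :=
  ∃ a : G, ∃ k : ℕ, Unmovable M Δ a ∧ 1 ≤ k ∧ α = a * (Δ ^ k)⁻¹ ∧
    dpt M M₁ N a < dpt M M₁ N (Δ ^ k)

/-- `α` is `(H, G₁)`-positive if `α⁻¹` is `(H, G₁)`-negative. -/
def Positive (M M₁ N : Submonoid G) (Δ : G) (α : G) : Prop :=
  Negative M M₁ N Δ α⁻¹

/-- The set `Θ` of theta elements `θ^k a₀`, `k ≥ 1`, `a₀ ∈ M₁`. -/
def thetaSet (M₁ : Submonoid G) (θ : G) : Set G :=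
  {x : G | ∃ k : ℕ, 1 ≤ k ∧ ∃ a₀ ∈ M₁, x = θ ^ k * a₀}

/-- `Θ̄ = Θ ∪ M₁`. -/
def thetaBar (M₁ : Submonoid G) (θ : G) : Set G := thetaSet M₁ θ ∪ (M₁ : Set G)

/-- Condition A with constant `ζ`: `dpt (Δ^k) = ζ k + 1` for all `k ≥ 1`. -/
def CondA (M M₁ N : Submonoid G) (Δ : G) (ζ : ℕ) : Prop :=
  ∀ k : ℕ, 1 ≤ k → dpt M M₁ N (Δ ^ k) = ζ * k + 1

/-- Condition B with constant `ζ`. -/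
def CondB (M M₁ N : Submonoid G) (Δ θ : G) (ζ : ℕ) : Prop :=
  ∀ a b c : G, ∀ t : ℤ,
    Unmovable M Δ a → Unmovable M Δ b →
    ¬(a ∈ thetaBar M₁ θ ∧ b ∈ thetaBar M₁ θ) →
    Unmovable M Δ c → a * b = c * Δ ^ t →
    ∃ ε : ℕ, ε ≤ 1 ∧
      (dpt M M₁ N c : ℤ) =
        (dpt M M₁ N a : ℤ) + (dpt M M₁ N b : ℤ) - (ζ : ℤ) * t - (ε : ℤ) ∧
      ((a ∈ thetaSet M₁ θ ∨ b ∈ thetaSet M₁ θ ∨ c ∈ M₁) → ε = 1)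

/-- A Garside structure with group of fractions the subgroup `car`. -/
structure IsGarsideOn (car : Subgroup G) (M : Submonoid G) (Δ : G) : Prop where
  M_sub : (M : Set G) ⊆ (car : Set G)
  delta_mem : Δ ∈ M
  units_trivial : ∀ x : G, x ∈ M → x⁻¹ ∈ M → x = 1
  noetherian : ∀ a ∈ M, ∃ n : ℕ, 1 ≤ n ∧ ∀ l : List G,
      (∀ x ∈ l, x ∈ M ∧ x ≠ 1) → l.prod = a → l.length ≤ n
  balanced : Balanced M Δ
  div_finite : (DivR M Δ).Finite
  div_gen_monoid : Submonoid.closure (DivR M Δ) = M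
  div_gen_group : Subgroup.closure (DivR M Δ) = car
  meet : ∀ a ∈ car, ∀ b ∈ car, ∃ c ∈ car, leR M c a ∧ leR M c b ∧
      ∀ d ∈ car, leR M d a → leR M d b → leR M d c
  join : ∀ a ∈ car, ∀ b ∈ car, ∃ c ∈ car, leR M a c ∧ leR M b c ∧
      ∀ d ∈ car, leR M a d → leR M b d → leR M c d

/-- The parabolic submonoid determined by `δ`: the submonoid generated by `Div(δ)`. -/
def parM (M : Submonoid G) (δ : G) : Submonoid G := Submonoid.closure (DivR M δ)

/-- The parabolic subgroup determined by `δ`: the subgroup generated by `Div(δ)`. -/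
def parG (M : Submonoid G) (δ : G) : Subgroup G := Subgroup.closure (DivR M δ)

/-- `δ` determines a parabolic substructure of `(G, M, Δ)`. -/
structure IsParabolic (M : Submonoid G) (Δ δ : G) : Prop where
  mem : δ ∈ M
  balanced : Balanced M δ
  div_eq : DivR M δ = DivR M Δ ∩ (parM M δ : Set G)

/-- The setting of Section 3: a Garside structure `(car, M, Δ)` together with two
parabolic substructures `(H, N, Λ)` (given by `lam`) and `(G₁, M₁, Δ₁)` (given by `δ1`),
with `N ≠ M`, `M₁ ≠ M`, `N ∪ M₁` generating `M`, `Δ` central, `Δ₁` central in `G₁`. -/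
structure Setting (G : Type*) [Group G] where
  car : Subgroup G
  M : Submonoid G
  Δ : G
  δ1 : G
  lam : G
  garside : IsGarsideOn car M Δ
  par1 : IsParabolic M Δ δ1
  parH : IsParabolic M Δ lam
  N_ne : parM M lam ≠ M
  M1_ne : parM M δ1 ≠ M
  unionGen : Submonoid.closure ((parM M lam : Set G) ∪ (parM M δ1 : Set G)) = M
  delta_central : ∀ g ∈ car, Δ * g = g * Δ
  delta1_central : ∀ g ∈ parG M δ1, δ1 * g = g * δ1

namespace Setting

variable (S : Setting G)

/-- The parabolic submonoid `M₁`. -/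
def M₁ : Submonoid G := parM S.M S.δ1

/-- The parabolic submonoid `N`. -/
def Nsub : Submonoid G := parM S.M S.lam

/-- The parabolic subgroup `G₁`. -/
def G₁ : Subgroup G := parG S.M S.δ1

/-- `θ = Δ Δ₁⁻¹`. -/
def theta : G := S.Δ * S.δ1⁻¹

/-- The set of `(H, G₁)`-negative elements. -/
def Neg : Set G := {α : G | Negative S.M S.M₁ S.Nsub S.Δ α}

/-- The set of `(H, G₁)`-positive elements. -/
def Pos : Set G := {α : G | α⁻¹ ∈ S.Neg}

/-- Condition A. -/
def condA (ζ : ℕ) : Prop := CondA S.M S.M₁ S.Nsub S.Δ ζ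

/-- Condition B. -/
def condB (ζ : ℕ) : Prop := CondB S.M S.M₁ S.Nsub S.Δ S.theta ζ

/-- `(H, G₁)` is a Dehornoy structure: `PP ⊆ P`, `G₁ P G₁ ⊆ P`, and the group is the
disjoint union of `P`, `P⁻¹` and `G₁`. -/
def IsDehornoy : Prop :=
  (∀ α ∈ S.Pos, ∀ β ∈ S.Pos, α * β ∈ S.Pos) ∧
  (∀ g₁ ∈ S.G₁, ∀ α ∈ S.Pos, ∀ g₂ ∈ S.G₁, g₁ * α * g₂ ∈ S.Pos) ∧
  (∀ α ∈ S.car, α ∈ S.Pos ∨ α ∈ S.Neg ∨ α ∈ S.G₁) ∧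
  (∀ α : G, ¬(α ∈ S.Pos ∧ α ∈ S.Neg)) ∧
  (∀ α : G, ¬(α ∈ S.Pos ∧ α ∈ S.G₁)) ∧
  (∀ α : G, ¬(α ∈ S.Neg ∧ α ∈ S.G₁))

end Setting

end GarsideOrder


namespace BraidOrder

open GarsideOrder

/-- The braid relations on `n` generators `σ_0, …, σ_{n-1}` (representing `s_1, …, s_n`). -/
def braidRel (n : ℕ) : Set (FreeGroup (Fin n)) :=
  {r | ∃ i j : Fin n,
      ((i : ℕ) + 1 = (j : ℕ) ∧
        r = FreeGroup.of i * FreeGroup.of j * FreeGroup.of i *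
            (FreeGroup.of j * FreeGroup.of i * FreeGroup.of j)⁻¹) ∨
      ((i : ℕ) + 2 ≤ (j : ℕ) ∧
        r = FreeGroup.of i * FreeGroup.of j * (FreeGroup.of j * FreeGroup.of i)⁻¹)}

/-- The braid group `B_{n+1}` on `n+1` strands, presented with `n` generators. -/
abbrev Braid (n : ℕ) := PresentedGroup (braidRel n)

/-- `gen n i` is the generator `s_{i+1}` of `B_{n+1}` (for `i < n`). -/
def gen (n i : ℕ) : Braid n :=
  if h : i < n then PresentedGroup.of ⟨i, h⟩ else 1

/-- The product `gen a * gen (a+1) * ⋯ * gen (b-1)`, i.e. `s_{a+1} s_{a+2} ⋯ s_b`. -/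
def seg (n a b : ℕ) : Braid n := (((List.range b).drop a).map (gen n)).prod

/-- The product `gen (b-1) * ⋯ * gen (a+1) * gen a`, i.e. `s_b ⋯ s_{a+2} s_{a+1}`. -/
def segRev (n a b : ℕ) : Braid n := ((((List.range b).drop a).reverse).map (gen n)).prod

/-- The positive braid monoid `B_{n+1}^+`. -/
def Mb (n : ℕ) : Submonoid (Braid n) :=
  Submonoid.closure {x : Braid n | ∃ i : ℕ, i < n ∧ x = gen n i}

/-- The submonoid generated by `s_2, …, s_n`. -/
def M₁b (n : ℕ) : Submonoid (Braid n) :=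
  Submonoid.closure {x : Braid n | ∃ i : ℕ, 1 ≤ i ∧ i < n ∧ x = gen n i}

/-- The submonoid generated by `s_1, …, s_{n-1}`. -/
def Nb (n : ℕ) : Submonoid (Braid n) :=
  Submonoid.closure {x : Braid n | ∃ i : ℕ, i + 1 < n ∧ x = gen n i}

/-- The subgroup generated by `s_2, …, s_n`. -/
def G₁b (n : ℕ) : Subgroup (Braid n) :=
  Subgroup.closure {x : Braid n | ∃ i : ℕ, 1 ≤ i ∧ i < n ∧ x = gen n i}

/-- The subgroup generated by `s_1, …, s_{n-1}`. -/
def Hb (n : ℕ) : Subgroup (Braid n) :=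
  Subgroup.closure {x : Braid n | ∃ i : ℕ, i + 1 < n ∧ x = gen n i}

/-- The Garside element `Δ = (s_1 s_2 ⋯ s_n)^{n+1}`. -/
def Δb (n : ℕ) : Braid n := seg n 0 n ^ (n + 1)

/-- `Δ₁ = (s_2 ⋯ s_n)^n`. -/
def Δ₁b (n : ℕ) : Braid n := seg n 1 n ^ n

/-- `Λ = (s_1 ⋯ s_{n-1})^n`. -/
def Λb (n : ℕ) : Braid n := seg n 0 (n - 1) ^ n

/-- `θ = s_1 ⋯ s_{n-1} s_n² s_{n-1} ⋯ s_1` as an explicit word. -/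
def thetaWordb (n : ℕ) : Braid n := seg n 0 n * segRev n 0 n

end BraidOrder

namespace PosBraid

/-- Braid congruence on words with letters indexed by the integers. -/
inductive WordRel : List ℤ → List ℤ → Prop
  | refl (u) : WordRel u u
  | symm {u v} : WordRel u v → WordRel v u
  | trans {u v w} : WordRel u v → WordRel v w → WordRel u w
  | cons (i) {u v} : WordRel u v → WordRel (i :: u) (i :: v)
  | comm (i j u) : (i + 2 ≤ j ∨ j + 2 ≤ i) → WordRel (i :: j :: u) (j :: i :: u)
  | braid (i j u) : (i + 1 = j ∨ j + 1 = i) → WordRel (i :: j :: i :: u) (j :: i :: j :: u)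

theorem WordRel.append_left (w : List ℤ) {u v : List ℤ} (h : WordRel u v) :
    WordRel (w ++ u) (w ++ v) := by
  induction w with
  | nil => exact h
  | cons i w ih => exact ih.cons i

theorem WordRel.append_right {u v : List ℤ} (h : WordRel u v) (w : List ℤ) :
    WordRel (u ++ w) (v ++ w) := by
  induction h with
  | refl u => exact .refl _
  | symm _ ih => exact ih.symm
  | trans _ _ ih₁ ih₂ => exact ih₁.trans ih₂
  | cons i _ ih => exact ih.cons i
  | comm i j u h => exact .comm i j _ h
  | braid i j u h => exact .braid i j _ h

theorem WordRel.length_eq {u v : List ℤ} (h : WordRel u v) : u.length = v.length := by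
  induction h <;> simp_all

theorem WordRel.mem_iff {u v : List ℤ} (h : WordRel u v) (k : ℤ) : k ∈ u ↔ k ∈ v := by
  induction h <;> simp_all <;> tauto

theorem WordRel.reverse {u v : List ℤ} (h : WordRel u v) : WordRel u.reverse v.reverse := by
  induction h with
  | refl u => exact .refl _
  | symm _ ih => exact ih.symm
  | trans _ _ ih₁ ih₂ => exact ih₁.trans ih₂
  | cons i _ ih => simpa using ih.append_right [i]
  | comm i j u h =>
    simpa using WordRel.append_left u.reverse (WordRel.comm j i [] h.symm)
  | braid i j u h =>
    simpa using WordRel.append_left u.reverse (WordRel.braid i j [] h)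

theorem WordRel.map {f : ℤ → ℤ}
    (hf : ∀ i j, |f i - f j| = |i - j|) {u v : List ℤ} (h : WordRel u v) :
    WordRel (u.map f) (v.map f) := by
  induction h with
  | refl u => exact .refl _
  | symm _ ih => exact ih.symm
  | trans _ _ ih₁ ih₂ => exact ih₁.trans ih₂
  | cons i _ ih => exact ih.cons (f i)
  | comm i j u h =>
    refine .comm _ _ _ ?_
    have := hf i j
    rcases abs_cases (f i - f j) with h1 | h1 <;> rcases abs_cases (i - j) with h2 | h2 <;> omega
  | braid i j u h =>
    refine .braid _ _ _ ?_
    have := hf i j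
    rcases abs_cases (f i - f j) with h1 | h1 <;> rcases abs_cases (i - j) with h2 | h2 <;> omega

instance wordSetoid : Setoid (List ℤ) :=
  ⟨WordRel, .refl, .symm, .trans⟩

/-- The monoid of positive braids with strands indexed by the integers. -/
def PB : Type := Quotient wordSetoid

namespace PB

/-- The positive braid represented by a word. -/
def mk (u : List ℤ) : PB := Quotient.mk wordSetoid u

theorem mk_eq {u v : List ℤ} : mk u = mk v ↔ WordRel u v := Quotient.eq

theorem exists_mk (x : PB) : ∃ u, mk u = x := Quotient.exists_rep x

instance : Monoid PB where
  one := mk []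
  mul := Quotient.map₂ (· ++ ·) fun _ _ h _ _ h' =>
    (h.append_right _).trans (h'.append_left _)
  mul_assoc a b c := by
    obtain ⟨u, rfl⟩ := exists_mk a
    obtain ⟨v, rfl⟩ := exists_mk b
    obtain ⟨w, rfl⟩ := exists_mk c
    exact congrArg mk (List.append_assoc u v w)
  one_mul a := by
    obtain ⟨u, rfl⟩ := exists_mk a
    rfl
  mul_one a := by
    obtain ⟨u, rfl⟩ := exists_mk a
    exact congrArg mk (List.append_nil u)

theorem mk_append (u v : List ℤ) : mk (u ++ v) = mk u * mk v := rfl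

theorem mk_nil : mk [] = 1 := rfl

/-- The generators. -/
def g (i : ℤ) : PB := mk [i]

theorem mk_cons (i : ℤ) (u : List ℤ) : mk (i :: u) = g i * mk u := rfl

theorem mk_singleton (i : ℤ) : mk [i] = g i := rfl

theorem g_comm {i j : ℤ} (h : i + 2 ≤ j ∨ j + 2 ≤ i) : g i * g j = g j * g i :=
  mk_eq.2 (.comm i j [] h)

theorem g_braid {i j : ℤ} (h : i + 1 = j ∨ j + 1 = i) : g i * g j * g i = g j * g i * g j :=
  mk_eq.2 (.braid i j [] h)

/-- Induction on positive braids, adding letters on the right. -/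
theorem induction_right {motive : PB → Prop} (one : motive 1)
    (mul_g : ∀ x i, motive x → motive (x * g i)) (x : PB) : motive x := by
  obtain ⟨u, rfl⟩ := exists_mk x
  induction u using List.reverseRecOn with
  | nil => exact one
  | append_singleton u i ih => exact mul_g _ i ih

/-- The set of letters of a positive braid. -/
def lett : PB → Set ℤ :=
  Quotient.lift (fun u => {k | k ∈ u}) fun _ _ h => Set.ext fun k => WordRel.mem_iff h k

theorem lett_mk (u : List ℤ) : lett (mk u) = {k | k ∈ u} := rfl

@[simp] theorem lett_one : lett 1 = ∅ := by
  change lett (mk []) = ∅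
  simp [lett_mk]

@[simp] theorem lett_g (i : ℤ) : lett (g i) = {i} := by
  change lett (mk [i]) = {i}
  simp [lett_mk]

@[simp] theorem lett_mul (x y : PB) : lett (x * y) = lett x ∪ lett y := by
  obtain ⟨u, rfl⟩ := exists_mk x
  obtain ⟨v, rfl⟩ := exists_mk y
  rw [← mk_append]
  ext k
  simp [lett_mk]

/-- Word length. -/
def len : PB → ℕ := Quotient.lift List.length fun _ _ h => WordRel.length_eq h

theorem len_mk (u : List ℤ) : len (mk u) = u.length := rfl

@[simp] theorem len_one : len 1 = 0 := rfl

@[simp] theorem len_g (i : ℤ) : len (g i) = 1 := rfl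

@[simp] theorem len_mul (x y : PB) : len (x * y) = len x + len y := by
  obtain ⟨u, rfl⟩ := exists_mk x
  obtain ⟨v, rfl⟩ := exists_mk y
  rw [← mk_append]
  simp [len_mk]

theorem len_eq_zero {x : PB} : len x = 0 ↔ x = 1 := by
  obtain ⟨u, rfl⟩ := exists_mk x
  constructor
  · intro h
    rw [len_mk, List.length_eq_zero_iff] at h
    rw [h, mk_nil]
  · intro h
    rw [h, len_one]

/-- The automorphism induced by an isometry of the index set. -/
def mapHom (f : ℤ → ℤ) (hf : ∀ i j, |f i - f j| = |i - j|) : PB →* PB where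
  toFun := Quotient.map (List.map f) fun _ _ h => WordRel.map hf h
  map_one' := rfl
  map_mul' x y := by
    obtain ⟨u, rfl⟩ := exists_mk x
    obtain ⟨v, rfl⟩ := exists_mk y
    exact congrArg mk (List.map_append (f := f) (l₁ := u) (l₂ := v))

theorem mapHom_mk (f : ℤ → ℤ) (hf) (u : List ℤ) : mapHom f hf (mk u) = mk (u.map f) := rfl

theorem lett_mapHom (f : ℤ → ℤ) (hf) (x : PB) : lett (mapHom f hf x) = Set.image f (lett x) := by
  obtain ⟨u, rfl⟩ := exists_mk x
  ext k
  simp [mapHom_mk, lett_mk]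

theorem len_mapHom (f : ℤ → ℤ) (hf) (x : PB) : len (mapHom f hf x) = len x := by
  obtain ⟨u, rfl⟩ := exists_mk x
  simp [mapHom_mk, len_mk]

/-- Translation of the indices by `c`. -/
def sh (c : ℤ) : PB →* PB := mapHom (· + c) (by intro i j; congr 1; ring)

/-- The flip `i ↦ c - i` of the indices. -/
def fl (c : ℤ) : PB →* PB := mapHom (c - ·) (by intro i j; rw [← abs_neg]; congr 1; ring)

@[simp] theorem sh_g (c i : ℤ) : sh c (g i) = g (i + c) := rfl

@[simp] theorem fl_g (c i : ℤ) : fl c (g i) = g (c - i) := rfl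

@[simp] theorem sh_sh (c d : ℤ) (x : PB) : sh c (sh d x) = sh (d + c) x := by
  induction x using induction_right with
  | one => simp
  | mul_g x i ih => simp [ih, add_assoc]

@[simp] theorem sh_zero (x : PB) : sh 0 x = x := by
  induction x using induction_right with
  | one => simp
  | mul_g x i ih => simp [ih]

@[simp] theorem fl_fl (c : ℤ) (x : PB) : fl c (fl c x) = x := by
  induction x using induction_right with
  | one => simp
  | mul_g x i ih => simp [ih]

@[simp] theorem mem_lett_sh {c k : ℤ} {x : PB} : k ∈ lett (sh c x) ↔ k - c ∈ lett x := by
  rw [sh, lett_mapHom]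
  constructor
  · rintro ⟨i, hi, rfl⟩
    simpa using hi
  · intro h
    exact ⟨_, h, by simp⟩

@[simp] theorem mem_lett_fl {c k : ℤ} {x : PB} : k ∈ lett (fl c x) ↔ c - k ∈ lett x := by
  rw [fl, lett_mapHom]
  constructor
  · rintro ⟨i, hi, rfl⟩
    simpa using hi
  · intro h
    exact ⟨_, h, by simp⟩

@[simp] theorem len_sh (c : ℤ) (x : PB) : len (sh c x) = len x := len_mapHom _ _ x

@[simp] theorem len_fl (c : ℤ) (x : PB) : len (fl c x) = len x := len_mapHom _ _ x

/-- Reversal of words. -/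
def rev : PB → PB := Quotient.map List.reverse fun _ _ h => WordRel.reverse h

theorem rev_mk (u : List ℤ) : rev (mk u) = mk u.reverse := rfl

@[simp] theorem rev_g (i : ℤ) : rev (g i) = g i := rfl

@[simp] theorem rev_mul (x y : PB) : rev (x * y) = rev y * rev x := by
  obtain ⟨u, rfl⟩ := exists_mk x
  obtain ⟨v, rfl⟩ := exists_mk y
  simp only [rev_mk, ← mk_append, List.reverse_append]

@[simp] theorem rev_rev (x : PB) : rev (rev x) = x := by
  obtain ⟨u, rfl⟩ := exists_mk x
  simp [rev_mk]

end PB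

end PosBraid

namespace PosBraid
namespace PB

theorem g_comm_assoc {i j : ℤ} (h : i + 2 ≤ j ∨ j + 2 ≤ i) (x : PB) :
    g i * (g j * x) = g j * (g i * x) := by
  rw [← mul_assoc, g_comm h, mul_assoc]

theorem g_braid_assoc {i j : ℤ} (h : i + 1 = j ∨ j + 1 = i) (x : PB) :
    g i * (g j * (g i * x)) = g j * (g i * (g j * x)) := by
  have := congrArg (· * x) (g_braid h)
  simpa only [mul_assoc] using this

/-- `Compl i j x y` says that `g i * x = g j * y` is a multiple of the least common multiple of
`g i` and `g j`. -/
def Compl (i j : ℤ) (x y : PB) : Prop :=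
  (i = j ∧ x = y) ∨
  ((i + 2 ≤ j ∨ j + 2 ≤ i) ∧ ∃ w, x = g j * w ∧ y = g i * w) ∨
  ((i + 1 = j ∨ j + 1 = i) ∧ ∃ w, x = g j * (g i * w) ∧ y = g i * (g j * w))

theorem Compl.symm {i j : ℤ} {x y : PB} (h : Compl i j x y) : Compl j i y x := by
  rcases h with ⟨h, h'⟩ | ⟨h, w, hx, hy⟩ | ⟨h, w, hx, hy⟩
  · exact .inl ⟨h.symm, h'.symm⟩
  · exact .inr (.inl ⟨h.symm, w, hy, hx⟩)
  · exact .inr (.inr ⟨h.symm, w, hy, hx⟩)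

theorem Compl.eq {i : ℤ} {x y : PB} (h : Compl i i x y) : x = y := by
  rcases h with ⟨h, h'⟩ | ⟨h, w, hx, hy⟩ | ⟨h, w, hx, hy⟩
  · exact h'
  · omega
  · omega

theorem Compl.far {i j : ℤ} {x y : PB} (h : Compl i j x y) (hij : i + 2 ≤ j ∨ j + 2 ≤ i) :
    ∃ w, x = g j * w ∧ y = g i * w := by
  rcases h with ⟨h, h'⟩ | ⟨h, w, hx, hy⟩ | ⟨h, w, hx, hy⟩
  · omega
  · exact ⟨w, hx, hy⟩
  · omega

theorem Compl.near {i j : ℤ} {x y : PB} (h : Compl i j x y) (hij : i + 1 = j ∨ j + 1 = i) :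
    ∃ w, x = g j * (g i * w) ∧ y = g i * (g j * w) := by
  rcases h with ⟨h, h'⟩ | ⟨h, w, hx, hy⟩ | ⟨h, w, hx, hy⟩
  · omega
  · omega
  · exact ⟨w, hx, hy⟩

/-- The mixed case of transitivity of `Compl`. -/
theorem Compl.trans_far_near {L : ℕ}
    (IH : ∀ i j x y, len x < L → g i * x = g j * y → Compl i j x y)
    {i j k : ℤ} {x y w₁ w₂ : PB} (hx : len x = L)
    (hik : i + 2 ≤ k ∨ k + 2 ≤ i) (hjk : k + 1 = j ∨ j + 1 = k)
    (e₁ : x = g k * w₁) (e₂ : y = g k * (g j * w₂)) (e : g i * w₁ = g j * (g k * w₂)) :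
    Compl i j x y := by
  have l₁ : len w₁ + 1 = L := by rw [← hx, e₁]; simp; omega
  have h := IH _ _ _ _ (by omega) e
  have hij : i ≠ j := by omega
  by_cases hn : i + 1 = j ∨ j + 1 = i
  · obtain ⟨w₃, f₁, f₂⟩ := h.near hn
    have l₃ := congrArg len f₂
    have l₃' := congrArg len f₁
    simp at l₃ l₃'
    obtain ⟨w₄, f₃, f₄⟩ := (IH _ _ _ _ (by omega) f₂).far (by omega)
    have l₄ := congrArg len f₄
    simp at l₄
    obtain ⟨w₅, f₅, f₆⟩ := (IH _ _ _ _ (by omega) f₄).near (by omega)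
    refine .inr (.inr ⟨hn, g k * (g j * (g i * w₅)), ?_, ?_⟩)
    · rw [e₁, f₁, f₅, g_comm_assoc hik, g_braid_assoc (i := k) (by omega),
        g_braid_assoc (i := j) (j := i) (by omega), g_comm_assoc hik.symm]
    · rw [e₂, f₃, f₆, g_braid_assoc (i := j) (j := i) (by omega),
        g_comm_assoc hik.symm, g_comm_assoc hik (w₅), g_braid_assoc (i := k) (by omega)]
  · obtain ⟨w₃, f₁, f₂⟩ := h.far (by omega)
    have l₃ := congrArg len f₂
    have l₃' := congrArg len f₁
    simp at l₃ l₃'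
    obtain ⟨w₄, f₃, f₄⟩ := (IH _ _ _ _ (by omega) f₂).far (by omega)
    refine .inr (.inl ⟨by omega, g k * (g j * w₄), ?_, ?_⟩)
    · rw [e₁, f₁, f₄, g_braid_assoc (i := k) (by omega)]
    · rw [e₂, f₃, g_comm_assoc (i := j) (j := i) (by omega), g_comm_assoc hik.symm]

theorem Compl.trans {L : ℕ}
    (IH : ∀ i j x y, len x < L → g i * x = g j * y → Compl i j x y)
    {i j k : ℤ} {x t y : PB} (hx : len x = L) (hxy : len y = L)
    (h₁ : Compl i k x t) (h₂ : Compl k j t y) :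
    Compl i j x y := by
  rcases h₁ with ⟨rfl, rfl⟩ | ⟨hik, w₁, e₁, e₁'⟩ | ⟨hik, w₁, e₁, e₁'⟩
  · exact h₂
  · rcases h₂ with ⟨rfl, rfl⟩ | ⟨hjk, w₂, e₂, e₂'⟩ | ⟨hjk, w₂, e₂, e₂'⟩
    · exact .inr (.inl ⟨hik, w₁, e₁, e₁'⟩)
    · have l₁ := congrArg len e₁
      simp at l₁
      rcases IH _ _ _ _ (by omega) (e₁'.symm.trans e₂) with
        ⟨rfl, rfl⟩ | ⟨h, w, f₁, f₂⟩ | ⟨h, w, f₁, f₂⟩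
      · exact .inl ⟨rfl, by rw [e₁, e₂']⟩
      · refine .inr (.inl ⟨h, g k * w, ?_, ?_⟩)
        · rw [e₁, f₁, g_comm_assoc hjk]
        · rw [e₂', f₂, g_comm_assoc hik]
      · refine .inr (.inr ⟨h, g k * w, ?_, ?_⟩)
        · rw [e₁, f₁, g_comm_assoc hjk, g_comm_assoc hik]
        · rw [e₂', f₂, g_comm_assoc hik.symm, g_comm_assoc hjk]
    · exact Compl.trans_far_near IH hx hik hjk e₁ e₂' (e₁'.symm.trans e₂)
  · rcases h₂ with ⟨rfl, rfl⟩ | ⟨hjk, w₂, e₂, e₂'⟩ | ⟨hjk, w₂, e₂, e₂'⟩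
    · exact .inr (.inr ⟨hik, w₁, e₁, e₁'⟩)
    · exact (Compl.trans_far_near IH hxy hjk.symm hik.symm e₂' e₁ (e₂.symm.trans e₁')).symm
    · have l₁ := congrArg len e₁
      simp at l₁
      have e := e₁'.symm.trans e₂
      by_cases hij : i = j
      · subst hij
        refine .inl ⟨rfl, ?_⟩
        have f := (IH _ _ _ _ (by simp; omega) e).eq
        have f := (IH _ _ _ _ (by omega) f).eq
        rw [e₁, e₂', f]
      · obtain ⟨w₃, f₁, f₂⟩ := (IH _ _ _ _ (by simp; omega) e).far (by omega)
        obtain ⟨w₄, f₃, f₄⟩ := (IH _ _ _ _ (by omega) f₁).near (by omega)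
        have l₂ := congrArg len e
        simp at l₂
        obtain ⟨w₅, f₅, f₆⟩ := (IH _ _ _ _ (by omega) f₂).near (by omega)
        have l₃ := congrArg len f₄
        have l₄ := congrArg len f₁
        simp at l₃ l₄
        have f := (IH _ _ _ _ (by simp; omega) (f₄.symm.trans f₆)).eq
        obtain ⟨w₆, f₇, f₈⟩ := (IH _ _ _ _ (by omega) f).far (by omega)
        refine .inr (.inl ⟨by omega, g k * (g j * (g i * (g k * w₆))), ?_, ?_⟩)
        · rw [e₁, f₃, f₇, g_comm_assoc (i := i) (j := j) (by omega),
            g_braid_assoc (i := i) (by omega), g_braid_assoc (i := k) (by omega)]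
        · rw [e₂', f₅, f₈, g_comm_assoc (i := j) (j := i) (by omega),
            g_braid_assoc (i := j) (by omega), g_braid_assoc (i := k) (j := i) (by omega),
            g_comm_assoc (i := i) (j := j) (by omega)]

theorem compl_of_mul_eq : ∀ (L : ℕ) (i j : ℤ) (x y : PB), len x < L → g i * x = g j * y →
    Compl i j x y := by
  intro L
  induction L with
  | zero => intro _ _ _ _ h; omega
  | succ L IH =>
    intro i j x y hL e
    obtain ⟨u, rfl⟩ := exists_mk x
    obtain ⟨v, rfl⟩ := exists_mk y
    rw [← mk_cons, ← mk_cons, mk_eq] at e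
    by_cases hlt : u.length < L
    · exact IH _ _ _ _ hlt (mk_eq.2 e)
    have key : ∀ a b : List ℤ, WordRel a b → ∀ i j u v, a = i :: u → b = j :: v →
        u.length = L → Compl i j (mk u) (mk v) := by
      intro a b h
      induction h with
      | refl a =>
        rintro i j u v rfl h -
        obtain ⟨rfl, rfl⟩ := List.cons_eq_cons.1 h
        exact .inl ⟨rfl, rfl⟩
      | @symm a b h ih =>
        rintro i j u v rfl rfl hl
        have := h.length_eq
        simp at this
        exact (ih _ _ _ _ rfl rfl (by omega)).symm
      | @trans a b c h₁ h₂ ih₁ ih₂ =>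
        rintro i j u v rfl rfl hl
        have h₃ := h₁.length_eq
        have h₄ := h₂.length_eq
        cases b with
        | nil => simp at h₃
        | cons k t =>
          simp at h₃ h₄
          exact Compl.trans IH (by rw [len_mk]; omega) (by rw [len_mk]; omega)
            (ih₁ _ _ _ _ rfl rfl hl) (ih₂ _ _ _ _ rfl rfl (by omega))
      | cons i h _ =>
        rintro i j u v h₁ h₂ -
        obtain ⟨rfl, rfl⟩ := List.cons_eq_cons.1 h₁
        obtain ⟨rfl, rfl⟩ := List.cons_eq_cons.1 h₂
        exact .inl ⟨rfl, mk_eq.2 h⟩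
      | comm i j u h =>
        rintro i j u v h₁ h₂ -
        obtain ⟨rfl, rfl⟩ := List.cons_eq_cons.1 h₁
        obtain ⟨rfl, rfl⟩ := List.cons_eq_cons.1 h₂
        exact .inr (.inl ⟨h, _, mk_cons _ _, mk_cons _ _⟩)
      | braid i j u h =>
        rintro i j u v h₁ h₂ -
        obtain ⟨rfl, rfl⟩ := List.cons_eq_cons.1 h₁
        obtain ⟨rfl, rfl⟩ := List.cons_eq_cons.1 h₂
        exact .inr (.inr ⟨h, mk u, rfl, rfl⟩)
    rw [len_mk] at hL
    exact key _ _ e _ _ _ _ rfl rfl (by omega)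

theorem g_mul_cancel {i : ℤ} {x y : PB} (h : g i * x = g i * y) : x = y :=
  (compl_of_mul_eq _ i i x y (Nat.lt_succ_self _) h).eq

theorem mul_g_cancel {i : ℤ} {x y : PB} (h : x * g i = y * g i) : x = y := by
  have := g_mul_cancel (i := i) (x := rev x) (y := rev y) (by
    simpa using congrArg rev h)
  simpa using congrArg rev this

theorem mul_g_far {i j : ℤ} {x y : PB} (hij : i + 2 ≤ j ∨ j + 2 ≤ i)
    (h : x * g i = y * g j) : ∃ w, x = w * g j ∧ y = w * g i := by
  have e : g i * rev x = g j * rev y := by simpa using congrArg rev h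
  obtain ⟨w, h₁, h₂⟩ := (compl_of_mul_eq _ i j _ _ (Nat.lt_succ_self _) e).far hij
  exact ⟨rev w, by simpa using congrArg rev h₁, by simpa using congrArg rev h₂⟩

theorem mul_g_near {i j : ℤ} {x y : PB} (hij : i + 1 = j ∨ j + 1 = i)
    (h : x * g i = y * g j) : ∃ w, x = w * g i * g j ∧ y = w * g j * g i := by
  have e : g i * rev x = g j * rev y := by simpa using congrArg rev h
  obtain ⟨w, h₁, h₂⟩ := (compl_of_mul_eq _ i j _ _ (Nat.lt_succ_self _) e).near hij
  exact ⟨rev w, by simpa using congrArg rev h₁, by simpa using congrArg rev h₂⟩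

instance : IsCancelMul PB where
  mul_left_cancel a b c h := by
    obtain ⟨u, rfl⟩ := exists_mk a
    induction u with
    | nil => simpa [mk_nil] using h
    | cons i u ih =>
      simp only [mk_cons, mul_assoc] at h
      exact ih (g_mul_cancel h)
  mul_right_cancel a b c h := by
    induction a using induction_right with
    | one => simpa using h
    | mul_g x i ih =>
      simp only [← mul_assoc] at h
      exact ih (mul_g_cancel h)

/-- `x` ends with the letter `i`. -/
def Ends (x : PB) (i : ℤ) : Prop := ∃ c, x = c * g i

theorem Ends.mem_lett {x : PB} {i : ℤ} (h : Ends x i) : i ∈ lett x := by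
  obtain ⟨c, rfl⟩ := h
  simp

theorem Ends.mul_left {x : PB} {i : ℤ} (h : Ends x i) (y : PB) : Ends (y * x) i := by
  obtain ⟨c, rfl⟩ := h
  exact ⟨y * c, by rw [mul_assoc]⟩

theorem exists_ends {x : PB} (h : x ≠ 1) : ∃ i, Ends x i := by
  induction x using induction_right with
  | one => exact absurd rfl h
  | mul_g x i _ => exact ⟨i, x, rfl⟩

theorem ends_fl {c i : ℤ} {x : PB} : Ends (fl c x) i ↔ Ends x (c - i) := by
  constructor
  · rintro ⟨y, h⟩
    exact ⟨fl c y, by simpa using congrArg (fl c) h⟩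
  · rintro ⟨y, rfl⟩
    exact ⟨fl c y, by simp⟩

theorem ends_sh {c i : ℤ} {x : PB} : Ends (sh c x) i ↔ Ends x (i - c) := by
  constructor
  · rintro ⟨y, h⟩
    exact ⟨sh (-c) y, by simpa [sub_eq_add_neg] using congrArg (sh (-c)) h⟩
  · rintro ⟨y, rfl⟩
    exact ⟨sh c y, by simp⟩

/-- `y` is the tail of `x * y` for the parabolic submonoid with letters in `I`. -/
def IsTail (I : Set ℤ) (x y : PB) : Prop := lett y ⊆ I ∧ ∀ i ∈ I, ¬ Ends x i

theorem exists_isTail (I : Set ℤ) (a : PB) : ∃ x y, a = x * y ∧ IsTail I x y := by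
  induction hl : len a using Nat.strong_induction_on generalizing a with
  | _ l ih =>
    by_cases h : ∃ i ∈ I, Ends a i
    · obtain ⟨i, hi, c, rfl⟩ := h
      obtain ⟨x, y, rfl, h₁, h₂⟩ := ih (len c) (by simp at hl; omega) c rfl
      exact ⟨x, y * g i, by rw [mul_assoc], by simp [Set.insert_subset_iff, h₁, hi], h₂⟩
    · push Not at h
      exact ⟨a, 1, by simp, by simp, h⟩

theorem IsTail.ends {I : Set ℤ} {x y : PB} (h : IsTail I x y) {j : ℤ} (hj : j ∈ I)
    (he : Ends (x * y) j) : Ends y j := by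
  induction hl : len y using Nat.strong_induction_on generalizing x y j with
  | _ l ih =>
    by_cases hy : y = 1
    · subst hy
      exact absurd (by simpa using he) (h.2 j hj)
    obtain ⟨i, y, rfl⟩ := exists_ends hy
    obtain ⟨c, hc⟩ := he
    have hI : i ∈ I := h.1 (by simp)
    have hy' : IsTail I x y := ⟨fun k hk => h.1 (by simp [hk]), h.2⟩
    simp at hl
    rw [← mul_assoc] at hc
    by_cases hij : i = j
    · subst hij
      exact ⟨_, rfl⟩
    by_cases hf : i + 2 ≤ j ∨ j + 2 ≤ i
    · obtain ⟨w, h₁, -⟩ := mul_g_far hf hc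
      obtain ⟨y', rfl⟩ := ih (len y) (by omega) hy' hj ⟨w, h₁⟩ rfl
      exact ⟨y' * g i, by rw [mul_assoc, mul_assoc, g_comm hf]⟩
    · have hn : i + 1 = j ∨ j + 1 = i := by omega
      obtain ⟨w, h₁, -⟩ := mul_g_near hn hc
      obtain ⟨y', rfl⟩ := ih (len y) (by omega) hy' hj ⟨w * g i, h₁⟩ rfl
      have hy'' : IsTail I x y' := ⟨fun k hk => hy'.1 (by simp [hk]), h.2⟩
      rw [← mul_assoc] at h₁
      obtain ⟨y'', rfl⟩ := ih (len y') (by simp at hl; omega) hy'' hI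
        ⟨w, mul_right_cancel h₁⟩ rfl
      exact ⟨y'' * g j * g i, by simp only [mul_assoc]; congr 1; simpa [mul_assoc] using g_braid hn⟩

/-- The tail collects all right divisors with letters in `I`. -/
theorem IsTail.exists_eq {I : Set ℤ} {x y : PB} (h : IsTail I x y) {c d : PB} (hc : lett c ⊆ I)
    (e : x * y = d * c) : ∃ y', y = y' * c := by
  induction c using induction_right generalizing y with
  | one => exact ⟨y, by simp⟩
  | mul_g c i ih =>
    simp at hc
    obtain ⟨y', rfl⟩ := h.ends (j := i) (hc (by simp)) ⟨d * c, by rw [e, mul_assoc]⟩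
    simp only [← mul_assoc] at e
    have hy : IsTail I x y' := ⟨fun k hk => h.1 (by simp [hk]), h.2⟩
    obtain ⟨y'', rfl⟩ := ih hy (fun k hk => hc (by simp [hk])) (mul_right_cancel e)
    exact ⟨y'', by rw [mul_assoc]⟩

end PB
end PosBraid

namespace PosBraid
namespace PB

open Set

theorem mul_g_of_far {x : PB} {j : ℤ} (h : ∀ i ∈ lett x, i + 2 ≤ j ∨ j + 2 ≤ i) :
    x * g j = g j * x := by
  induction x using induction_right with
  | one => simp
  | mul_g x i ih =>
    rw [mul_assoc, g_comm (h i (by simp)), ← mul_assoc, ih fun k hk => h k (by simp [hk]),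
      mul_assoc]

/-- The word `[k - 1, …, 1, 0]`. -/
def dlist : ℕ → List ℤ
  | 0 => []
  | k + 1 => (k : ℤ) :: dlist k

/-- The braid `g (k - 1) ⋯ g 0`. -/
def dn (k : ℕ) : PB := mk (dlist k)

/-- The braid `g 0 ⋯ g (k - 1)`. -/
def up (k : ℕ) : PB := rev (dn k)

@[simp] theorem dn_zero : dn 0 = 1 := rfl

theorem dn_succ (k : ℕ) : dn (k + 1) = g k * dn k := rfl

theorem lett_dn (k : ℕ) : lett (dn k) ⊆ Ico 0 (k : ℤ) := by
  induction k with
  | zero => simp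
  | succ k ih =>
    intro i hi
    simp [dn_succ] at hi
    rcases hi with rfl | hi
    · simp
    · have := ih hi
      simp at this ⊢
      omega

theorem lett_rev (x : PB) : lett (rev x) = lett x := by
  obtain ⟨u, rfl⟩ := exists_mk x
  simp [rev_mk, lett_mk]

theorem lett_up (k : ℕ) : lett (up k) ⊆ Ico 0 (k : ℤ) := by
  rw [up, lett_rev]
  exact lett_dn k

theorem dn_succ' (k : ℕ) : dn (k + 1) = sh 1 (dn k) * g 0 := by
  induction k with
  | zero => simp [dn_succ]
  | succ k ih =>
    rw [dn_succ (k + 1)]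
    nth_rw 1 [ih]
    rw [dn_succ k]
    simp [mul_assoc]

theorem dn_mul_g {k : ℕ} {j : ℤ} (h1 : 1 ≤ j) (h2 : j < k) :
    dn k * g j = g (j - 1) * dn k := by
  induction k with
  | zero => simp at h2; omega
  | succ k ih =>
    push_cast at h2
    rw [dn_succ, mul_assoc]
    by_cases hj : j < k
    · rw [ih hj, ← mul_assoc, g_comm (by omega), mul_assoc]
    · obtain rfl : j = k := by omega
      obtain ⟨k, rfl⟩ : ∃ k', k = k' + 1 := ⟨k - 1, by omega⟩
      rw [dn_succ, mul_assoc (g (k : ℤ)), mul_g_of_far (j := ((k + 1 : ℕ) : ℤ))]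
      · push_cast
        have := congrArg (· * dn k) (g_braid (i := (k : ℤ) + 1) (j := k) (by omega))
        simp only [mul_assoc] at this
        simpa using this
      · intro i hi
        have := lett_dn k hi
        simp at this
        push_cast
        omega

theorem dn_mul {k : ℕ} {x : PB} (h : lett x ⊆ Ico 1 (k : ℤ)) :
    dn k * x = sh (-1) x * dn k := by
  induction x using induction_right with
  | one => simp
  | mul_g x i ih =>
    have hi := h (by simp : i ∈ _)
    rw [← mul_assoc, ih fun k hk => h (by simp [hk]), mul_assoc, dn_mul_g hi.1 hi.2]
    simp [mul_assoc, sub_eq_add_neg]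

theorem mul_dn {k : ℕ} {x : PB} (h : lett x ⊆ Ico 0 ((k : ℤ) - 1)) :
    x * dn k = dn k * sh 1 x := by
  rw [dn_mul]
  · simp
  · intro i hi
    have := h (by simpa using hi : i - 1 ∈ _)
    simp at this ⊢
    omega

theorem rev_sh (c : ℤ) (x : PB) : rev (sh c x) = sh c (rev x) := by
  obtain ⟨u, rfl⟩ := exists_mk x
  simp [sh, mapHom_mk, rev_mk]

theorem up_mul {k : ℕ} {x : PB} (h : lett x ⊆ Ico 0 ((k : ℤ) - 1)) :
    up k * x = sh 1 x * up k := by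
  have := congrArg rev (mul_dn (k := k) (x := rev x) (by rwa [lett_rev]))
  simpa [up, rev_sh] using this

@[simp] theorem up_zero : up 0 = 1 := rfl

theorem up_succ (k : ℕ) : up (k + 1) = up k * g k := by
  simp [up, dn_succ]

theorem up_succ' (k : ℕ) : up (k + 1) = g 0 * sh 1 (up k) := by
  rw [up, dn_succ']
  simp [up, rev_sh]

/-- The half twist on the letters `0, …, m - 1`. -/
def D : ℕ → PB
  | 0 => 1
  | m + 1 => dn (m + 1) * sh 1 (D m)

theorem lett_sh_one {m : ℕ} {x : PB} (h : lett x ⊆ Ico 0 (m : ℤ)) :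
    lett (sh 1 x) ⊆ Ico 1 ((m : ℤ) + 1) := by
  intro i hi
  have := h (by simpa using hi : i - 1 ∈ _)
  simp at this ⊢
  omega

theorem lett_D (m : ℕ) : lett (D m) ⊆ Ico 0 (m : ℤ) := by
  induction m with
  | zero => simp [D]
  | succ m ih =>
    rw [D, lett_mul]
    refine union_subset (lett_dn _) ((lett_sh_one ih).trans ?_)
    intro i hi
    simp at hi ⊢
    omega

theorem D_succ (m : ℕ) : D (m + 1) = D m * dn (m + 1) := by
  rw [D, dn_mul]
  · simp
  · simpa using lett_sh_one (lett_D m)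

theorem D_succ' (m : ℕ) : D (m + 1) = sh 1 (D m) * up (m + 1) := by
  induction m with
  | zero => simp [D, up, dn_succ]
  | succ m ih =>
    have hc : g 0 * sh 1 (sh 1 (D m)) = sh 1 (sh 1 (D m)) * g 0 := by
      rw [mul_g_of_far]
      intro i hi
      have := lett_D m (by simpa using hi : i - (1 + 1) ∈ _)
      simp at this
      omega
    calc D (m + 1 + 1) = dn (m + 1 + 1) * sh 1 (D (m + 1)) := rfl
      _ = sh 1 (dn (m + 1)) * (g 0 * sh 1 (sh 1 (D m))) * sh 1 (up (m + 1)) := by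
        rw [dn_succ', ih]
        simp only [map_mul, mul_assoc]
      _ = sh 1 (D (m + 1)) * up (m + 1 + 1) := by
        rw [hc, up_succ' (m + 1), D, map_mul]
        simp only [mul_assoc]

theorem g_mul_D {m : ℕ} {i : ℤ} (h0 : 0 ≤ i) (hm : i < m) :
    g i * D m = D m * g (m - 1 - i) := by
  induction m generalizing i with
  | zero => simp at hm; omega
  | succ m ih =>
    push_cast at hm
    by_cases hi : i < m
    · rw [D_succ, ← mul_assoc, ih h0 hi, mul_assoc, mul_assoc, dn_mul_g (by omega)
        (by push_cast; omega)]
      congr 3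
      push_cast
      ring
    · obtain rfl : i = m := by omega
      cases m with
      | zero => simp [D, dn_succ]
      | succ m =>
        have hc : g ((m + 1 : ℕ) : ℤ) * D m = D m * g ((m + 1 : ℕ) : ℤ) := by
          rw [mul_g_of_far]
          intro i hi
          have := lett_D m hi
          simp at this
          push_cast
          omega
        have hd : dn (m + 1) * (dn (m + 1 + 1) * g 0) = dn (m + 1 + 1) * dn (m + 1 + 1) := by
          nth_rw 4 [dn_succ']
          rw [← mul_assoc, mul_dn, mul_assoc]
          intro i hi
          have := lett_dn _ hi
          push_cast at this ⊢
          simp at this ⊢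
          omega
        rw [D_succ, D_succ, ← mul_assoc, ← mul_assoc, hc]
        simp only [mul_assoc]
        rw [← mul_assoc (g _) (dn (m + 1)), ← dn_succ]
        push_cast
        simp only [add_sub_cancel_right, sub_self]
        rw [hd]

theorem mul_D {m : ℕ} {x : PB} (h : lett x ⊆ Ico 0 (m : ℤ)) :
    x * D m = D m * fl (m - 1) x := by
  induction x using induction_right with
  | one => simp
  | mul_g x i ih =>
    have hi := h (by simp : i ∈ _)
    rw [mul_assoc, g_mul_D hi.1 hi.2, ← mul_assoc, ih fun k hk => h (by simp [hk])]
    simp [mul_assoc]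

theorem lett_fl {m : ℕ} {x : PB} (h : lett x ⊆ Ico 0 (m : ℤ)) :
    lett (fl (m - 1) x) ⊆ Ico 0 (m : ℤ) := by
  intro i hi
  have := h (by simpa using hi : (m : ℤ) - 1 - i ∈ _)
  simp at this ⊢
  omega

theorem D_mul {m : ℕ} {x : PB} (h : lett x ⊆ Ico 0 (m : ℤ)) :
    D m * x = fl (m - 1) x * D m := by
  rw [mul_D (lett_fl h), fl_fl]

theorem D_sq_mul {m : ℕ} {x : PB} (h : lett x ⊆ Ico 0 (m : ℤ)) :
    D m ^ 2 * x = x * D m ^ 2 := by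
  rw [sq, mul_assoc, D_mul h, ← mul_assoc, D_mul (lett_fl h), fl_fl, mul_assoc]

/-- The braid `g 0 ⋯ g (m - 1) g (m - 1) ⋯ g 0`. -/
def theta (m : ℕ) : PB := up m * dn m

theorem theta_mul {m : ℕ} {x : PB} (h : lett x ⊆ Ico 1 (m : ℤ)) :
    theta m * x = x * theta m := by
  have h' : lett (sh (-1) x) ⊆ Ico 0 ((m : ℤ) - 1) := by
    intro i hi
    have := h (by simpa using hi : i + 1 ∈ _)
    simp at this ⊢
    omega
  rw [theta, mul_assoc, dn_mul h, ← mul_assoc, up_mul h']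
  simp [mul_assoc]

theorem up_pow {m k : ℕ} (hk : k ≤ m) : up m ^ k = dn k * sh 1 (up (m - 1)) ^ k := by
  induction k with
  | zero => simp
  | succ k ih =>
    obtain ⟨m, rfl⟩ : ∃ m', m = m' + 1 := ⟨m - 1, by omega⟩
    rw [pow_succ', ih (by omega), ← mul_assoc, up_mul]
    · rw [dn_succ', up_succ']
      simp only [mul_assoc, add_tsub_cancel_right]
      rw [← pow_succ']
    · refine (lett_dn k).trans ?_
      intro i hi
      simp at hi ⊢
      omega

theorem up_pow_succ (m : ℕ) : up (m + 1) ^ (m + 2) = theta (m + 1) * sh 1 (up m ^ (m + 1)) := by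
  rw [pow_succ', up_pow le_rfl, theta, mul_assoc, map_pow]
  simp

theorem D_sq_succ (m : ℕ) : D (m + 1) ^ 2 = theta (m + 1) * sh 1 (D m ^ 2) := by
  have hl : lett (sh 1 (D m)) ⊆ Ico 1 ((m + 1 : ℕ) : ℤ) := by
    simpa using lett_sh_one (lett_D m)
  rw [sq, D_succ' m]
  nth_rw 2 [← D_succ']
  rw [D, mul_assoc, ← mul_assoc (up _), ← theta, ← mul_assoc, ← theta_mul hl, mul_assoc, ← map_mul,
    ← sq]

theorem D_sq (m : ℕ) : D m ^ 2 = up m ^ (m + 1) := by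
  induction m with
  | zero => simp [D]
  | succ m ih => rw [D_sq_succ, ih, up_pow_succ]

end PB
end PosBraid

namespace PosBraid
open PB Set
open scoped List

/-- Every word representing `z` contains the word `[k - 1, …, 0]` as a subword. -/
def Contains (k : ℕ) (z : PB) : Prop := ∀ u, mk u = z → dlist k <+ u

/-- `x` ends with the braid `y`. -/
def EndsW (x y : PB) : Prop := ∃ c, x = c * y

theorem EndsW.mul_left {x y : PB} (h : EndsW x y) (z : PB) : EndsW (z * x) y := by
  obtain ⟨c, rfl⟩ := h
  exact ⟨z * c, by rw [mul_assoc]⟩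

theorem ends_dn {k : ℕ} (hk : 1 ≤ k) (c : PB) : Ends (c * dn k) 0 := by
  obtain ⟨k, rfl⟩ : ∃ k', k = k' + 1 := ⟨k - 1, by omega⟩
  exact ⟨c * sh 1 (dn k), by rw [dn_succ', mul_assoc]⟩

/-- Pushing a descending run through a word which does not contain it. -/
theorem ends_of_not_sublist (u : List ℤ) (hu : ∀ i ∈ u, 1 ≤ i) {k : ℕ} (hk : 1 ≤ k)
    (h : ¬ (dlist k).map (· + 1) <+ u) (c : PB) : Ends (c * dn k * mk u) 0 := by
  induction u generalizing k c with
  | nil => simpa [mk_nil] using ends_dn hk c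
  | cons j u ih =>
    have hj : 1 ≤ j := hu j (by simp)
    have hu' : ∀ i ∈ u, 1 ≤ i := fun i hi => hu i (by simp [hi])
    have h' : ¬ (dlist k).map (· + 1) <+ u := fun h' => h (h'.cons j)
    rw [mk_cons, ← mul_assoc]
    rcases lt_trichotomy j (k : ℤ) with hjk | rfl | hjk
    · rw [mul_assoc c, dn_mul_g hj hjk, ← mul_assoc]
      exact ih hu' hk h' _
    · obtain ⟨k, rfl⟩ : ∃ k', k = k' + 1 := ⟨k - 1, by omega⟩
      have hc : dn k * g ((k + 1 : ℕ) : ℤ) = g ((k + 1 : ℕ) : ℤ) * dn k := by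
        refine mul_g_of_far fun i hi => ?_
        have := lett_dn k hi
        simp at this
        push_cast
        omega
      have h'' : ¬ (dlist k).map (· + 1) <+ u := by
        intro h''
        apply h
        simp only [dlist, List.map_cons]
        push_cast
        exact h''.cons_cons _
      rw [dn_succ, mul_assoc c, mul_assoc (g (k : ℤ)), hc, ← mul_assoc, ← mul_assoc]
      rcases Nat.eq_zero_or_pos k with rfl | hk'
      · simp [dlist] at h''
      · exact ih hu' hk' h'' _
    · rw [mul_assoc c, mul_g_of_far (j := j), ← mul_assoc]
      · exact ih hu' hk h' _
      · intro i hi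
        have := lett_dn k hi
        simp at this
        omega

theorem contains_of_not_ends {v y : PB} {k : ℕ} (hk : 1 ≤ k) (hv : EndsW v (dn k))
    (hy : lett y ⊆ Ici 1) (h : ¬ Ends (v * y) 0) : Contains k (sh (-1) y) := by
  intro u hu
  by_contra hs
  obtain ⟨c, rfl⟩ := hv
  apply h
  have hy' : y = mk (u.map (· + 1)) := by
    have := congrArg (sh 1) hu
    simp at this
    rw [← this]
    rfl
  subst hy'
  refine ends_of_not_sublist _ (fun i hi => hy hi) hk ?_ c
  intro hs'
  apply hs
  have := hs'.map (· + (-1))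
  simpa [List.map_map, Function.comp_def] using this

theorem exists_maximal_dn (v : PB) : ∃ k, EndsW v (dn k) ∧ ¬ EndsW v (dn (k + 1)) := by
  by_contra! h
  have h1 : ∀ k, EndsW v (dn k) := by
    intro k
    induction k with
    | zero => exact ⟨v, by simp⟩
    | succ k ih => exact h k ih
  have hl : ∀ k, len (dn k) = k := by
    intro k
    induction k with
    | zero => rfl
    | succ k ih => rw [dn_succ]; simp [ih]; omega
  obtain ⟨c, hc⟩ := h1 (len v + 1)
  have := congrArg len hc
  rw [len_mul, hl] at this
  omega

theorem dlist_eq_append {k l : ℕ} (h : k ≤ l) :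
    ∃ A, dlist l = A ++ dlist k ∧ (∀ a ∈ A, (k : ℤ) ≤ a) ∧ A.length = l - k := by
  induction l, h using Nat.le_induction with
  | base => exact ⟨[], by simp⟩
  | succ l hl ih =>
    obtain ⟨A, h1, h2, h3⟩ := ih
    refine ⟨(l : ℤ) :: A, by simp [dlist, h1], ?_, by simp [h3]; omega⟩
    intro a ha
    rcases List.mem_cons.1 ha with rfl | ha
    · simpa using hl
    · exact h2 a ha

theorem length_dlist (k : ℕ) : (dlist k).length = k := by
  induction k with
  | zero => rfl
  | succ k ih => simp [dlist, ih]

theorem Contains.mem {k : ℕ} {z : PB} (h : Contains (k + 1) z) : (k : ℤ) ∈ lett z := by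
  obtain ⟨u, rfl⟩ := exists_mk z
  exact (h u rfl).subset (by simp [dlist])

theorem Contains.zero_mem {k : ℕ} (hk : 1 ≤ k) {z : PB} (h : Contains k z) : 0 ∈ lett z := by
  obtain ⟨u, rfl⟩ := exists_mk z
  obtain ⟨A, hA, -⟩ := dlist_eq_append hk
  exact (h u rfl).subset (by simp [hA, dlist])

/-- The subword `[l - 1, …, k - 1]` occurs in `c`, when `k` is maximal such that `c * dn k`
ends with `dn k`. -/
theorem exists_sublist_of_contains {c y : PB} {k l : ℕ} (hk : 1 ≤ k) (hkl : k < l)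
    (hv : ∀ i, Ends (c * dn k) i → i = 0) (hv0 : lett (c * dn k) ⊆ Ici 0)
    (hmax : ¬ EndsW (c * dn k) (dn (k + 1)))
    (hy : lett y ⊆ Ici 1) (hz : Contains l (c * dn k * y)) :
    ∃ A u, mk u = c ∧ A <+ u ∧ dlist l = A ++ dlist (k - 1) := by
  obtain ⟨u, rfl⟩ := exists_mk c
  obtain ⟨t, rfl⟩ := exists_mk y
  obtain ⟨A, hA, hA', hAl⟩ := dlist_eq_append hkl.le
  have h1 := hz (u ++ dlist k ++ t) (by simp only [mk_append]; rfl)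
  obtain ⟨l₁, l₂, e₁, h₁, h₂⟩ := List.sublist_append_iff.1 h1
  have hl₂ : l₂ = [] := by
    by_contra hne
    obtain ⟨B, hB, -⟩ := dlist_eq_append (hk.trans hkl.le)
    have h0 : (l₁ ++ l₂).getLast? = (B ++ dlist 1).getLast? := by rw [← hB, e₁]
    have h0' : l₂.getLast? = some 0 := by
      rw [List.getLast?_append_of_ne_nil _ hne] at h0
      simpa [dlist] using h0
    have := hy (h₂.subset (List.mem_of_getLast? h0') : (0 : ℤ) ∈ t)
    simp at this
  subst hl₂
  rw [List.append_nil] at e₁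
  subst e₁
  obtain ⟨l₃, l₄, e₂, h₃, h₄⟩ := List.sublist_append_iff.1 h₁
  have hl₄ := h₄.length_le
  have hlen := congrArg List.length e₂
  rw [length_dlist] at hlen hl₄
  rw [List.length_append] at hlen
  have hpre : A <+: l₃ := by
    refine List.prefix_of_prefix_length_le (l₃ := dlist l) ⟨_, hA.symm⟩ ⟨_, e₂.symm⟩ ?_
    omega
  have hAu : A <+ u := hpre.sublist.trans h₃
  have hAne : A ≠ [] := by
    rintro rfl
    simp at hAl
    omega
  rcases List.eq_nil_or_concat u with rfl | ⟨u', j, rfl⟩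
  · exact absurd (List.sublist_nil.1 hAu) hAne
  rw [List.concat_eq_append] at *
  have hj : j = (k : ℤ) - 1 := by
    have hj0 : 0 ≤ j := hv0 (by simp [mk_append, mk_singleton])
    rw [mk_append, mk_singleton, mul_assoc] at hv hmax
    rcases lt_trichotomy j ((k : ℤ) - 1) with h | h | h
    · have e := mul_dn (k := k) (x := g j) (by simp; omega)
      rw [e, ← mul_assoc] at hv
      have := hv (j + 1) ⟨_, rfl⟩
      omega
    · exact h
    · rcases eq_or_ne j (k : ℤ) with rfl | hjk
      · exact absurd ⟨_, rfl⟩ hmax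
      · rw [← mul_g_of_far, ← mul_assoc] at hv
        · have := hv j ⟨_, rfl⟩
          omega
        · intro i hi
          have := lett_dn k hi
          simp at this
          omega
  subst hj
  refine ⟨A ++ [(k : ℤ) - 1], _, rfl, ?_, ?_⟩
  · refine List.Sublist.append_right ?_ _
    obtain ⟨l₅, l₆, e₅, h₅, h₆⟩ := List.sublist_append_iff.1 hAu
    rcases List.sublist_singleton.1 h₆ with rfl | rfl
    · rw [e₅, List.append_nil]
      exact h₅
    · have := hA' ((k : ℤ) - 1) (by simp [e₅])
      omega
  · obtain ⟨k, rfl⟩ : ∃ k', k = k' + 1 := ⟨k - 1, by omega⟩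
    rw [hA]
    simp [dlist]

variable {G : Type*} [Group G]

/-- A right-invariant preorder on `G` for which positive braids increase, and which does not
see left multiplication by the generators of positive index. -/
structure PosOrder (φ : PB →* G) (le : G → G → Prop) : Prop where
  refl : ∀ a, le a a
  trans : ∀ {a b c}, le a b → le b c → le a c
  mul_right : ∀ {a b}, le a b → ∀ c, le (a * c) (b * c)
  pos : ∀ a i, le a (a * φ (g i))
  fix : ∀ i, 1 ≤ i → le (φ (g i)) 1

namespace PosOrder

variable {φ : PB →* G} {le : G → G → Prop} (h : PosOrder φ le)
include h

theorem le_mul (a : G) (x : PB) : le a (a * φ x) := by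
  induction x using induction_right with
  | one => simpa using h.refl a
  | mul_g x i ih => rw [map_mul, ← mul_assoc]; exact h.trans ih (h.pos _ i)

theorem le_mul_left (x : PB) (a : G) : le a (φ x * a) := by
  simpa using h.mul_right (h.le_mul 1 x) a

theorem fix_le {x : PB} (hx : lett x ⊆ Ici 1) (a : G) : le (φ x * a) a := by
  induction x using induction_right generalizing a with
  | one => simpa using h.refl a
  | mul_g x i ih =>
    rw [map_mul, mul_assoc]
    refine h.trans (ih (fun k hk => hx (by simp [hk])) _) ?_
    simpa using h.mul_right (h.fix i (hx (by simp))) a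

theorem sublist_le {u v : List ℤ} (hs : u <+ v) (a : G) :
    le (a * φ (PB.mk u)) (a * φ (PB.mk v)) := by
  induction hs generalizing a with
  | slnil => exact h.refl _
  | cons i hs ih =>
    refine h.trans (ih a) ?_
    rw [mk_cons, map_mul, ← mul_assoc]
    exact h.mul_right (h.pos a i) _
  | cons_cons i hs ih =>
    simp only [mk_cons, map_mul, ← mul_assoc]
    exact ih _

theorem contains_le {k : ℕ} {z : PB} (hz : Contains k z) (a : G) :
    le (a * φ (dn k)) (a * φ z) := by
  obtain ⟨u, rfl⟩ := exists_mk z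
  exact h.sublist_le (hz u rfl) a

theorem g_le_dn {k : ℕ} (hk : 1 ≤ k) : le (φ (g 0)) (φ (dn k)) := by
  obtain ⟨k, rfl⟩ : ∃ k', k = k' + 1 := ⟨k - 1, by omega⟩
  rw [dn_succ', map_mul]
  exact h.le_mul_left _ _

theorem inv_le_of_le {w q : G} (hq : le 1 (q * w)) : le w⁻¹ q := by
  simpa using h.mul_right hq w⁻¹

theorem dn_inv_le {k : ℕ} {w : PB} (hw : lett w ⊆ Ico 0 ((k : ℤ) - 1)) :
    le (φ (dn k))⁻¹ (φ w)⁻¹ := by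
  have e := congrArg φ (mul_dn hw)
  simp only [map_mul] at e
  have e' : (φ (dn k))⁻¹ * φ w = φ (sh 1 w) * (φ (dn k))⁻¹ := by
    rw [inv_mul_eq_iff_eq_mul, ← mul_assoc, eq_mul_inv_iff_mul_eq, e]
  have h1 : le (φ (sh 1 w) * (φ (dn k))⁻¹) (φ (dn k))⁻¹ := by
    refine h.fix_le (fun i hi => ?_) _
    have := hw (by simpa using hi : i - 1 ∈ _)
    simp at this ⊢
    omega
  have h2 : le (φ (dn k))⁻¹ 1 := by
    simpa using h.mul_right (h.le_mul 1 (dn k)) (φ (dn k))⁻¹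
  have h3 := h.trans h1 h2
  rw [← e'] at h3
  simpa using h.mul_right h3 (φ w)⁻¹

/-- Replacing the base point by its image under the first generator. -/
theorem shift : PosOrder (φ.comp (sh 1)) (fun a b => le (φ (g 0) * a) (φ (g 0) * b)) where
  refl _ := h.refl _
  trans := h.trans
  mul_right hab c := by simpa only [mul_assoc] using h.mul_right hab c
  pos a i := by
    simpa only [mul_assoc, MonoidHom.comp_apply, sh_g] using h.pos (φ (g 0) * a) (i + 1)
  fix i hi := by
    have := h.mul_right (h.fix (i + 1) (by omega)) (φ (g 0))
    rw [← map_mul, ← g_comm (by omega)] at this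
    simpa using this

/-- The starting inequality for the right half of a factorisation. -/
theorem exists_le_of_contains {q : G} {w v y : PB} {k l : ℕ} (hk : 1 ≤ k)
    (hw : lett w ⊆ Ico 0 ((l : ℤ) - 1)) (hq : le 1 (q * φ w))
    (hv : ∀ i, Ends v i → i = 0) (hv0 : lett v ⊆ Ici 0)
    (hvk : EndsW v (dn k)) (hmax : ¬ EndsW v (dn (k + 1)))
    (hy : lett y ⊆ Ici 1) (hz : Contains l (v * y)) :
    ∃ w', lett w' ⊆ Ico 1 (k : ℤ) ∧ le (φ (g 0)) (q * φ v * φ w') := by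
  obtain ⟨c, rfl⟩ := hvk
  suffices hs : ∃ w', lett w' ⊆ Ico 0 ((k : ℤ) - 1) ∧ le 1 (q * φ c * φ w') by
    obtain ⟨w', hw', hle⟩ := hs
    refine ⟨sh 1 w', ?_, ?_⟩
    · intro i hi
      have := hw' (by simpa using hi : i - 1 ∈ _)
      simp at this ⊢
      omega
    · refine h.trans (h.g_le_dn hk) ?_
      have e := congrArg φ (mul_dn hw')
      rw [map_mul, map_mul] at e
      rw [map_mul, mul_assoc, mul_assoc, ← e, ← mul_assoc, ← mul_assoc]
      simpa using h.mul_right hle (φ (dn k))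
  by_cases hkl : l ≤ k
  · refine ⟨w, hw.trans (Ico_subset_Ico_right (by omega)), h.trans hq ?_⟩
    exact h.mul_right (h.le_mul q c) _
  · obtain ⟨A, u, rfl, hA, hl⟩ := exists_sublist_of_contains hk (by omega) hv hv0 hmax hy hz
    refine ⟨dn (k - 1), ?_, ?_⟩
    · have := lett_dn (k - 1)
      rwa [Nat.cast_sub hk, Nat.cast_one] at this
    · have h1 := h.mul_right (h.trans (h.dn_inv_le hw) (h.inv_le_of_le hq)) (φ (PB.mk A))
      have h2 := h.mul_right (h.trans h1 (h.sublist_le hA q)) (φ (dn (k - 1)))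
      have e : φ (dn l) = φ (PB.mk A) * φ (dn (k - 1)) := by
        rw [← map_mul, dn, dn, hl, mk_append]
      rw [mul_assoc, ← e] at h2
      simpa using h2

end PosOrder

end PosBraid

namespace PosBraid
open PB Set

theorem sh_fl (c : ℤ) (x : PB) : sh 1 (fl c x) = fl (c + 1) x := by
  induction x using induction_right with
  | one => simp
  | mul_g x i ih => rw [map_mul, map_mul, map_mul, ih]; simp; congr 1; ring

theorem fl_dn (m : ℕ) : fl ((m : ℤ) - 1) (dn m) = up m := by
  induction m with
  | zero => simp
  | succ m ih =>
    rw [dn_succ, up_succ', ← ih, map_mul, sh_fl]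
    simp

theorem EndsW.map {x y : PB} (h : EndsW x y) (f : PB →* PB) : EndsW (f x) (f y) := by
  obtain ⟨c, rfl⟩ := h
  exact ⟨f c, map_mul _ _ _⟩

variable {G : Type*} [Group G]

/-- After a positive twist, `w` witnesses that some braid over few letters pushes `q * φ y` beyond
`D m * g (m - 1)`. -/
def Gap (φ : PB →* G) (le : G → G → Prop) (m l : ℕ) (q : G) (y : PB) : Prop :=
  EndsW y (fl ((m : ℤ) - 1) (dn l)) ∧ ∃ w, lett w ⊆ Ico ((m : ℤ) - l) ((m : ℤ) - 1) ∧
    le (φ (D m * g ((m : ℤ) - 1))) (q * φ (y * w))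

variable (G) in
/-- Induction hypothesis for a factor over the letters `1, …, m - 1`. -/
def LeftStep (m : ℕ) : Prop :=
  ∀ (φ : PB →* G) (le : G → G → Prop), PosOrder φ le → ∀ (q : G) (v w y : PB) (k : ℕ), 1 ≤ k →
    EndsW v (dn k) → lett w ⊆ Ico 1 (k : ℤ) → le (φ (g 0)) (q * φ w) →
    lett y ⊆ Ico 1 (m : ℤ) → (∀ i, Ends (v * y) i → i = (m : ℤ) - 1) → y ≠ 1 →
    le (φ (D m)) (q * φ y) ∧
      (¬ EndsW (v * y) (up m) → ∃ l, l + 1 ≤ m ∧ Gap φ le m l q y)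

variable (G) in
/-- Induction hypothesis for a factor over the letters `0, …, m - 1`. -/
def RightStep (m : ℕ) : Prop :=
  ∀ (φ : PB →* G) (le : G → G → Prop), PosOrder φ le → ∀ (q : G) (w z : PB) (k : ℕ), 1 ≤ k →
    lett w ⊆ Ico 0 ((k : ℤ) - 1) → le 1 (q * φ w) → lett z ⊆ Ico 0 (m : ℤ) → z ≠ 1 →
    (∀ i, Ends z i → i = (m : ℤ) - 1) → Contains k z →
    le (φ (D m)) (q * φ z) ∧ (¬ EndsW z (up m) → ∃ l, l ≤ m ∧ Gap φ le m l q z)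

namespace PosOrder

theorem gap_of_up {φ : PB →* G} {le : G → G → Prop} (h : PosOrder φ le) {m : ℕ} (hm : 1 ≤ m)
    {q : G} {w z : PB} {k : ℕ}
    (hk : 1 ≤ k) (hw : lett w ⊆ Ico 0 ((k : ℤ) - 1)) (hq : le 1 (q * φ w))
    (hz : lett z ⊆ Ico 0 (m : ℤ)) (hc : Contains k z) : Gap φ le m m q (z * up m) := by
  obtain ⟨m, rfl⟩ : ∃ m', m = m' + 1 := ⟨m - 1, by omega⟩
  have hkm : k ≤ m + 1 := by
    obtain ⟨k, rfl⟩ : ∃ k', k = k' + 1 := ⟨k - 1, by omega⟩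
    have := hz hc.mem
    simp at this
    omega
  have hwm : lett w ⊆ Ico 0 (((m + 1 : ℕ) : ℤ) - 1) := hw.trans (Ico_subset_Ico_right (by omega))
  refine ⟨⟨z, by rw [fl_dn]⟩, w * up m, ?_, ?_⟩
  · simp only [lett_mul, union_subset_iff, sub_self]
    exact ⟨hwm, by simpa using lett_up m⟩
  · have h1 : le (φ (g 0)) (q * φ (z * sh 1 w)) := by
      have h2 := h.mul_right (h.contains_le hc q) (φ (sh 1 w))
      rw [mul_assoc, ← map_mul, ← mul_dn hw, map_mul, ← mul_assoc] at h2
      rw [map_mul, ← mul_assoc]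
      refine h.trans (h.g_le_dn hk) (h.trans ?_ h2)
      simpa using h.mul_right hq (φ (dn k))
    have e1 : z * up (m + 1) * (w * up m) = z * sh 1 w * (up (m + 1) * up m) := by
      simp only [mul_assoc]
      rw [← mul_assoc (up (m + 1)), up_mul hwm]
      simp only [mul_assoc]
    have e2 : g 0 * (up (m + 1) * up m) = up (m + 1) * up (m + 1) := by
      rw [PB.up_mul (by simpa using lett_up m), ← mul_assoc, ← up_succ']
    have h3 := h.mul_right h1 (φ (up (m + 1) * up m))
    rw [← map_mul, e2, mul_assoc, ← map_mul, ← e1] at h3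
    refine h.trans ?_ h3
    rw [D_succ', map_mul, map_mul, mul_assoc]
    refine h.trans (h.fix_le ?_ _) ?_
    · exact (lett_sh_one (lett_D m)).trans fun i hi => hi.1
    · rw [map_mul]
      nth_rewrite 3 [up_succ]
      rw [map_mul, ← mul_assoc]
      have := h.mul_right (h.le_mul (φ (up (m + 1))) (up m)) (φ (g m))
      simpa using this

end PosOrder

theorem rightStep_one : RightStep G 1 := by
  intro φ le h q w z k hk hw hq hz hz1 hzi hc
  have h1 : k = 1 := by
    obtain ⟨k, rfl⟩ : ∃ k', k = k' + 1 := ⟨k - 1, by omega⟩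
    have := hz hc.mem
    simp at this
    omega
  subst h1
  have hw1 : w = 1 := by
    obtain ⟨u, rfl⟩ := exists_mk w
    cases u with
    | nil => rfl
    | cons a u =>
      have : a ∈ Ico (0 : ℤ) (((1 : ℕ) : ℤ) - 1) := hw (by simp [lett_mk])
      simp at this
  subst hw1
  refine ⟨?_, fun hu => ?_⟩
  · have h2 := h.contains_le hc q
    refine h.trans ?_ h2
    have h3 := h.mul_right hq (φ (dn 1))
    simpa [D] using h3
  · exfalso
    obtain ⟨i, hi⟩ := exists_ends hz1
    have := hzi i hi
    apply hu
    obtain ⟨c, rfl⟩ := hi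
    exact ⟨c, by subst this; simp [up_succ]⟩

theorem rightStep_of_leftStep {m : ℕ} (hm : 2 ≤ m) (hK : LeftStep G m) : RightStep G m := by
  intro φ le h q w z k hk hw hq hz hz1 hzi hc
  obtain ⟨v, y, rfl, hvy⟩ := exists_isTail (Ico 1 (m : ℤ)) z
  simp only [lett_mul, union_subset_iff] at hz
  have hv : ∀ i, Ends v i → i = 0 := by
    intro i hi
    by_contra h0
    have := hz.1 hi.mem_lett
    simp at this
    exact hvy.2 i (by simp; omega) hi
  have hy1 : y ≠ 1 := by
    rintro rfl
    rw [mul_one] at *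
    obtain ⟨i, hi⟩ := exists_ends hz1
    have := hzi i hi
    have := hv i hi
    omega
  have hv1 : v ≠ 1 := by
    rintro rfl
    rw [one_mul] at *
    have := hvy.1 (hc.zero_mem hk)
    simp at this
  obtain ⟨μ, hμ, hμ'⟩ := exists_maximal_dn v
  have hμ1 : 1 ≤ μ := by
    by_contra h0
    obtain rfl : μ = 0 := by omega
    obtain ⟨i, hi⟩ := exists_ends hv1
    obtain rfl := hv i hi
    obtain ⟨c, rfl⟩ := hi
    exact hμ' ⟨c, by simp [dn_succ]⟩
  obtain ⟨w', hw', hle⟩ := h.exists_le_of_contains hμ1 hw hq hv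
    (hz.1.trans fun i hi => hi.1) hμ hμ' (hvy.1.trans fun i hi => hi.1) hc
  obtain ⟨h1, h2⟩ := hK φ le h (q * φ v) v w' y μ hμ1 hμ hw' hle hvy.1 hzi hy1
  refine ⟨by simpa [mul_assoc] using h1, fun hu => ?_⟩
  obtain ⟨l, hl, h3, w'', h4, h5⟩ := h2 hu
  exact ⟨l, by omega, h3.mul_left v, w'', h4, by simpa [mul_assoc] using h5⟩

theorem leftStep_of_rightStep {m : ℕ} (hm : 1 ≤ m) (hR : RightStep G m) :
    LeftStep G (m + 1) := by
  intro φ le h q v w y k hk hvk hw hq hy hvy hy1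
  have hbase : ∀ a : G, le (φ (D (m + 1)) * a) (φ (g 0) * φ (sh 1 (D m)) * a) := by
    intro a
    obtain ⟨m, rfl⟩ : ∃ m', m = m' + 1 := ⟨m - 1, by omega⟩
    have e : g 0 * sh 1 (D (m + 1)) = sh 2 (D m) * up (m + 2) := by
      rw [D_succ', up_succ' (m + 1), ← mul_assoc, map_mul, ← mul_assoc, sh_sh]
      congr 1
      symm
      refine mul_g_of_far fun i hi => ?_
      have := lett_D m (by simpa using hi : i - 2 ∈ _)
      simp at this
      omega
    rw [← map_mul, e, D_succ', map_mul, map_mul, mul_assoc, mul_assoc]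
    refine h.trans (h.fix_le ?_ _) (h.le_mul_left _ _)
    exact (lett_sh_one (lett_D (m + 1))).trans fun i hi => hi.1
  have hlow : ∀ {x : PB} {c d : ℤ}, lett x ⊆ Ico (c + 1) (d + 1) →
      lett (sh (-1) x) ⊆ Ico c d := by
    intro x c d hx i hi
    have := hx (by simpa using hi : i + 1 ∈ _)
    simp at this ⊢
    omega
  have hhigh : ∀ {x : PB} {c d : ℤ}, lett x ⊆ Ico c d → lett (sh 1 x) ⊆ Ico (c + 1) (d + 1) := by
    intro x c d hx i hi
    have := hx (by simpa using hi : i - 1 ∈ _)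
    simp at this ⊢
    omega
  obtain ⟨x, rfl⟩ : ∃ x, y = sh 1 x := ⟨sh (-1) y, by simp⟩
  obtain ⟨t, rfl⟩ : ∃ t, w = sh 1 t := ⟨sh (-1) w, by simp⟩
  have hx : lett x ⊆ Ico 0 (m : ℤ) := by
    simpa using hlow (x := sh 1 x) (c := 0) (d := m) (by simpa using hy)
  have ht : lett t ⊆ Ico 0 ((k : ℤ) - 1) := by
    simpa using hlow (x := sh 1 t) (c := 0) (d := (k : ℤ) - 1) (by simpa using hw)
  have hx1 : x ≠ 1 := by
    rintro rfl
    simp at hy1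
  have hxi : ∀ i, Ends x i → i = (m : ℤ) - 1 := by
    intro i hi
    have := hvy (i + 1) ((ends_sh.2 (by simpa using hi)).mul_left v)
    push_cast at this
    omega
  have hc : ∀ {c : PB}, lett c ⊆ Ico 0 (m : ℤ) → ¬ Ends (v * sh 1 c) 0 → Contains k c := by
    intro c hcl hce
    have := contains_of_not_ends hk hvk
      ((hhigh hcl).trans fun i hi => by simpa using hi.1) hce
    simpa using this
  have hcx : Contains k x := hc hx fun h0 => by
    have := hvy 0 h0
    push_cast at this
    omega
  have hq' : le (φ (g 0) * 1) (φ (g 0) * ((φ (g 0))⁻¹ * q * φ.comp (sh 1) t)) := by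
    simpa [mul_assoc] using hq
  have hconv : ∀ {l : ℕ}, Gap (φ.comp (sh 1)) (fun a b => le (φ (g 0) * a) (φ (g 0) * b)) m l
      ((φ (g 0))⁻¹ * q) x → Gap φ le (m + 1) l q (sh 1 x) := by
    rintro l ⟨h1, w', hw', hle⟩
    refine ⟨?_, sh 1 w', ?_, ?_⟩
    · have := h1.map (sh 1)
      rw [sh_fl] at this
      simpa using this
    · have := hhigh hw'
      push_cast
      convert this using 2 <;> ring
    · have h2 := hbase (φ (g m))
      refine h.trans (by simpa using h2) ?_
      simpa [mul_assoc] using hle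
  obtain ⟨h1, h2⟩ := hR _ _ h.shift _ t x k hk ht hq' hx hx1 hxi hcx
  refine ⟨?_, fun hu => ?_⟩
  · have h3 := hbase 1
    refine h.trans (by simpa using h3) ?_
    simpa [mul_assoc] using h1
  · by_cases hup : EndsW x (up m)
    · obtain ⟨c, rfl⟩ := hup
      simp only [lett_mul, union_subset_iff] at hx
      refine ⟨m, le_rfl, hconv (h.shift.gap_of_up hm hk ht hq' hx.1 (hc hx.1 ?_))⟩
      rintro ⟨d, hd⟩
      exact hu ⟨d, by rw [map_mul, ← mul_assoc, hd, up_succ', mul_assoc]⟩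
    · obtain ⟨l, hl, hg⟩ := h2 hup
      exact ⟨l, by omega, hconv hg⟩

theorem leftStep {m : ℕ} (hm : 2 ≤ m) : LeftStep G m := by
  induction m, hm using Nat.le_induction with
  | base => exact leftStep_of_rightStep le_rfl rightStep_one
  | succ m hm ih => exact leftStep_of_rightStep (by omega) (rightStep_of_leftStep hm ih)

end PosBraid

namespace PosBraid
open PB Set

theorem EndsW.trans {x y z : PB} (h : EndsW x y) (h' : EndsW y z) : EndsW x z := by
  obtain ⟨c, rfl⟩ := h'
  obtain ⟨d, rfl⟩ := h
  exact ⟨d * c, by rw [mul_assoc]⟩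

theorem endsW_dn_of_le {k l : ℕ} (h : k ≤ l) : EndsW (dn l) (dn k) := by
  obtain ⟨A, hA, -⟩ := dlist_eq_append h
  exact ⟨PB.mk A, by rw [dn, hA, mk_append]; rfl⟩

/-- The only letter at which `v` can end is `0`. -/
def Low (v : PB) : Prop := ∀ i, Ends v i → i = 0

theorem Low.endsW {v : PB} (h : Low v) (h1 : v ≠ 1) : EndsW v (g 0) := by
  obtain ⟨i, hi⟩ := exists_ends h1
  obtain rfl := h i hi
  exact hi

theorem Low.one_le {v : PB} (h : Low v) (h1 : v ≠ 1) {k : ℕ} (hk : ¬ EndsW v (dn (k + 1))) :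
    1 ≤ k := by
  by_contra h0
  obtain rfl : k = 0 := by omega
  exact hk (by simpa [dn_succ] using h.endsW h1)

theorem le_of_endsW_dn {m k : ℕ} {v : PB} (hv : lett v ⊆ Ico 0 (m : ℤ)) (h : EndsW v (dn k)) :
    k ≤ m := by
  obtain ⟨c, rfl⟩ := h
  rcases Nat.eq_zero_or_pos k with rfl | hk
  · simp
  · obtain ⟨k, rfl⟩ : ∃ k', k = k' + 1 := ⟨k - 1, by omega⟩
    have := hv (by simp [dn_succ] : (k : ℤ) ∈ _)
    simp at this
    omega

theorem low_of_isTail {m : ℕ} {v y : PB} (hv : lett v ⊆ Ico 0 (m : ℤ))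
    (h : IsTail (Ico 1 (m : ℤ)) v y) : Low v := by
  intro i hi
  by_contra h0
  have := hv hi.mem_lett
  simp at this
  exact h.2 i (by simp; omega) hi

variable {G : Type*} [Group G]

/-- A total `PosOrder` for which the first generator is strictly positive. -/
structure StrictPosOrder (φ : PB →* G) (le : G → G → Prop) : Prop extends PosOrder φ le where
  total : ∀ a b, le a b ∨ le b a
  not_le : ¬ le (φ (g 0)) 1

/-- `v`, over the letters `0, …, m - 1`, lies beyond the `k`-th power of the half twist, with some
room unless it ends with the whole descending run. -/
structure Good (φ : PB →* G) (le : G → G → Prop) (m k : ℕ) (v : PB) : Prop where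
  ne_one : v ≠ 1
  lett_sub : lett v ⊆ Ico 0 (m : ℤ)
  low : Low v
  le_one : le 1 ((φ (D m) ^ k)⁻¹ * φ v)
  room : ∀ μ, μ < m → EndsW v (dn μ) → ¬ EndsW v (dn (μ + 1)) →
    ∃ w, lett w ⊆ Ico 1 (μ : ℤ) ∧ le (φ (g 0)) ((φ (D m) ^ k)⁻¹ * φ v * φ w)

theorem pow_inv_mul_fl {φ : PB →* G} {m k : ℕ} {y : PB} (hy : lett y ⊆ Ico 0 (m : ℤ)) :
    (φ (D m) ^ (k + 1))⁻¹ * φ (fl ((m : ℤ) - 1) y) =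
      (φ (D m) ^ k)⁻¹ * φ y * (φ (D m))⁻¹ := by
  have e := congrArg φ (D_mul hy)
  rw [map_mul, map_mul] at e
  rw [eq_mul_inv_iff_mul_eq, mul_assoc, ← e, pow_succ', mul_inv_rev]
  group

theorem pow_even_comm {φ : PB →* G} {m : ℕ} (k : ℕ) {y : PB} (hy : lett y ⊆ Ico 0 (m : ℤ)) :
    Commute (φ (D m) ^ (2 * k)) (φ y) := by
  rw [pow_mul]
  refine Commute.pow_left ?_ k
  have e := congrArg φ (D_sq_mul hy)
  rw [map_mul, map_mul, map_pow] at e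
  exact e

namespace PosOrder

variable {φ : PB →* G} {le : G → G → Prop}

theorem good_zero (h : PosOrder φ le) {m : ℕ} {v : PB} (h1 : v ≠ 1)
    (hv : lett v ⊆ Ico 0 (m : ℤ)) (hl : Low v) : Good φ le m 0 v where
  ne_one := h1
  lett_sub := hv
  low := hl
  le_one := by simpa using h.le_mul 1 v
  room μ _ _ _ := by
    refine ⟨1, by simp, ?_⟩
    obtain ⟨c, rfl⟩ := hl.endsW h1
    simpa using h.le_mul_left c (φ (g 0))

theorem good_succ (h : PosOrder φ le) {m k : ℕ} (hm : 2 ≤ m) {v z : PB} (hv : Good φ le m k v)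
    (hz : lett z ⊆ Ico 1 (m : ℤ)) (hl : Low (fl ((m : ℤ) - 1) (v * z))) :
    Good φ le m (k + 1) (fl ((m : ℤ) - 1) (v * z)) := by
  have hz0 : lett z ⊆ Ico 0 (m : ℤ) := hz.trans (Ico_subset_Ico_left (by omega))
  have hvz : lett (v * z) ⊆ Ico 0 (m : ℤ) := by simpa using ⟨hv.lett_sub, hz0⟩
  have hi : ∀ i, Ends (v * z) i → i = (m : ℤ) - 1 := by
    intro i hi
    have := hl ((m : ℤ) - 1 - i) (ends_fl.2 (by simpa using hi))
    omega
  have hz1 : z ≠ 1 := by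
    rintro rfl
    obtain ⟨i, hi'⟩ := exists_ends hv.ne_one
    have := hv.low i hi'
    have := hi i (by simpa using hi')
    omega
  obtain ⟨μ, hμ, hμ'⟩ := exists_maximal_dn v
  have hμ1 := hv.low.one_le hv.ne_one hμ'
  have hμm : μ < m := by
    refine lt_of_le_of_ne (le_of_endsW_dn hv.lett_sub hμ) ?_
    rintro rfl
    obtain ⟨c, rfl⟩ := hμ
    have := hi 0 (by rw [mul_assoc, dn_mul hz, ← mul_assoc]; exact ends_dn hμ1 _)
    omega
  obtain ⟨w, hw, hle⟩ := hv.room μ hμm hμ hμ'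
  obtain ⟨h1, h2⟩ := leftStep hm φ le h _ v w z μ hμ1 hμ hw hle hz hi hz1
  refine ⟨?_, lett_fl hvz, hl, ?_, ?_⟩
  · intro h0
    have := congrArg len h0
    simp at this
    exact hz1 (len_eq_zero.1 this.2)
  · rw [pow_inv_mul_fl hvz]
    have := h.mul_right h1 (φ (D m))⁻¹
    simpa [mul_assoc] using this
  · intro ν hν hd hd'
    have hup : ¬ EndsW (v * z) (up m) := by
      intro hu
      have := hu.map (fl ((m : ℤ) - 1))
      rw [← fl_dn, fl_fl] at this
      exact hd' (this.trans (endsW_dn_of_le hν))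
    obtain ⟨l, hl, he, w', hw', hle'⟩ := h2 hup
    have hlν : l ≤ ν := by
      by_contra hlt
      have := (he.mul_left v).map (fl ((m : ℤ) - 1))
      rw [fl_fl] at this
      exact hd' (this.trans (endsW_dn_of_le (by omega)))
    have hw0 : lett w' ⊆ Ico 0 (m : ℤ) := hw'.trans (Ico_subset_Ico (by omega) (by omega))
    refine ⟨fl ((m : ℤ) - 1) w', ?_, ?_⟩
    · intro i hi
      have := hw' (by simpa using hi : (m : ℤ) - 1 - i ∈ _)
      simp at this ⊢
      omega
    · rw [mul_assoc, ← map_mul, ← map_mul, pow_inv_mul_fl (by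
        rw [lett_mul]; exact union_subset hvz hw0)]
      have e := D_mul (m := m) (x := g ((m : ℤ) - 1)) (by simp; omega)
      have := h.mul_right hle' (φ (D m))⁻¹
      rw [e] at this
      simpa [mul_assoc] using this

end PosOrder

namespace StrictPosOrder

variable {φ : PB →* G} {le : G → G → Prop} (h : StrictPosOrder φ le)
include h

theorem le_inv_fix {x : PB} (hx : lett x ⊆ Ici 1) (a : G) : le a ((φ x)⁻¹ * a) := by
  simpa using h.fix_le hx ((φ x)⁻¹ * a)

theorem inv_fix_le {x : PB} (a : G) : le ((φ x)⁻¹ * a) a := by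
  simpa using h.le_mul_left x ((φ x)⁻¹ * a)

theorem not_le_one {x : PB} (hx : 0 ∈ lett x) : ¬ le (φ x) 1 := by
  obtain ⟨u, rfl⟩ := exists_mk x
  intro h1
  obtain ⟨s, t, rfl⟩ := List.append_of_mem (show (0 : ℤ) ∈ u from hx)
  rw [mk_append, mk_cons, map_mul, map_mul] at h1
  refine h.not_le (h.trans (h.trans ?_ (h.le_mul_left (PB.mk s) _)) h1)
  exact h.le_mul _ _

theorem pow_le {x : PB} {k l : ℕ} (hkl : k ≤ l) : le (φ x ^ k) (φ x ^ l) := by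
  obtain ⟨j, rfl⟩ := Nat.exists_eq_add_of_le hkl
  rw [pow_add, ← map_pow φ x j]
  exact h.le_mul _ _

theorem lt_of_pow {x : PB} (a : G) {k l : ℕ} (h1 : le (φ x ^ k) a) (h2 : ¬ le (φ x ^ l) a) :
    k < l := by
  by_contra hkl
  exact h2 (h.trans (h.pow_le (by omega)) h1)

theorem pow_not_le {x : PB} (hx : 0 ∈ lett x) {k l : ℕ} (hkl : l < k) :
    ¬ le (φ x ^ k) (φ x ^ l) := by
  intro h0
  obtain ⟨j, rfl⟩ := Nat.exists_eq_add_of_lt hkl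
  have := h.mul_right h0 (φ x ^ l)⁻¹
  rw [mul_inv_cancel, show l + j + 1 = (j + 1) + l by ring, pow_add, mul_inv_cancel_right,
    ← map_pow] at this
  refine h.not_le_one ?_ this
  rw [pow_succ]
  simp [hx]

/-- The strict upper bound for elements of level `k`. -/
theorem not_le_zero {m : ℕ} (hm : 2 ≤ m) {y x : PB} (hy : lett y ⊆ Ico 1 (m : ℤ))
    (hx : lett x ⊆ Ico 0 ((m : ℤ) - 1)) : ¬ le (φ (D m)) (φ (y * x)) := by
  intro h0
  rw [map_mul] at h0
  have h1 := h.trans h0 (h.fix_le (hy.trans fun i hi => hi.1) _)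
  have h2 := h.mul_right h1 (φ x)⁻¹
  rw [mul_inv_cancel] at h2
  have e := congrArg φ (D_mul (m := m) (hx.trans (Ico_subset_Ico_right (by omega))))
  rw [map_mul, map_mul] at e
  have e' : φ (D m) = φ (fl ((m : ℤ) - 1) x) * (φ (D m) * (φ x)⁻¹) := by
    rw [← mul_assoc, ← e, mul_inv_cancel_right]
  have hf : lett (fl ((m : ℤ) - 1) x) ⊆ Ici 1 := by
    intro i hi
    have := hx (by simpa using hi : (m : ℤ) - 1 - i ∈ _)
    simp at this ⊢
    omega
  have h3 := h.fix_le hf (φ (D m) * (φ x)⁻¹)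
  rw [← e'] at h3
  refine h.not_le_one ?_ (h.trans h3 h2)
  obtain ⟨m, rfl⟩ : ∃ m', m = m' + 1 := ⟨m - 1, by omega⟩
  rw [D_succ, dn_succ']
  simp

theorem not_le_succ {m k : ℕ} {v z : PB} (hv : lett v ⊆ Ico 0 (m : ℤ))
    (hz : lett z ⊆ Ico 1 (m : ℤ)) (hu : ¬ le (φ (D m)) ((φ (D m) ^ k)⁻¹ * φ v)) :
    ¬ le (φ (D m)) ((φ (D m) ^ (k + 1))⁻¹ * φ (fl ((m : ℤ) - 1) (v * z))) := by
  have hz0 : lett z ⊆ Ico 0 (m : ℤ) := hz.trans (Ico_subset_Ico_left (by omega))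
  intro h0
  rw [pow_inv_mul_fl (by simpa using ⟨hv, hz0⟩)] at h0
  apply hu
  have h1 := h.mul_right (h.mul_right h0 (φ (D m))) (φ z)⁻¹
  have e := (pow_even_comm (φ := φ) 1 hz0).inv_right
  rw [mul_one, sq] at e
  rw [map_mul, e.eq] at h1
  refine h.trans (h.trans ?_ (h.le_inv_fix (hz.trans fun i hi => hi.1) _))
    (by simpa [mul_assoc] using h1)
  exact h.le_mul _ _

end StrictPosOrder

/-- `Chain m k v`: stripping alternately the tails over `0, …, m - 2` and over `1, …, m - 1`
takes `v` into the braids over `1, …, m - 1` after `k` double steps and one more single step. -/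
inductive Chain (m : ℕ) : ℕ → PB → Prop
  | base {u x : PB} : u * x ≠ 1 → Low (u * x) → IsTail (Ico 0 ((m : ℤ) - 1)) u x →
      lett u ⊆ Ico 1 (m : ℤ) → Chain m 0 (u * x)
  | step {k : ℕ} {w z x : PB} : Chain m k w → Low (w * z * x) →
      IsTail (Ico 0 ((m : ℤ) - 1)) (w * z) x → IsTail (Ico 1 (m : ℤ)) w z →
      Chain m (k + 1) (w * z * x)

theorem exists_chain {m : ℕ} (hm : 2 ≤ m) {v : PB} (h1 : v ≠ 1) (hl : Low v)
    (hv : lett v ⊆ Ico 0 (m : ℤ)) : ∃ k, Chain m k v := by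
  induction hlen : len v using Nat.strong_induction_on generalizing v with
  | _ l ih =>
    obtain ⟨u, x, rfl, hux⟩ := exists_isTail (Ico 0 ((m : ℤ) - 1)) v
    by_cases hu : lett u ⊆ Ico 1 (m : ℤ)
    · exact ⟨0, .base h1 hl hux hu⟩
    · obtain ⟨w, z, rfl, hwz⟩ := exists_isTail (Ico 1 (m : ℤ)) u
      simp only [lett_mul, union_subset_iff] at hv
      have hw1 : w ≠ 1 := by
        rintro rfl
        exact hu (by simpa using hwz.1)
      have hlt : len w < l := by
        by_contra hge
        simp at hlen
        obtain rfl : z = 1 := len_eq_zero.1 (by omega)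
        obtain rfl : x = 1 := len_eq_zero.1 (by omega)
        obtain ⟨c, hc⟩ := hl.endsW h1
        exact hux.2 0 (by simp; omega) ⟨c, by simpa using hc⟩
      obtain ⟨k, hk⟩ := ih (len w) hlt hw1 (low_of_isTail hv.1.1 hwz) hv.1.1 rfl
      exact ⟨k + 1, .step hk hl hux hwz⟩

namespace StrictPosOrder

variable {φ : PB →* G} {le : G → G → Prop} (h : StrictPosOrder φ le)
include h

theorem chain_good {m k : ℕ} (hm : 2 ≤ m) {v : PB} (hc : Chain m k v)
    (hv : lett v ⊆ Ico 0 (m : ℤ)) :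
    Good φ le m (2 * k) v ∧ ¬ le (φ (D m)) ((φ (D m) ^ (2 * k))⁻¹ * φ v) := by
  induction hc with
  | base h1 hl hux hu =>
    exact ⟨h.good_zero h1 hv hl, by simpa using h.not_le_zero hm hu hux.1⟩
  | @step k w z x hw hl hux hwz ih =>
    simp only [lett_mul, union_subset_iff] at hv
    obtain ⟨ih1, ih2⟩ := ih hv.1.1
    have hfx : lett (fl ((m : ℤ) - 1) x) ⊆ Ico 1 (m : ℤ) := by
      intro i hi
      have := hux.1 (by simpa using hi : (m : ℤ) - 1 - i ∈ _)
      simp at this ⊢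
      omega
    have hl' : Low (fl ((m : ℤ) - 1) (w * z)) := by
      intro i hi
      have hi' := ends_fl.1 hi
      have := lett_fl (m := m) (x := w * z) (by simpa using hv.1) hi.mem_lett
      simp at this
      by_contra h0
      exact hux.2 _ (by simp; omega) hi'
    have hg := h.good_succ hm ih1 hwz.1 hl'
    have hn := h.not_le_succ hv.1.1 hwz.1 ih2
    have e : fl ((m : ℤ) - 1) (fl ((m : ℤ) - 1) (w * z) * fl ((m : ℤ) - 1) x) = w * z * x := by
      rw [← map_mul, fl_fl]
    have hg' := h.good_succ hm hg hfx (by rwa [e])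
    have hn' := h.not_le_succ hg.lett_sub hfx hn
    rw [e] at hg' hn'
    exact ⟨hg', hn'⟩

theorem chain_le {m k : ℕ} (hm : 2 ≤ m) {v : PB} (hc : Chain m k v)
    (hv : lett v ⊆ Ico 0 (m : ℤ)) (y : PB) : le (φ (D m) ^ (2 * k)) (φ (v * y)) := by
  have h1 := h.mul_right (h.chain_good hm hc hv).1.le_one (φ (D m) ^ (2 * k))
  rw [mul_assoc, ← (pow_even_comm k hv).eq] at h1
  rw [map_mul]
  exact h.trans (by simpa using h1) (h.le_mul _ _)

theorem chain_not_le {m k : ℕ} (hm : 2 ≤ m) {v : PB} (hc : Chain m k v)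
    (hv : lett v ⊆ Ico 0 (m : ℤ)) {y : PB} (hy : lett y ⊆ Ico 1 (m : ℤ)) :
    ¬ le (φ (D m) ^ (2 * (k + 1))) (φ (v * y)) := by
  intro h0
  apply (h.chain_good hm hc hv).2
  rw [map_mul] at h0
  have h1 := h.mul_right h0 (φ y)⁻¹
  rw [((pow_even_comm (k + 1) (hy.trans (Ico_subset_Ico_left (by omega)))).inv_right).eq,
    mul_inv_cancel_right] at h1
  have h2 := h.trans (h.le_inv_fix (hy.trans fun i hi => hi.1) _) h1
  have h3 := h.mul_right h2 (φ (D m) ^ (2 * k))⁻¹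
  rw [← ((pow_even_comm k hv).inv_left).eq, mul_add, add_comm, pow_add, mul_inv_cancel_right] at h3
  refine h.trans ?_ h3
  simpa using h.pow_le (x := D m) (show 1 ≤ 2 * 1 by norm_num)

theorem endsW_of_good {m k : ℕ} {v : PB} (hv : Good φ le m k v)
    (hle : le ((φ (D m) ^ k)⁻¹ * φ v) 1) : EndsW v (dn m) := by
  obtain ⟨μ, hμ, hμ'⟩ := exists_maximal_dn v
  rcases lt_or_ge μ m with hlt | hge
  · obtain ⟨w, hw, hle'⟩ := hv.room μ hlt hμ hμ'
    exfalso
    refine h.not_le (h.trans hle' (h.trans (h.mul_right hle _) ?_))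
    rw [one_mul]
    simpa using h.fix_le (hw.trans fun i hi => hi.1) 1
  · exact hμ.trans (endsW_dn_of_le hge)

end StrictPosOrder

end PosBraid

namespace PosBraid
open PB Set

variable {G : Type*} [Group G]

theorem zero_mem_lett_D {m : ℕ} (hm : 1 ≤ m) : 0 ∈ lett (D m) := by
  obtain ⟨m, rfl⟩ : ∃ m', m = m' + 1 := ⟨m - 1, by omega⟩
  rw [D_succ, dn_succ']
  simp

theorem exists_theta_mul {φ : PB →* G} {le : G → G → Prop} (h : StrictPosOrder φ le) {m : ℕ}
    (hm : 2 ≤ m) (k : ℕ) {a : PB} (ha : lett a ⊆ Ico 0 (m : ℤ))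
    (h1 : le (φ a) (φ (D m) ^ (2 * k))) (h2 : le (φ (D m) ^ (2 * k)) (φ a)) :
    ∃ b, lett b ⊆ Ico 1 (m : ℤ) ∧ a = theta m ^ k * b := by
  have hD : 0 ∈ lett (D m) := zero_mem_lett_D (by omega)
  induction k generalizing a with
  | zero =>
    refine ⟨a, fun i hi => ?_, by simp⟩
    have hi' := ha hi
    refine ⟨?_, hi'.2⟩
    by_contra h0
    obtain rfl : i = 0 := le_antisymm (by omega) hi'.1
    exact h.not_le_one hi (by simpa using h1)
  | succ k ih =>
    obtain ⟨v, y, rfl, hvy⟩ := exists_isTail (Ico 1 (m : ℤ)) a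
    simp only [lett_mul, union_subset_iff] at ha
    have hvl := low_of_isTail ha.1 hvy
    have hy1 : lett y ⊆ Ici 1 := hvy.1.trans fun i hi => hi.1
    rw [map_mul] at h1 h2
    have hv1 : le (φ v) (φ (D m) ^ (2 * (k + 1))) := h.trans (h.le_mul _ y) h1
    have hv2 : le (φ (D m) ^ (2 * (k + 1))) (φ v) := by
      have h3 := h.mul_right h2 (φ y)⁻¹
      rw [((pow_even_comm (k + 1) ha.2).inv_right).eq, mul_inv_cancel_right] at h3
      exact h.trans (h.le_inv_fix hy1 _) h3
    have hvne : v ≠ 1 := by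
      rintro rfl
      exact h.pow_not_le hD (l := 0) (k := 2 * (k + 1)) (by omega) (by simpa using hv2)
    obtain ⟨k', hc⟩ := exists_chain hm hvne hvl ha.1
    have hk' : k' = k + 1 := by
      have h3 := h.lt_of_pow _ hv2 (by simpa using h.chain_not_le hm hc ha.1 (y := 1) (by simp))
      have h4 := h.trans (by simpa using h.chain_le hm hc ha.1 1) hv1
      have : ¬ 2 * (k + 1) < 2 * k' := fun hlt => h.pow_not_le hD hlt h4
      omega
    subst hk'
    have hde := h.endsW_of_good (h.chain_good hm hc ha.1).1 (by
      have := h.mul_right hv1 (φ (D m) ^ (2 * (k + 1)))⁻¹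
      rwa [mul_inv_cancel, ← ((pow_even_comm (k + 1) ha.1).inv_left).eq] at this)
    obtain ⟨v', rfl⟩ := hde
    have hav' : lett v' ⊆ Ico 0 (m : ℤ) := fun i hi => ha.1 (by simp [hi])
    obtain ⟨n, rfl⟩ : ∃ n, m = n + 1 := ⟨m - 1, by omega⟩
    have hn : lett (D n) ⊆ Ico 0 ((n + 1 : ℕ) : ℤ) :=
      (lett_D n).trans (Ico_subset_Ico_right (by omega))
    have hfn : lett (fl (((n + 1 : ℕ) : ℤ) - 1) (D n)) ⊆ Ici 1 := by
      intro i hi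
      have := lett_D n (by simpa using hi : (n : ℤ) - i ∈ _)
      simp at this ⊢
      omega
    have e1 : φ (D (n + 1)) ^ (2 * (k + 1)) * (φ (dn (n + 1)))⁻¹ =
        φ (fl (((n + 1 : ℕ) : ℤ) - 1) (D n)) * φ (D (n + 1)) ^ (2 * k + 1) := by
      have e := congrArg φ (D_mul hn)
      rw [map_mul, map_mul] at e
      rw [show 2 * (k + 1) = 2 * k + 1 + 1 by ring, pow_succ _ (2 * k + 1)]
      nth_rewrite 2 [D_succ]
      rw [map_mul, ← mul_assoc, mul_inv_cancel_right, pow_succ', mul_assoc,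
        (pow_even_comm k hn).eq, ← mul_assoc, e, mul_assoc]
    have e2 : φ (D (n + 1)) ^ (2 * k + 1) * (φ (up (n + 1)))⁻¹ =
        φ (sh 1 (D n)) * φ (D (n + 1)) ^ (2 * k) := by
      rw [pow_succ]
      nth_rewrite 2 [D_succ']
      rw [map_mul, ← mul_assoc, mul_inv_cancel_right]
      refine (pow_even_comm k ?_).eq
      exact (lett_sh_one (lett_D n)).trans (Ico_subset_Ico (by omega) (by omega))
    have hv1' : le (φ v') (φ (D (n + 1)) ^ (2 * k + 1)) := by
      have h3 := h.mul_right hv1 (φ (dn (n + 1)))⁻¹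
      rw [map_mul, mul_inv_cancel_right, e1] at h3
      exact h.trans h3 (h.fix_le hfn _)
    have hv2' : le (φ (D (n + 1)) ^ (2 * k + 1)) (φ v') := by
      have h3 := h.mul_right hv2 (φ (dn (n + 1)))⁻¹
      rw [map_mul, mul_inv_cancel_right, e1] at h3
      exact h.trans (h.le_mul_left _ _) h3
    have hfl : Low (fl (((n + 1 : ℕ) : ℤ) - 1) v') := by
      intro i hi
      have hmem := lett_fl hav' hi.mem_lett
      obtain ⟨c, rfl⟩ := ends_fl.1 hi
      simp at hmem
      by_contra h0
      have := hvl (((n + 1 : ℕ) : ℤ) - 1 - i + 1)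
        ⟨c * dn (n + 1), by
          rw [mul_assoc, mul_dn (by simp; omega), ← mul_assoc]; simp⟩
      push_cast at this
      omega
    obtain ⟨u, y', rfl, huy⟩ := exists_isTail (Ico 1 ((n + 1 : ℕ) : ℤ)) v'
    simp only [lett_mul, union_subset_iff] at hav'
    have hul := low_of_isTail hav'.1 huy
    have hune : u ≠ 1 := by
      rintro rfl
      rw [one_mul] at hv2'
      have h3 : le (φ y') 1 := by
        simpa using h.fix_le (huy.1.trans fun i hi => hi.1 : lett y' ⊆ Ici 1) 1
      exact h.pow_not_le hD (l := 0) (k := 2 * k + 1) (by omega)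
        (by simpa using h.trans hv2' h3)
    obtain ⟨k', hc'⟩ := exists_chain hm hune hul hav'.1
    have hk' : k' = k := by
      have h3 := h.lt_of_pow _ hv2' (h.chain_not_le hm hc' hav'.1 huy.1)
      have h4 := h.trans (h.chain_le hm hc' hav'.1 y') hv1'
      have : ¬ 2 * k + 1 < 2 * k' := fun hlt => h.pow_not_le hD hlt h4
      omega
    subst hk'
    have hav2 : lett (u * y') ⊆ Ico 0 ((n + 1 : ℕ) : ℤ) := by simpa using hav'
    have hde := h.endsW_of_good (h.good_succ hm (h.chain_good hm hc' hav'.1).1 huy.1 hfl) (by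
      rw [pow_inv_mul_fl hav2, ((pow_even_comm k' hav2).inv_left).eq, mul_assoc, ← mul_inv_rev,
        ← pow_succ']
      simpa using h.mul_right hv1' (φ (D (n + 1)) ^ (2 * k' + 1))⁻¹)
    replace hde := hde.map (fl (((n + 1 : ℕ) : ℤ) - 1))
    rw [fl_fl, fl_dn] at hde
    obtain ⟨v'', hv''⟩ := hde
    rw [hv''] at hv1' hv2' hav2 ⊢
    obtain ⟨b, hb, rfl⟩ := ih (a := v'') (fun i hi => hav2 (by simp [hi]))
      (by
        have h3 := h.mul_right hv1' (φ (up (n + 1)))⁻¹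
        rw [map_mul, mul_inv_cancel_right, e2] at h3
        exact h.trans h3 (h.fix_le ((lett_sh_one (lett_D n)).trans fun i hi => hi.1) _))
      (by
        have h3 := h.mul_right hv2' (φ (up (n + 1)))⁻¹
        rw [map_mul, mul_inv_cancel_right, e2] at h3
        exact h.trans (h.le_mul_left _ _) h3)
    refine ⟨b * y, by simpa using ⟨hb, hvy.1⟩, ?_⟩
    rw [mul_assoc (_ * b), ← theta, mul_assoc (theta _ ^ k'), ← theta_mul hb, pow_succ]
    simp only [mul_assoc]

end PosBraid

namespace PosBraid

/-- `bef s k l`: leaving a vertex entered through the edge `s`, the edge `k` comes before `l`. -/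
def bef : Option ℤ → ℤ → ℤ → Prop
  | none, k, l => k < l
  | some j, k, l => (j < k ∧ (l < j ∨ k < l)) ∨ (k < j ∧ l < j ∧ k < l)

/-- The lexicographic order on words induced by `bef`, larger words first. -/
def Lex : Option ℤ → List ℤ → List ℤ → Prop
  | _, [], [] => True
  | none, [], _ :: _ => False
  | none, _ :: _, [] => True
  | some j, [], l :: _ => l < j
  | some j, k :: _, [] => j < k
  | s, k :: u, l :: v => (k = l ∧ Lex (some k) u v) ∨ (k ≠ l ∧ bef s k l)

/-- The word `u` is reduced and does not start with the letter of the state `s`. -/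
def Adm : Option ℤ → List ℤ → Prop
  | _, [] => True
  | s, k :: u => s ≠ some k ∧ Adm (some k) u

@[simp] theorem adm_nil (s : Option ℤ) : Adm s [] := by cases s <;> trivial

@[simp] theorem adm_cons (s : Option ℤ) (k : ℤ) (u : List ℤ) :
    Adm s (k :: u) ↔ s ≠ some k ∧ Adm (some k) u := by cases s <;> rfl

@[simp] theorem lex_nil (s : Option ℤ) : Lex s [] [] := by cases s <;> trivial

@[simp] theorem lex_nil_cons (j l : ℤ) (v : List ℤ) : Lex (some j) [] (l :: v) ↔ l < j := Iff.rfl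

@[simp] theorem lex_cons_nil (j k : ℤ) (u : List ℤ) : Lex (some j) (k :: u) [] ↔ j < k := Iff.rfl

@[simp] theorem lex_none_nil (l : ℤ) (v : List ℤ) : ¬ Lex none [] (l :: v) := id

@[simp] theorem lex_none_cons (k : ℤ) (u : List ℤ) : Lex none (k :: u) [] := trivial

theorem lex_cons (s : Option ℤ) (k l : ℤ) (u v : List ℤ) : Lex s (k :: u) (l :: v) ↔
    (k = l ∧ Lex (some k) u v) ∨ (k ≠ l ∧ bef s k l) := by cases s <;> rfl

@[simp] theorem lex_cons_same (s : Option ℤ) (k : ℤ) (u v : List ℤ) :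
    Lex s (k :: u) (k :: v) ↔ Lex (some k) u v := by simp [lex_cons]

theorem lex_cons_ne {s : Option ℤ} {k l : ℤ} (h : k ≠ l) (u v : List ℤ) :
    Lex s (k :: u) (l :: v) ↔ bef s k l := by simp [lex_cons, h]

theorem Lex.refl (s : Option ℤ) (u : List ℤ) : Lex s u u := by
  induction u generalizing s with
  | nil => simp
  | cons k u ih => simp [ih]

theorem lex_total {s : Option ℤ} {u v : List ℤ} (hu : Adm s u) (hv : Adm s v) :
    Lex s u v ∨ Lex s v u := by
  induction u generalizing s v with
  | nil => cases v <;> rcases s with _ | j <;> (simp_all; try omega)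
  | cons k u ih =>
    cases v with
    | nil => rcases s with _ | j <;> simp_all
    | cons l v =>
      rcases eq_or_ne k l with rfl | h
      · simp only [lex_cons_same]
        exact ih hu.2 hv.2
      · rw [lex_cons_ne h, lex_cons_ne h.symm]
        rcases s with _ | j <;> (simp_all [bef]; try omega)

theorem Lex.antisymm {s : Option ℤ} {u v : List ℤ} (h : Lex s u v) (h' : Lex s v u) : u = v := by
  induction u generalizing s v with
  | nil => cases v <;> rcases s with _ | j <;> simp_all; omega
  | cons k u ih =>
    cases v with
    | nil => rcases s with _ | j <;> simp_all; omega
    | cons l v =>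
      rcases eq_or_ne k l with rfl | hn
      · simp only [lex_cons_same] at h h'
        rw [ih h h']
      · rw [lex_cons_ne hn] at h
        rw [lex_cons_ne hn.symm] at h'
        rcases s with _ | j <;> simp_all [bef] <;> omega

theorem Lex.trans {s : Option ℤ} {u v w : List ℤ} (h : Lex s u v) (h' : Lex s v w) :
    Lex s u w := by
  induction u generalizing s v w with
  | nil =>
    cases v <;> cases w <;> rcases s with _ | j <;> simp_all [lex_cons, bef]
    omega
  | cons k u ih =>
    cases v with
    | nil => cases w <;> rcases s with _ | j <;> simp_all [lex_cons, bef]; omega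
    | cons l v =>
      cases w with
      | nil => rcases s with _ | j <;> simp_all [lex_cons, bef]; omega
      | cons o w =>
        rw [lex_cons] at *
        rcases h with ⟨rfl, h⟩ | ⟨h1, h2⟩ <;> rcases h' with ⟨rfl, h'⟩ | ⟨h1', h2'⟩
        · exact Or.inl ⟨rfl, ih h h'⟩
        · exact Or.inr ⟨h1', h2'⟩
        · exact Or.inr ⟨h1, h2⟩
        · refine Or.inr ?_
          rcases s with _ | j <;> simp only [bef] at * <;> omega

/-- The action of the generator of index `a` on words, and the same action followed by
multiplication by the letter `a` on the left. -/
def actB (a : ℤ) : Bool → List ℤ → List ℤ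
  | true, [] => []
  | false, [] => [a]
  | true, k :: u => if k = a then a :: (a + 1) :: actB a false u
      else if k = a + 1 then actB a false u else k :: actB a true u
  | false, k :: u => if k = a then (a + 1) :: actB a false u
      else if k = a + 1 then actB a true u else a :: k :: actB a true u

abbrev act (a : ℤ) : List ℤ → List ℤ := actB a true

abbrev actL (a : ℤ) : List ℤ → List ℤ := actB a false

variable {a : ℤ}

@[simp] theorem act_nil : act a [] = [] := rfl
@[simp] theorem actL_nil : actL a [] = [a] := rfl
@[simp] theorem act_left (u : List ℤ) : act a (a :: u) = a :: (a + 1) :: actL a u := by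
  simp [act, actB]
@[simp] theorem actL_left (u : List ℤ) : actL a (a :: u) = (a + 1) :: actL a u := by
  simp [actL, actB]
@[simp] theorem act_right (u : List ℤ) : act a ((a + 1) :: u) = actL a u := by
  simp [act, actB]
@[simp] theorem actL_right (u : List ℤ) : actL a ((a + 1) :: u) = act a u := by
  simp [actL, actB]
theorem act_other {k : ℤ} (h : k ≠ a) (h' : k ≠ a + 1) (u : List ℤ) :
    act a (k :: u) = k :: act a u := by
  simp [act, actB, h, h']
theorem actL_other {k : ℤ} (h : k ≠ a) (h' : k ≠ a + 1) (u : List ℤ) :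
    actL a (k :: u) = a :: k :: act a u := by
  simp [actL, actB, h, h']

end PosBraid

namespace PosBraid
variable {a : ℤ}

theorem word_cases (a : ℤ) (u : List ℤ) : u = [] ∨ (∃ t, u = a :: t) ∨ (∃ t, u = (a + 1) :: t) ∨
    ∃ k t, k ≠ a ∧ k ≠ a + 1 ∧ u = k :: t := by
  cases u with
  | nil => exact Or.inl rfl
  | cons k t => by_cases h : k = a <;> by_cases h' : k = a + 1 <;> simp [h, h']

theorem act_lex_cons {u y : List ℤ} (hu : Adm (some (a + 1)) u)
    (hy : y = [] ∨ ∃ k t, k ≠ a ∧ k ≠ a + 1 ∧ y = k :: t) :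
    Lex (some (a + 1)) (act a u) (a :: y) := by
  rcases word_cases a u with rfl | ⟨u, rfl⟩ | ⟨u, rfl⟩ | ⟨k, u, h1, h2, rfl⟩
  · simp
  · rcases hy with rfl | ⟨k, t, h1, h2, rfl⟩
    · simp
    · simp [lex_cons_ne h2.symm, bef]
      omega
  · simp at hu
  · rw [act_other h1 h2, lex_cons_ne h1]
    simp [bef]
    omega

section Generic

variable {s : Option ℤ} (hs : s ≠ some a) (hs' : s ≠ some (a + 1))
include hs hs'

theorem bef_left_right : bef s a (a + 1) := by
  rcases s with _ | j <;> simp_all [bef]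
  omega

theorem not_bef_right_left : ¬ bef s (a + 1) a := by
  rcases s with _ | j <;> simp_all [bef]

theorem bef_left_iff {k : ℤ} (h' : k ≠ a + 1) : bef s a k ↔ bef s (a + 1) k := by
  rcases s with _ | j <;> simp_all [bef] <;> omega

theorem bef_iff_right {k : ℤ} (h : k ≠ a) (h' : k ≠ a + 1) : bef s k a ↔ bef s k (a + 1) := by
  rcases s with _ | j <;> simp_all [bef] <;> omega

theorem lex_nil_left_iff (u v : List ℤ) : Lex s [] (a :: u) ↔ Lex s [] ((a + 1) :: v) := by
  rcases s with _ | j <;> simp_all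
  omega

theorem lex_left_nil_iff (u v : List ℤ) : Lex s (a :: u) [] ↔ Lex s ((a + 1) :: v) [] := by
  rcases s with _ | j <;> simp_all
  omega

end Generic

theorem lex_nil_cons_congr (s : Option ℤ) (k : ℤ) (u v : List ℤ) :
    Lex s [] (k :: u) ↔ Lex s [] (k :: v) := by cases s <;> simp

theorem lex_cons_nil_congr (s : Option ℤ) (k : ℤ) (u v : List ℤ) :
    Lex s (k :: u) [] ↔ Lex s (k :: v) [] := by cases s <;> simp

/-- The words `actL a u`, for `u` not starting with `a + 1`, start with `a` or `a + 1`. -/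
theorem actL_start {u : List ℤ} (hu : Adm (some (a + 1)) u) :
    (∃ t, actL a u = (a + 1) :: t) ∨ ∃ y, actL a u = a :: y ∧
      (y = [] ∨ ∃ k t, k ≠ a ∧ k ≠ a + 1 ∧ y = k :: t) := by
  rcases word_cases a u with rfl | ⟨u, rfl⟩ | ⟨u, rfl⟩ | ⟨k, u, h1, h2, rfl⟩
  · exact Or.inr ⟨[], by simp⟩
  · exact Or.inl ⟨_, actL_left u⟩
  · simp at hu
  · exact Or.inr ⟨_, actL_other h1 h2 u, Or.inr ⟨k, _, h1, h2, rfl⟩⟩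

/-- Monotonicity of the two maps on words, jointly for the four kinds of states. -/
structure ActMono (a : ℤ) (u : List ℤ) : Prop where
  generic : ∀ s v, s ≠ some a → s ≠ some (a + 1) → Adm s u → Adm s v → Lex s u v →
    Lex s (act a u) (act a v)
  left : ∀ v, Adm (some a) u → Adm (some a) v → Lex (some a) u v →
    Lex (some (a + 1)) (actL a u) (actL a v)
  right : ∀ v, Adm (some (a + 1)) u → Adm (some (a + 1)) v → Lex (some (a + 1)) u v →
    Lex (some (a + 1)) (act a u) (act a v)
  right' : ∀ s v, s ≠ some a → s ≠ some (a + 1) → Adm (some (a + 1)) u → Adm (some (a + 1)) v →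
    Lex (some (a + 1)) u v → Lex s (actL a u) (actL a v)

theorem ActMono.other {k l : ℤ} {u v : List ℤ} (ih : ActMono a u) (h1 : k ≠ a) (h2 : k ≠ a + 1)
    {s s' : Option ℤ} (hu : Adm (some k) u) (hv : Adm (some l) v)
    (hss : bef s k l → bef s' k l) (h : Lex s (k :: u) (l :: v)) :
    Lex s' (k :: act a u) (l :: act a v) := by
  rw [lex_cons] at *
  rcases h with ⟨rfl, h⟩ | ⟨hn, h⟩
  · exact Or.inl ⟨rfl, ih.generic _ _ (by simpa) (by simpa) hu hv h⟩
  · exact Or.inr ⟨hn, hss h⟩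

theorem lex_left_actL {v : List ℤ} (u : List ℤ) {s : Option ℤ} (hs : s ≠ some a)
    (hs' : s ≠ some (a + 1)) (hv : Adm (some (a + 1)) v) :
    Lex s (a :: (a + 1) :: u) (actL a v) := by
  rcases actL_start hv with ⟨t, e⟩ | ⟨y, e, rfl | ⟨k, t, h1, h2, rfl⟩⟩ <;> rw [e]
  · rw [lex_cons_ne (by omega)]
    exact bef_left_right hs hs'
  · simp
  · rw [lex_cons_same, lex_cons_ne h2.symm]
    simp [bef]
    omega

theorem actMono (a : ℤ) (u : List ℤ) : ActMono a u := by
  have hne : a ≠ a + 1 := by omega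
  induction u with
  | nil =>
    refine ⟨fun s v hs hs' hu hv h => ?_, fun v hu hv h => ?_, fun v hu hv h => ?_,
      fun s v hs hs' hu hv h => ?_⟩ <;>
    rcases word_cases a v with rfl | ⟨v, rfl⟩ | ⟨v, rfl⟩ | ⟨l, v, h3, h4, rfl⟩
    · simp
    · rw [act_left]
      exact (lex_nil_cons_congr _ _ _ _).1 h
    · rw [act_right]
      rcases actL_start hv.2 with ⟨t, e⟩ | ⟨y, e, -⟩ <;> rw [e]
      · exact (lex_nil_cons_congr _ _ _ _).1 h
      · exact (lex_nil_left_iff hs hs' _ _).2 h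
    · rw [act_other h3 h4]
      exact (lex_nil_cons_congr _ _ _ _).1 h
    · simp
    · simp at hv
    · simp at h
    · rw [actL_other h3 h4]
      simpa using h
    · simp
    · simp
    · simp at hv
    · rw [act_other h3 h4]
      simpa using h
    · simp [Lex.refl]
    · rw [actL_left, actL_nil, lex_cons_ne hne]
      exact bef_left_right hs hs'
    · simp at hv
    · rw [actL_other h3 h4, actL_nil, lex_cons_same]
      simp at h ⊢
      omega
  | cons k u ih =>
    refine ⟨fun s v hs hs' hu hv h => ?_, fun v hu hv h => ?_, fun v hu hv h => ?_,
      fun s v hs hs' hu hv h => ?_⟩ <;>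
    rcases word_cases a (k :: u) with h0 | ⟨u, h0⟩ | ⟨u, h0⟩ | ⟨k, u, h1, h2, h0⟩ <;> cases h0 <;>
    rcases word_cases a v with rfl | ⟨v, rfl⟩ | ⟨v, rfl⟩ | ⟨l, v, h3, h4, rfl⟩
    -- generic states
    · rw [act_left]
      exact (lex_cons_nil_congr _ _ _ _).1 h
    · rw [act_left, act_left, lex_cons_same, lex_cons_same]
      exact ih.left _ hu.2 hv.2 (by simpa using h)
    · rw [act_left, act_right]
      exact lex_left_actL _ hs hs' hv.2
    · rw [act_left, act_other h3 h4, lex_cons_ne h3.symm]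
      rwa [lex_cons_ne h3.symm] at h
    · rw [act_right]
      rcases actL_start hu.2 with ⟨t, e⟩ | ⟨y, e, -⟩ <;> rw [e]
      · exact (lex_cons_nil_congr _ _ _ _).1 h
      · exact (lex_left_nil_iff hs hs' _ _).2 h
    · rw [lex_cons_ne hne.symm] at h
      exact absurd h (not_bef_right_left hs hs')
    · rw [act_right, act_right]
      exact ih.right' _ _ hs hs' hu.2 hv.2 (by simpa using h)
    · rw [lex_cons_ne h4.symm] at h
      rw [act_right, act_other h3 h4]
      rcases actL_start hu.2 with ⟨t, e⟩ | ⟨y, e, -⟩ <;> rw [e]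
      · rwa [lex_cons_ne h4.symm]
      · rwa [lex_cons_ne h3.symm, bef_left_iff hs hs' h4]
    · rw [act_other h1 h2]
      exact (lex_cons_nil_congr _ _ _ _).1 h
    · rw [act_left, act_other h1 h2, lex_cons_ne h1]
      rwa [lex_cons_ne h1] at h
    · rw [lex_cons_ne h2] at h
      rw [act_right, act_other h1 h2]
      rcases actL_start hv.2 with ⟨t, e⟩ | ⟨y, e, -⟩ <;> rw [e]
      · rwa [lex_cons_ne h2]
      · rwa [lex_cons_ne h1, bef_iff_right hs hs' h1 h2]
    · rw [act_other h1 h2, act_other h3 h4]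
      exact ih.other h1 h2 hu.2 hv.2 id h
    -- entering through the left letter
    · simp at hu
    · simp at hu
    · simp at hu
    · simp at hu
    · rw [actL_right, actL_nil]
      exact act_lex_cons hu.2 (Or.inl rfl)
    · simp at hv
    · rw [actL_right, actL_right]
      exact ih.right _ hu.2 hv.2 (by simpa using h)
    · rw [actL_right, actL_other h3 h4]
      exact act_lex_cons hu.2 (Or.inr ⟨l, _, h3, h4, rfl⟩)
    · rw [actL_other h1 h2, actL_nil]
      simpa using h
    · simp at hv
    · rw [lex_cons_ne h2] at h
      simp [bef] at h
      omega
    · rw [actL_other h1 h2, actL_other h3 h4, lex_cons_same]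
      exact ih.other h1 h2 hu.2 hv.2 id h
    -- entering through the right letter
    · simp at h
    · rw [act_left, act_left, lex_cons_same, lex_cons_same]
      exact ih.left _ hu.2 hv.2 (by simpa using h)
    · simp at hv
    · rw [lex_cons_ne h3.symm] at h
      simp [bef] at h
      omega
    · simp at hu
    · simp at hu
    · simp at hu
    · simp at hu
    · rw [act_other h1 h2]
      simpa using h
    · rw [act_other h1 h2, act_left, lex_cons_ne h1]
      rwa [lex_cons_ne h1] at h
    · simp at hv
    · rw [act_other h1 h2, act_other h3 h4]
      exact ih.other h1 h2 hu.2 hv.2 id h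
    -- entering through the right letter, which is then removed
    · simp at h
    · rw [actL_left, actL_left, lex_cons_same]
      exact ih.left _ hu.2 hv.2 (by simpa using h)
    · simp at hv
    · rw [lex_cons_ne h3.symm] at h
      simp [bef] at h
      omega
    · simp at hu
    · simp at hu
    · simp at hu
    · simp at hu
    · rw [actL_other h1 h2, actL_nil, lex_cons_same]
      simp at h ⊢
      omega
    · rw [actL_other h1 h2, actL_left, lex_cons_ne hne]
      exact bef_left_right hs hs'
    · simp at hv
    · rw [actL_other h1 h2, actL_other h3 h4, lex_cons_same]
      refine ih.other h1 h2 hu.2 hv.2 (fun h => ?_) h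
      simp [bef] at h ⊢
      omega

/-- The generators move words to larger words. -/
structure ActPos (a : ℤ) (u : List ℤ) : Prop where
  generic : ∀ s, s ≠ some a → s ≠ some (a + 1) → Adm s u → Lex s (act a u) u
  right : Adm (some (a + 1)) u → Lex (some (a + 1)) (act a u) u
  left : Adm (some a) u → Lex (some (a + 1)) (actL a u) (a :: u)
  right' : ∀ s, s ≠ some a → s ≠ some (a + 1) → Adm (some (a + 1)) u →
    Lex s (actL a u) ((a + 1) :: u)
  leftCons : Adm (some a) u → Lex (some a) ((a + 1) :: actL a u) u
  rightCons : Adm (some (a + 1)) u → Lex (some (a + 1)) (act a u) (a :: (a + 1) :: u)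

theorem actPos (a : ℤ) (u : List ℤ) : ActPos a u := by
  have hne : a ≠ a + 1 := by omega
  induction u with
  | nil =>
    refine ⟨fun s _ _ _ => by simp, fun _ => by simp, fun _ => by simp [Lex.refl],
      fun s hs hs' _ => ?_, fun _ => by simp, fun _ => by simp⟩
    rw [actL_nil, lex_cons_ne hne]
    exact bef_left_right hs hs'
  | cons k u ih =>
    rcases word_cases a (k :: u) with h0 | ⟨u, h0⟩ | ⟨u, h0⟩ | ⟨k, u, h1, h2, h0⟩ <;> cases h0
    · refine ⟨fun s _ _ h => ?_, fun h => ?_, fun h => ?_, fun s hs hs' h => ?_, fun h => ?_,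
        fun h => ?_⟩
      · rw [act_left, lex_cons_same]
        exact ih.leftCons h.2
      · rw [act_left, lex_cons_same]
        exact ih.leftCons h.2
      · simp at h
      · rw [actL_left, lex_cons_same]
        exact ih.left h.2
      · simp at h
      · rw [act_left, lex_cons_same, lex_cons_same]
        exact ih.left h.2
    · refine ⟨fun s hs hs' h => ?_, fun h => ?_, fun h => ?_, fun s hs hs' h => ?_, fun h => ?_,
        fun h => ?_⟩
      · rw [act_right]
        exact ih.right' s hs hs' h.2
      · simp at h
      · rw [actL_right]
        exact ih.rightCons h.2
      · simp at h
      · rw [lex_cons_same, actL_right]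
        exact ih.right h.2
      · simp at h
    · have hk : Adm (some k) u → Lex (some k) (act a u) u :=
        ih.generic _ (by simpa) (by simpa)
      refine ⟨fun s hs hs' h => ?_, fun h => ?_, fun h => ?_, fun s hs hs' h => ?_, fun h => ?_,
        fun h => ?_⟩
      · rw [act_other h1 h2, lex_cons_same]
        exact hk h.2
      · rw [act_other h1 h2, lex_cons_same]
        exact hk h.2
      · rw [actL_other h1 h2, lex_cons_same, lex_cons_same]
        exact hk h.2
      · rw [actL_other h1 h2, lex_cons_ne hne]
        exact bef_left_right hs hs'
      · rw [lex_cons_ne h2.symm]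
        simp [bef]
        omega
      · rw [act_other h1 h2, lex_cons_ne h1]
        simp [bef]
        omega

end PosBraid

namespace PosBraid
variable {a : ℤ}

/-- Left multiplication by the involution `c` on words. -/
def cancelCons (c : ℤ) : List ℤ → List ℤ
  | [] => [c]
  | k :: u => if k = c then u else c :: k :: u

theorem cancelCons_of_adm {c : ℤ} {u : List ℤ} (h : Adm (some c) u) : cancelCons c u = c :: u := by
  cases u with
  | nil => rfl
  | cons k u =>
    rw [adm_cons] at h
    exact if_neg fun e => h.1 (congrArg some e.symm)

theorem Adm.none {s : Option ℤ} {u : List ℤ} (h : Adm s u) : Adm none u := by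
  cases u <;> simp_all

theorem adm_cancelCons {u : List ℤ} (c : ℤ) (h : Adm none u) : Adm none (cancelCons c u) := by
  cases u with
  | nil => simp [cancelCons]
  | cons k u =>
    by_cases e : k = c
    · simpa [cancelCons, e] using h.2.none
    · simpa [cancelCons, e, Ne.symm e] using h.2

theorem cancelCons_cancelCons {u : List ℤ} (c : ℤ) (h : Adm none u) :
    cancelCons c (cancelCons c u) = u := by
  cases u with
  | nil => simp [cancelCons]
  | cons k u =>
    by_cases e : k = c
    · subst e
      have e : cancelCons k (k :: u) = u := if_pos rfl
      rw [e, cancelCons_of_adm h.2]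
    · simp [cancelCons, e]

/-- The two maps on words respect reducedness, jointly for the four kinds of states. -/
structure ActAdm (a : ℤ) (u : List ℤ) : Prop where
  generic : ∀ s, s ≠ some a → s ≠ some (a + 1) → Adm s u → Adm s (act a u)
  left : Adm (some a) u → Adm (some (a + 1)) (actL a u)
  right : Adm (some (a + 1)) u → Adm (some (a + 1)) (act a u)
  right' : ∀ s, s ≠ some a → s ≠ some (a + 1) → Adm (some (a + 1)) u → Adm s (actL a u)

theorem actAdm (a : ℤ) (u : List ℤ) : ActAdm a u := by
  induction u with
  | nil => exact ⟨by simp, by simp, by simp, fun s hs _ _ => by simpa using hs⟩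
  | cons k u ih =>
    rcases word_cases a (k :: u) with h0 | ⟨u, h0⟩ | ⟨u, h0⟩ | ⟨k, u, h1, h2, h0⟩ <;> cases h0
    · refine ⟨fun s hs hs' h => ?_, fun h => ?_, fun h => ?_, fun s hs hs' h => ?_⟩
      · simpa [hs] using ih.left h.2
      · simp at h
      · simpa using ih.left h.2
      · simpa [hs'] using ih.left h.2
    · refine ⟨fun s hs hs' h => ?_, fun h => ?_, fun h => ?_, fun s hs hs' h => ?_⟩
      · simpa using ih.right' s hs hs' h.2
      · simpa using ih.right h.2
      · simp at h
      · simp at h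
    · have hk : Adm (some k) u → Adm (some k) (act a u) := ih.generic _ (by simpa) (by simpa)
      have h1' := h1.symm
      have h2' := h2.symm
      refine ⟨fun s hs hs' h => ?_, fun h => ?_, fun h => ?_, fun s hs hs' h => ?_⟩ <;>
        have hu := hk h.2 <;> simp only [act_other h1 h2, actL_other h1 h2] <;> simp_all

theorem adm_act {u : List ℤ} (h : Adm none u) : Adm none (act a u) :=
  (actAdm a u).generic _ (by simp) (by simp) h

theorem actL_eq {u : List ℤ} (h : Adm none u) : actL a u = cancelCons a (act a u) := by
  induction u with
  | nil => rfl
  | cons k u ih =>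
    have hu : Adm none u := h.2.none
    rcases word_cases a (k :: u) with h0 | ⟨u, h0⟩ | ⟨u, h0⟩ | ⟨k, u, h1, h2, h0⟩ <;> cases h0
    · simp [cancelCons]
    · rw [actL_right, act_right, ih hu, cancelCons_cancelCons _ (adm_act hu)]
    · simp [act_other h1 h2, actL_other h1 h2, cancelCons, h1]

theorem act_cons_left {u : List ℤ} (h : Adm (some a) u) :
    act a (a :: u) = cancelCons a (cancelCons (a + 1) (cancelCons a (act a u))) := by
  have hl := (actAdm a u).left h
  rw [act_left, ← actL_eq h.none, cancelCons_of_adm hl, cancelCons_of_adm]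
  simpa using hl

theorem act_cons_right {u : List ℤ} (h : Adm (some (a + 1)) u) :
    act a ((a + 1) :: u) = cancelCons a (act a u) := by
  rw [act_right, actL_eq h.none]

theorem act_cons_other {u : List ℤ} {k : ℤ} (h1 : k ≠ a) (h2 : k ≠ a + 1) (h : Adm (some k) u) :
    act a (k :: u) = cancelCons k (act a u) := by
  rw [act_other h1 h2, cancelCons_of_adm ((actAdm a u).generic _ (by simpa) (by simpa) h)]

/-- Reduced words, that is, the free product of the groups of order two indexed by `ℤ`. -/
def RedWord : Type := {u : List ℤ // Adm none u}

namespace RedWord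

@[ext] theorem ext {x y : RedWord} (h : x.1 = y.1) : x = y := Subtype.ext h

/-- The empty word. -/
def nil : RedWord := ⟨[], by simp⟩

/-- Left multiplication by a letter. -/
def cr (c : ℤ) (x : RedWord) : RedWord := ⟨cancelCons c x.1, adm_cancelCons c x.2⟩

/-- The action of the generator of index `a`. -/
def tw (a : ℤ) (x : RedWord) : RedWord := ⟨act a x.1, adm_act x.2⟩

@[simp] theorem cr_cr (c : ℤ) (x : RedWord) : cr c (cr c x) = x :=
  RedWord.ext (cancelCons_cancelCons c x.2)

@[elab_as_elim]
theorem induction {p : RedWord → Prop} (x : RedWord) (h0 : p nil) (h : ∀ c x, p x → p (cr c x)) :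
    p x := by
  obtain ⟨u, hu⟩ := x
  induction u with
  | nil => exact h0
  | cons k u ih =>
    have := h k _ (ih hu.2.none)
    have e : cr k ⟨u, hu.2.none⟩ = ⟨k :: u, hu⟩ := RedWord.ext (cancelCons_of_adm hu.2)
    rwa [e] at this

/-- An equation for left multiplication by a letter follows from the case of reduced products. -/
theorem map_cr {F f : RedWord → RedWord} {c : ℤ} (hf : ∀ x, f (f x) = x)
    (h : ∀ x : RedWord, Adm (some c) x.1 → F (cr c x) = f (F x)) (x : RedWord) :
    F (cr c x) = f (F x) := by
  by_cases hx : Adm (some c) x.1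
  · exact h x hx
  · obtain ⟨u, hu⟩ := x
    cases u with
    | nil => simp at hx
    | cons k u =>
      have e : k = c := by
        by_contra e
        exact hx (by simpa [Ne.symm e] using hu.2)
      subst e
      have hu' : Adm (some k) u := hu.2
      obtain ⟨y, rfl⟩ : ∃ y : RedWord, y.1 = u := ⟨⟨u, hu'.none⟩, rfl⟩
      have e : (⟨k :: y.1, hu⟩ : RedWord) = cr k y :=
        RedWord.ext (cancelCons_of_adm hu').symm
      rw [e, cr_cr, h y hu', hf]

@[simp] theorem tw_left (a : ℤ) (x : RedWord) :
    tw a (cr a x) = cr a (cr (a + 1) (cr a (tw a x))) :=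
  map_cr (f := fun y => cr a (cr (a + 1) (cr a y))) (by simp) (fun x hx => RedWord.ext <| by
    simpa [tw, cr, cancelCons_of_adm hx] using act_cons_left hx) x

@[simp] theorem tw_right (a : ℤ) (x : RedWord) : tw a (cr (a + 1) x) = cr a (tw a x) :=
  map_cr (by simp) (fun x hx => RedWord.ext <| by
    simpa only [tw, cr, cancelCons_of_adm hx] using act_cons_right hx) x

theorem tw_other {a c : ℤ} (h : c ≠ a) (h' : c ≠ a + 1) (x : RedWord) :
    tw a (cr c x) = cr c (tw a x) :=
  map_cr (by simp) (fun x hx => RedWord.ext <| by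
    simpa only [tw, cr, cancelCons_of_adm hx] using act_cons_other h h' hx) x

theorem tw_comm {i j : ℤ} (h : i + 2 ≤ j) (x : RedWord) : tw i (tw j x) = tw j (tw i x) := by
  induction x using induction with
  | h0 => rfl
  | h c x ih =>
    rcases eq_or_ne c i with rfl | h1
    · simp [tw_other (show c ≠ j by omega) (show c ≠ j + 1 by omega),
        tw_other (show c + 1 ≠ j by omega) (show c + 1 ≠ j + 1 by omega), ih]
    rcases eq_or_ne c (i + 1) with rfl | h2
    · simp [tw_other (show i ≠ j by omega) (show i ≠ j + 1 by omega),
        tw_other (show i + 1 ≠ j by omega) (show i + 1 ≠ j + 1 by omega), ih]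
    rcases eq_or_ne c j with rfl | h3
    · simp [tw_other h1 h2, tw_other (show c + 1 ≠ i by omega) (show c + 1 ≠ i + 1 by omega), ih]
    rcases eq_or_ne c (j + 1) with rfl | h4
    · simp [tw_other h1 h2, tw_other (show j ≠ i by omega) (show j ≠ i + 1 by omega), ih]
    · simp [tw_other h1 h2, tw_other h3 h4, ih]

theorem tw_braid (i : ℤ) (x : RedWord) :
    tw i (tw (i + 1) (tw i x)) = tw (i + 1) (tw i (tw (i + 1) x)) := by
  have o1 := fun x => tw_other (show i ≠ i + 1 by omega) (show i ≠ i + 1 + 1 by omega) x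
  have o2 := fun x => tw_other (show i + 1 + 1 ≠ i by omega) (show i + 1 + 1 ≠ i + 1 by omega) x
  induction x using induction with
  | h0 => rfl
  | h c x ih =>
    rcases eq_or_ne c i with rfl | h1
    · simp [o1, o2, ih]
    rcases eq_or_ne c (i + 1) with rfl | h2
    · simp [o1, o2, ih]
    rcases eq_or_ne c (i + 1 + 1) with rfl | h3
    · simp [o1, o2, ih]
    · simp [tw_other h1 h2, tw_other h2 h3, ih]

theorem adm_map (e : Equiv.Perm ℤ) {s : Option ℤ} {u : List ℤ} (h : Adm s u) :
    Adm (s.map e) (u.map e) := by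
  induction u generalizing s with
  | nil => simp
  | cons k u ih =>
    rw [adm_cons] at h
    rw [List.map_cons, adm_cons]
    refine ⟨fun h' => h.1 ?_, ih h.2⟩
    rcases s with _ | j <;> simp_all

/-- The exchange of the letters `a` and `a + 1`. -/
def swap (a : ℤ) (x : RedWord) : RedWord :=
  ⟨x.1.map (Equiv.swap a (a + 1)), adm_map _ x.2⟩

theorem swap_cr (a c : ℤ) (x : RedWord) :
    swap a (cr c x) = cr (Equiv.swap a (a + 1) c) (swap a x) :=
  map_cr (by simp) (fun x hx => RedWord.ext <| by
    have := cancelCons_of_adm (adm_map (Equiv.swap a (a + 1)) hx)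
    simp only [swap, cr, cancelCons_of_adm hx]
    exact this.symm) x

/-- The action of the inverse of the generator of index `a`. -/
def twInv (a : ℤ) (x : RedWord) : RedWord := swap a (tw a (swap a x))

@[simp] theorem twInv_left (a : ℤ) (x : RedWord) : twInv a (cr a x) = cr (a + 1) (twInv a x) := by
  simp [twInv, swap_cr]

@[simp] theorem twInv_right (a : ℤ) (x : RedWord) :
    twInv a (cr (a + 1) x) = cr (a + 1) (cr a (cr (a + 1) (twInv a x))) := by
  simp [twInv, swap_cr]

theorem twInv_other {a c : ℤ} (h : c ≠ a) (h' : c ≠ a + 1) (x : RedWord) :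
    twInv a (cr c x) = cr c (twInv a x) := by
  simp [twInv, swap_cr, Equiv.swap_apply_of_ne_of_ne h h', tw_other h h']

theorem twInv_tw (a : ℤ) (x : RedWord) : twInv a (tw a x) = x := by
  induction x using induction with
  | h0 => rfl
  | h c x ih =>
    rcases eq_or_ne c a with rfl | h1
    · simp [ih]
    rcases eq_or_ne c (a + 1) with rfl | h2
    · simp [ih]
    · simp [tw_other h1 h2, twInv_other h1 h2, ih]

theorem tw_twInv (a : ℤ) (x : RedWord) : tw a (twInv a x) = x := by
  induction x using induction with
  | h0 => rfl
  | h c x ih =>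
    rcases eq_or_ne c a with rfl | h1
    · simp [ih]
    rcases eq_or_ne c (a + 1) with rfl | h2
    · simp [ih]
    · simp [tw_other h1 h2, twInv_other h1 h2, ih]

/-- The order on reduced words. -/
def Le (x y : RedWord) : Prop := Lex none x.1 y.1

theorem tw_mono (a : ℤ) {x y : RedWord} (h : Le x y) : Le (tw a x) (tw a y) :=
  (actMono a x.1).generic _ _ (by simp) (by simp) x.2 y.2 h

/-- The generator of index `a` as an automorphism of the ordered set of reduced words. -/
def twIso (a : ℤ) : Le ≃r Le where
  toFun := tw a
  invFun := twInv a
  left_inv := twInv_tw a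
  right_inv := tw_twInv a
  map_rel_iff' {x y} := by
    refine ⟨fun h => ?_, tw_mono a⟩
    rcases lex_total x.2 y.2 with h' | h'
    · exact h'
    · have e : tw a x = tw a y := RedWord.ext (Lex.antisymm h (tw_mono a h'))
      have : x = y := by rw [← twInv_tw a x, e, twInv_tw]
      rw [this]
      exact Lex.refl _ _

end RedWord

/-- The monoid homomorphism out of `PB` with given images of the generators. -/
def PB.lift {K : Type*} [Monoid K] (f : ℤ → K) (hc : ∀ i j, i + 2 ≤ j → f i * f j = f j * f i)
    (hb : ∀ i, f i * f (i + 1) * f i = f (i + 1) * f i * f (i + 1)) : PB →* K where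
  toFun := Quotient.lift (fun u => (u.map f).prod) (by
    intro u v h
    change WordRel u v at h
    induction h with
    | refl => rfl
    | symm _ ih => exact ih.symm
    | trans _ _ ih1 ih2 => exact ih1.trans ih2
    | cons i _ ih => simp only [List.map_cons, List.prod_cons, ih]
    | comm i j u h =>
      simp only [List.map_cons, List.prod_cons, ← mul_assoc]
      rcases h with h | h
      · rw [hc i j h]
      · rw [hc j i h]
    | braid i j u h =>
      simp only [List.map_cons, List.prod_cons, ← mul_assoc]
      rcases h with rfl | rfl
      · rw [hb]
      · rw [hb])
  map_one' := rfl
  map_mul' x y := by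
    obtain ⟨u, rfl⟩ := PB.exists_mk x
    obtain ⟨v, rfl⟩ := PB.exists_mk y
    rw [← PB.mk_append]
    change ((u ++ v).map f).prod = (u.map f).prod * (v.map f).prod
    simp

theorem PB.lift_g {K : Type*} [Monoid K] (f : ℤ → K) (hc) (hb) (i : ℤ) :
    PB.lift f hc hb (PB.g i) = f i := by
  change ([i].map f).prod = f i
  simp

/-- The action of positive braids on the right of the reduced words. -/
def ordHom : PB →* (RedWord.Le ≃r RedWord.Le)ᵐᵒᵖ :=
  PB.lift (fun i => .op (RedWord.twIso i))
    (fun _ _ h => congrArg MulOpposite.op (RelIso.ext fun x => (RedWord.tw_comm h x).symm))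
    (fun i => congrArg MulOpposite.op (RelIso.ext fun x => RedWord.tw_braid i x))

/-- The word with the single letter `0`. -/
def RedWord.base : RedWord := ⟨[0], by simp⟩

/-- The preorder on the acting group read off from the images of the base word. -/
def ordLe (α β : (RedWord.Le ≃r RedWord.Le)ᵐᵒᵖ) : Prop :=
  RedWord.Le (β.unop RedWord.base) (α.unop RedWord.base)

theorem strictPosOrder_ordHom : StrictPosOrder ordHom ordLe where
  refl _ := Lex.refl _ _
  trans h h' := Lex.trans h' h
  mul_right h c := c.unop.map_rel_iff.2 h
  pos a i := by
    rw [ordHom, PB.lift_g]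
    exact (actPos i _).generic _ (by simp) (by simp) (a.unop RedWord.base).2
  fix i hi := by
    rw [ordHom, PB.lift_g]
    change Lex none [0] (act i [0])
    rw [act_other (by omega) (by omega)]
    exact Lex.refl _ _
  total a b := lex_total (b.unop RedWord.base).2 (a.unop RedWord.base).2
  not_le := by
    rw [ordHom, PB.lift_g]
    change ¬ Lex none [0] (act 0 [0])
    simp

end PosBraid

namespace PosBraid
open PB Set

theorem ends_D {m : ℕ} {i : ℤ} (hi : i ∈ Ico 0 (m : ℤ)) : Ends (D m) i := by
  induction m generalizing i with
  | zero => simp at hi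
  | succ m ih =>
    rcases eq_or_ne i 0 with rfl | h0
    · rw [D_succ, dn_succ', ← mul_assoc]
      exact ⟨_, rfl⟩
    · have hi' : i - 1 ∈ Ico 0 (m : ℤ) := by
        simp only [mem_Ico, Nat.cast_add, Nat.cast_one] at hi ⊢
        omega
      obtain ⟨c, hc⟩ := ih hi'
      exact ⟨dn (m + 1) * sh 1 c, by rw [D, hc]; simp [mul_assoc]⟩

theorem exists_mul_eq_pow {m : ℕ} {x : PB} (hx : lett x ⊆ Ico 0 (m : ℤ)) :
    ∃ y, y * x = (D m ^ 2) ^ len x := by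
  induction x using induction_right with
  | one => exact ⟨1, by simp⟩
  | mul_g x i ih =>
    simp only [lett_mul, lett_g, union_subset_iff, singleton_subset_iff] at hx
    obtain ⟨y, hy⟩ := ih hx.1
    obtain ⟨c, hc⟩ := ends_D hx.2
    have hlc : lett (D m * c) ⊆ Ico 0 (m : ℤ) := by
      have := lett_D m
      rw [hc] at this
      simp only [lett_mul, union_subset_iff] at this ⊢
      exact ⟨lett_D m, this.1⟩
    have hcomm : Commute (D m ^ 2) (D m * c) := D_sq_mul hlc
    refine ⟨D m * c * y, ?_⟩
    rw [len_mul, len_g, pow_succ, show D m * c * y * (x * g i) = D m * c * (y * x) * g i by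
      simp only [mul_assoc], hy, ← (hcomm.pow_left _).eq, mul_assoc, mul_assoc, ← hc, sq]

theorem exists_lett_subset (x : PB) : ∃ c : ℤ, 0 ≤ c ∧ lett x ⊆ Ico (-c) c := by
  induction x using induction_right with
  | one => exact ⟨0, by simp⟩
  | mul_g x i ih =>
    obtain ⟨c, h0, hc⟩ := ih
    refine ⟨c + |i| + 1, by positivity, ?_⟩
    have := abs_le.1 (le_refl |i|)
    simp only [lett_mul, lett_g, union_subset_iff, singleton_subset_iff]
    refine ⟨hc.trans (Ico_subset_Ico (by omega) (by omega)), ?_, ?_⟩ <;> omega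

/-- Common left multiples exist. -/
theorem exists_mul_eq_mul (x y : PB) : ∃ x' y', x' * x = y' * y := by
  obtain ⟨c, h0, hc⟩ := exists_lett_subset (x * y)
  simp only [lett_mul, union_subset_iff] at hc
  obtain ⟨m, hm⟩ : ∃ m : ℕ, (m : ℤ) = 2 * c := ⟨(2 * c).toNat, by omega⟩
  have key : ∀ z, lett z ⊆ Ico (-c) c → lett (sh c z) ⊆ Ico 0 (m : ℤ) := by
    intro z hz i hi
    have := hz (mem_lett_sh.1 hi)
    simp only [mem_Ico] at this ⊢
    omega
  obtain ⟨x', hx'⟩ := exists_mul_eq_pow (key x hc.1)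
  obtain ⟨y', hy'⟩ := exists_mul_eq_pow (key y hc.2)
  refine ⟨sh (-c) ((D m ^ 2) ^ len y * x'), sh (-c) ((D m ^ 2) ^ len x * y'), ?_⟩
  have e := congrArg (sh (-c)) (show (D m ^ 2) ^ len y * x' * sh c x =
    (D m ^ 2) ^ len x * y' * sh c y by
      rw [mul_assoc, hx', mul_assoc, hy', len_sh, len_sh, ← pow_add, ← pow_add, add_comm])
  rw [map_mul, map_mul (sh (-c)) _ (sh c y)] at e
  simpa using e

noncomputable instance : OreLocalization.OreSet (⊤ : Submonoid PB) where
  ore_right_cancel r₁ r₂ s h := ⟨1, by rw [mul_right_cancel h]⟩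
  oreNum r s := (exists_mul_eq_mul r s).choose_spec.choose
  oreDenom r s := ⟨(exists_mul_eq_mul r s).choose, trivial⟩
  ore_eq r s := (exists_mul_eq_mul r s).choose_spec.choose_spec

/-- The embedding of the positive braids into a group of fractions. -/
noncomputable def fracHom : PB →* (OreLocalization (⊤ : Submonoid PB) PB)ˣ where
  toFun x := OreLocalization.numeratorUnit ⟨x, trivial⟩
  map_one' := by ext; exact map_one OreLocalization.numeratorHom
  map_mul' x y := by ext; exact map_mul OreLocalization.numeratorHom x y

theorem fracHom_injective : Function.Injective fracHom := by
  intro x y h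
  have h' := congrArg Units.val h
  obtain ⟨u, v, h1, h2⟩ := OreLocalization.oreDiv_eq_iff.1 h'
  have huv : (u : PB) = v := by simpa using h2
  rw [Submonoid.smul_def, smul_eq_mul, smul_eq_mul, huv] at h1
  exact (mul_left_cancel h1).symm

end PosBraid

namespace BraidOrder
open GarsideOrder PosBraid PosBraid.PB Set

variable {n : ℕ}

theorem gen_comm {i j : ℕ} (h : i + 2 ≤ j) (hj : j < n) :
    gen n i * gen n j = gen n j * gen n i := by
  rw [gen, gen, dif_pos (by omega : i < n), dif_pos hj, ← mul_inv_eq_one]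
  exact PresentedGroup.one_of_mem (rels := braidRel n)
    (x := FreeGroup.of ⟨i, by omega⟩ * FreeGroup.of ⟨j, hj⟩ *
      (FreeGroup.of ⟨j, hj⟩ * FreeGroup.of ⟨i, by omega⟩)⁻¹) ⟨_, _, Or.inr ⟨h, rfl⟩⟩

theorem gen_braid {i : ℕ} (h : i + 1 < n) :
    gen n i * gen n (i + 1) * gen n i = gen n (i + 1) * gen n i * gen n (i + 1) := by
  rw [gen, gen, dif_pos (by omega : i < n), dif_pos h, ← mul_inv_eq_one]
  exact PresentedGroup.one_of_mem (rels := braidRel n)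
    (x := FreeGroup.of ⟨i, by omega⟩ * FreeGroup.of ⟨i + 1, h⟩ * FreeGroup.of ⟨i, by omega⟩ *
      (FreeGroup.of ⟨i + 1, h⟩ * FreeGroup.of ⟨i, by omega⟩ * FreeGroup.of ⟨i + 1, h⟩)⁻¹)
    ⟨_, _, Or.inl ⟨rfl, rfl⟩⟩

/-- The braid represented by a positive word. -/
def evalWord (n : ℕ) (u : List ℤ) : Braid n := (u.map fun k => gen n k.toNat).prod

theorem evalWord_cons (i : ℤ) (u : List ℤ) :
    evalWord n (i :: u) = gen n i.toNat * evalWord n u := by simp [evalWord]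

theorem evalWord_append (u v : List ℤ) :
    evalWord n (u ++ v) = evalWord n u * evalWord n v := by simp [evalWord]

theorem evalWord_eq {u v : List ℤ} (h : WordRel u v) (hu : ∀ k ∈ u, k ∈ Ico 0 (n : ℤ)) :
    evalWord n u = evalWord n v := by
  induction h with
  | refl => rfl
  | symm h ih => exact (ih fun k hk => hu k ((h.mem_iff k).1 hk)).symm
  | trans h _ ih1 ih2 => exact (ih1 hu).trans (ih2 fun k hk => hu k ((h.mem_iff k).2 hk))
  | cons i _ ih =>
    rw [evalWord_cons, evalWord_cons, ih fun k hk => hu k (List.mem_cons_of_mem _ hk)]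
  | comm i j u h =>
    have hi := hu i (by simp)
    have hj := hu j (by simp)
    simp only [mem_Ico] at hi hj
    simp only [evalWord_cons, ← mul_assoc]
    rcases h with h | h
    · rw [gen_comm (by omega) (by omega)]
    · rw [gen_comm (i := j.toNat) (by omega) (by omega)]
  | braid i j u h =>
    have hi := hu i (by simp)
    have hj := hu j (by simp)
    simp only [mem_Ico] at hi hj
    simp only [evalWord_cons, ← mul_assoc]
    rcases h with h | h
    · rw [show j.toNat = i.toNat + 1 by omega, gen_braid (by omega)]
    · rw [show i.toNat = j.toNat + 1 by omega, gen_braid (by omega)]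

/-- The braid represented by a positive braid over the letters `0, …, n - 1`. -/
noncomputable def pr (n : ℕ) (x : PB) : Braid n := evalWord n (exists_mk x).choose

theorem pr_mk {u : List ℤ} (hu : ∀ k ∈ u, k ∈ Ico 0 (n : ℤ)) :
    pr n (PB.mk u) = evalWord n u :=
  (evalWord_eq (mk_eq.1 (exists_mk (PB.mk u)).choose_spec.symm) hu).symm

theorem pr_mul {x y : PB} (hx : lett x ⊆ Ico 0 (n : ℤ)) (hy : lett y ⊆ Ico 0 (n : ℤ)) :
    pr n (x * y) = pr n x * pr n y := by
  obtain ⟨u, rfl⟩ := exists_mk x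
  obtain ⟨v, rfl⟩ := exists_mk y
  rw [← mk_append, pr_mk, evalWord_append, pr_mk fun k hk => hx hk, pr_mk fun k hk => hy hk]
  intro k hk
  exact (List.mem_append.1 hk).elim (fun h => hx h) fun h => hy h

@[simp] theorem pr_one : pr n 1 = 1 := pr_mk (u := []) (by simp)

theorem pr_g {i : ℕ} (hi : i < n) : pr n (g i) = gen n i := by
  rw [← mk_singleton, pr_mk]
  · simp [evalWord]
  · intro k hk
    simp only [List.mem_singleton] at hk
    simp [hk, hi]

theorem lett_pow_subset {J : Set ℤ} {x : PB} (hx : lett x ⊆ J) (k : ℕ) : lett (x ^ k) ⊆ J := by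
  induction k with
  | zero => simp
  | succ k ih => rw [pow_succ, lett_mul]; exact union_subset ih hx

theorem pr_pow {x : PB} (hx : lett x ⊆ Ico 0 (n : ℤ)) (k : ℕ) : pr n (x ^ k) = pr n x ^ k := by
  induction k with
  | zero => simp
  | succ k ih => rw [pow_succ, pr_mul (lett_pow_subset hx k) hx, ih, pow_succ]

/-- A homomorphism on positive braids with values in a group extends to all braids. -/
def desc {K : Type*} [Group K] (n : ℕ) (f : PB →* K) : Braid n →* K :=
  PresentedGroup.toGroup (f := fun i : Fin n => f (g i)) (by
    rintro r ⟨i, j, ⟨h, rfl⟩ | ⟨h, rfl⟩⟩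
    · simp only [map_mul, map_inv, FreeGroup.lift_apply_of, mul_inv_eq_one]
      rw [← map_mul, ← map_mul, ← map_mul, ← map_mul, g_braid (Or.inl (by exact_mod_cast h))]
    · simp only [map_mul, map_inv, FreeGroup.lift_apply_of, mul_inv_eq_one]
      rw [← map_mul, ← map_mul, g_comm (Or.inl (by exact_mod_cast h))])

theorem desc_pr {K : Type*} [Group K] (f : PB →* K) {x : PB} (hx : lett x ⊆ Ico 0 (n : ℤ)) :
    desc n f (pr n x) = f x := by
  induction x using induction_right with
  | one => simp
  | mul_g x i ih =>
    simp only [lett_mul, lett_g, union_subset_iff, singleton_subset_iff] at hx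
    have hi := hx.2
    rw [mem_Ico] at hi
    obtain ⟨i, rfl⟩ := Int.eq_ofNat_of_zero_le hi.1
    rw [pr_mul hx.1 (by simpa using hx.2), map_mul, map_mul, ih hx.1, pr_g (by omega), gen,
      dif_pos (by omega), desc, PresentedGroup.toGroup.of]

theorem pr_injOn : InjOn (pr n) {x | lett x ⊆ Ico 0 (n : ℤ)} := by
  intro x hx y hy h
  apply fracHom_injective
  rw [← desc_pr fracHom hx, h, desc_pr fracHom hy]

theorem mem_closure_iff {J : Set ℤ} (hJ : J ⊆ Ico 0 (n : ℤ)) {a : Braid n} :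
    a ∈ Submonoid.closure {x : Braid n | ∃ i : ℕ, (i : ℤ) ∈ J ∧ x = gen n i} ↔
      ∃ x, lett x ⊆ J ∧ pr n x = a := by
  constructor
  · intro h
    induction h using Submonoid.closure_induction with
    | mem x hx =>
      obtain ⟨i, hi, rfl⟩ := hx
      exact ⟨g i, by simpa using hi, pr_g (by have := hJ hi; simp at this; omega)⟩
    | one => exact ⟨1, by simp⟩
    | mul a b _ _ iha ihb =>
      obtain ⟨x, hx, rfl⟩ := iha
      obtain ⟨y, hy, rfl⟩ := ihb
      exact ⟨x * y, by simp [hx, hy], pr_mul (hx.trans hJ) (hy.trans hJ)⟩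
  · rintro ⟨x, hx, rfl⟩
    induction x using induction_right with
    | one => simp
    | mul_g x i ih =>
      simp only [lett_mul, lett_g, union_subset_iff, singleton_subset_iff] at hx
      have hi := hJ hx.2
      rw [mem_Ico] at hi
      obtain ⟨i, rfl⟩ := Int.eq_ofNat_of_zero_le hi.1
      rw [pr_mul (hx.1.trans hJ) (by simpa using hJ hx.2), pr_g (by omega)]
      exact mul_mem (ih hx.1) (Submonoid.subset_closure ⟨i, hx.2, rfl⟩)

/-- The submonoid of the braids represented by positive words over the letters in `J`. -/
structure IsPos (K : Submonoid (Braid n)) (J : Set ℤ) : Prop where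
  subset : J ⊆ Ico 0 (n : ℤ)
  mem_iff : ∀ {a}, a ∈ K ↔ ∃ x, lett x ⊆ J ∧ pr n x = a

theorem isPos_Mb : IsPos (Mb n) (Ico 0 (n : ℤ)) :=
  ⟨Subset.rfl, by
    intro a
    rw [Mb, ← mem_closure_iff Subset.rfl]
    simp⟩

theorem isPos_M₁b : IsPos (M₁b n) (Ico 1 (n : ℤ)) :=
  have h : Ico 1 (n : ℤ) ⊆ Ico 0 (n : ℤ) := Ico_subset_Ico (by omega) le_rfl
  ⟨h, by
    intro a
    rw [M₁b, ← mem_closure_iff h]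
    simp [and_assoc]⟩

theorem isPos_Nb : IsPos (Nb n) (Ico 0 ((n : ℤ) - 1)) :=
  have h : Ico 0 ((n : ℤ) - 1) ⊆ Ico 0 (n : ℤ) := Ico_subset_Ico le_rfl (by omega)
  ⟨h, by
    intro a
    rw [Nb, ← mem_closure_iff h]
    have (i : ℕ) : (i : ℤ) < n - 1 ↔ i + 1 < n := by omega
    simp [this]⟩

theorem leR_pr_iff {x c : PB} (hx : lett x ⊆ Ico 0 (n : ℤ)) (hc : lett c ⊆ Ico 0 (n : ℤ)) :
    leR (Mb n) (pr n c) (pr n x) ↔ ∃ d, x = d * c := by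
  rw [leR, isPos_Mb.mem_iff]
  constructor
  · rintro ⟨d, hd, h⟩
    refine ⟨d, pr_injOn hx (by simp [hd, hc]) ?_⟩
    rw [pr_mul hd hc, h, inv_mul_cancel_right]
  · rintro ⟨d, rfl⟩
    rw [lett_mul, union_subset_iff] at hx
    exact ⟨d, hx.1, by rw [pr_mul hx.1 hc, mul_inv_cancel_right]⟩

theorem tail_pr {K : Submonoid (Braid n)} {J : Set ℤ} (hK : IsPos K J) {v y : PB}
    (hv : lett v ⊆ Ico 0 (n : ℤ)) (h : IsTail J v y) : tail (Mb n) K (pr n (v * y)) = pr n y := by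
  have hy := h.1.trans hK.subset
  have hvy : lett (v * y) ⊆ Ico 0 (n : ℤ) := by simp [hv, hy]
  have hex : ∃ b : Braid n, b ∈ K ∧ {c | c ∈ K ∧ leR (Mb n) c (pr n (v * y))} =
      {c | c ∈ K ∧ leR (Mb n) c b} := by
    refine ⟨pr n y, hK.mem_iff.2 ⟨y, h.1, rfl⟩, ?_⟩
    ext c
    refine and_congr_right fun hc => ?_
    obtain ⟨c, hc', rfl⟩ := hK.mem_iff.1 hc
    rw [leR_pr_iff hvy (hc'.trans hK.subset), leR_pr_iff hy (hc'.trans hK.subset)]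
    constructor
    · rintro ⟨d, e⟩
      exact h.exists_eq hc' e
    · rintro ⟨d, rfl⟩
      exact ⟨v * d, by rw [mul_assoc]⟩
  rw [tail, dif_pos hex]
  obtain ⟨hb, hset⟩ := hex.choose_spec
  obtain ⟨z, hz, e⟩ := hK.mem_iff.1 hb
  rw [← e] at hset ⊢
  have hz' := hz.trans hK.subset
  have h1 : pr n y ∈ {c | c ∈ K ∧ leR (Mb n) c (pr n z)} :=
    hset ▸ ⟨hK.mem_iff.2 ⟨y, h.1, rfl⟩, (leR_pr_iff hvy hy).2 ⟨v, rfl⟩⟩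
  have h2 : pr n z ∈ {c | c ∈ K ∧ leR (Mb n) c (pr n (v * y))} :=
    hset ▸ ⟨hK.mem_iff.2 ⟨z, hz, rfl⟩, (leR_pr_iff hz' hz').2 ⟨1, by simp⟩⟩
  obtain ⟨d, hd⟩ := (leR_pr_iff hz' hy).1 h1.2
  obtain ⟨d', hd'⟩ := (leR_pr_iff hvy hz').1 h2.2
  obtain ⟨y', hy'⟩ := h.exists_eq hz hd'
  have hl := congrArg len hd
  have hl' := congrArg len hy'
  rw [len_mul] at hl hl'
  have : d = 1 := len_eq_zero.1 (by omega)
  rw [hd, this, one_mul]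

theorem isTail_one {J : Set ℤ} {y : PB} (hy : lett y ⊆ J) : IsTail J 1 y :=
  ⟨hy, fun i _ h => by simpa using h.mem_lett⟩

theorem strip_succ_even {i : ℕ} (hi : i % 2 = 0) {a : Braid n} {v y : PB}
    (hv : lett v ⊆ Ico 0 (n : ℤ)) (h : IsTail (Ico 1 (n : ℤ)) v y)
    (e : strip (Mb n) (M₁b n) (Nb n) i a = pr n (v * y)) :
    strip (Mb n) (M₁b n) (Nb n) (i + 1) a = pr n v := by
  rw [strip, if_pos hi, e, tail_pr isPos_M₁b hv h, pr_mul hv (h.1.trans isPos_M₁b.subset),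
    mul_inv_cancel_right]

theorem strip_succ_odd {i : ℕ} (hi : i % 2 = 1) {a : Braid n} {v y : PB}
    (hv : lett v ⊆ Ico 0 (n : ℤ)) (h : IsTail (Ico 0 ((n : ℤ) - 1)) v y)
    (e : strip (Mb n) (M₁b n) (Nb n) i a = pr n (v * y)) :
    strip (Mb n) (M₁b n) (Nb n) (i + 1) a = pr n v := by
  rw [strip, if_neg (by omega), e, tail_pr isPos_Nb hv h, pr_mul hv (h.1.trans isPos_Nb.subset),
    mul_inv_cancel_right]

theorem strip_eq_one_of_le {i j : ℕ} (hij : i ≤ j) {a : Braid n}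
    (h : strip (Mb n) (M₁b n) (Nb n) i a = 1) : strip (Mb n) (M₁b n) (Nb n) j a = 1 := by
  induction j, hij using Nat.le_induction with
  | base => exact h
  | succ j _ ih =>
    have e : strip (Mb n) (M₁b n) (Nb n) j a = pr n (1 * 1) := by simpa using ih
    rcases Nat.mod_two_eq_zero_or_one j with hj | hj
    · simpa using strip_succ_even hj (by simp) (isTail_one (by simp)) e
    · simpa using strip_succ_odd hj (by simp) (isTail_one (by simp)) e

theorem strip_chain {k : ℕ} {v : PB} (hc : Chain n k v) (hv : lett v ⊆ Ico 0 (n : ℤ)) {i : ℕ}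
    (hi : i % 2 = 1) {a : Braid n} (e : strip (Mb n) (M₁b n) (Nb n) i a = pr n v) :
    strip (Mb n) (M₁b n) (Nb n) (i + 2 * k + 2) a = 1 ∧
      strip (Mb n) (M₁b n) (Nb n) (i + 2 * k) a ≠ 1 := by
  induction hc generalizing i with
  | @base u x h1 _ hx hu =>
    have hv' := hv
    rw [lett_mul, union_subset_iff] at hv'
    have e1 := strip_succ_odd hi hv'.1 hx e
    have e2 := strip_succ_even (i := i + 1) (by omega) (v := 1) (by simp) (isTail_one hu)
      (by simpa using e1)
    refine ⟨by simpa using e2, fun h => h1 (pr_injOn hv (by simp) ?_)⟩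
    rw [pr_one, ← e]
    exact h
  | @step k w z x _ _ hx hz ih =>
    have hv' := hv
    simp only [lett_mul, union_subset_iff] at hv'
    have e1 := strip_succ_odd hi (by simp [hv'.1.1, hv'.1.2]) hx e
    have e2 := strip_succ_even (by omega) hv'.1.1 hz e1
    have := ih hv'.1.1 (by omega) e2
    rwa [show i + 1 + 1 + 2 * k = i + 2 * (k + 1) by ring] at this

theorem dpt_pr_of_chain {k : ℕ} {v y : PB} (hc : Chain n k v) (hv : lett v ⊆ Ico 0 (n : ℤ))
    (h : IsTail (Ico 1 (n : ℤ)) v y) : dpt (Mb n) (M₁b n) (Nb n) (pr n (v * y)) = k + 1 := by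
  have e := strip_succ_even (i := 0) rfl hv h rfl
  obtain ⟨h1, h2⟩ := strip_chain hc hv (by rfl) e
  have hmem : 0 + 1 + 2 * k + 2 ∈ {p : ℕ | 1 ≤ p ∧
    strip (Mb n) (M₁b n) (Nb n) p (pr n (v * y)) = 1} := ⟨by omega, h1⟩
  have hle := Nat.sInf_le hmem
  have hm := Nat.sInf_mem ⟨_, hmem⟩
  have hlt : 0 + 1 + 2 * k < bh (Mb n) (M₁b n) (Nb n) (pr n (v * y)) := by
    by_contra hcon
    exact h2 (strip_eq_one_of_le (not_lt.1 hcon) hm.2)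
  rw [dpt]
  rw [← bh] at hle
  omega

theorem dpt_pr_of_lett {y : PB} (hy : lett y ⊆ Ico 1 (n : ℤ)) :
    dpt (Mb n) (M₁b n) (Nb n) (pr n y) = 0 := by
  have e := strip_succ_even (i := 0) rfl (a := pr n y) (v := 1) (by simp) (isTail_one hy)
    (by rw [one_mul]; rfl)
  have hle := Nat.sInf_le (show 1 ∈ {p : ℕ | 1 ≤ p ∧
    strip (Mb n) (M₁b n) (Nb n) p (pr n y) = 1} from ⟨le_rfl, by simpa using e⟩)
  rw [← bh] at hle
  rw [dpt]
  omega

theorem seg_zero {k : ℕ} (hk : k ≤ n) : seg n 0 k = pr n (up k) := by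
  induction k with
  | zero => simp [seg]
  | succ k ih =>
    have := ih (by omega)
    simp only [seg, List.drop_zero] at this ⊢
    have hg : lett (g (k : ℤ)) ⊆ Ico 0 (n : ℤ) := by simp; omega
    rw [List.range_succ, List.map_append, List.prod_append, this, up_succ,
      pr_mul ((lett_up k).trans (Ico_subset_Ico le_rfl (by omega))) hg, pr_g (by omega)]
    simp

theorem seg_one {k : ℕ} (hk : k + 1 ≤ n) : seg n 1 (k + 1) = pr n (sh 1 (up k)) := by
  induction k with
  | zero => simp [seg]
  | succ k ih =>
    have := ih (by omega)
    simp only [seg] at this ⊢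
    have hg : lett (g ((k + 1 : ℕ) : ℤ)) ⊆ Ico 0 (n : ℤ) := by simp; omega
    have hu : lett (sh 1 (up k)) ⊆ Ico 0 (n : ℤ) :=
      (lett_sh_one (lett_up k)).trans (Ico_subset_Ico (by omega) (by omega))
    rw [List.range_succ, List.drop_append_of_le_length (by simp), List.map_append,
      List.prod_append, this, up_succ, map_mul, sh_g,
      show (k : ℤ) + 1 = ((k + 1 : ℕ) : ℤ) by simp, pr_mul hu hg, pr_g (by omega)]
    simp

theorem Δb_eq : Δb n = pr n (D n ^ 2) := by
  rw [Δb, seg_zero le_rfl, D_sq, pr_pow (lett_up n)]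

theorem theta_eq (hn : 1 ≤ n) : Δb n * (Δ₁b n)⁻¹ = pr n (theta n) := by
  obtain ⟨m, rfl⟩ : ∃ m, n = m + 1 := ⟨n - 1, by omega⟩
  have hu : lett (sh 1 (up m)) ⊆ Ico 0 ((m + 1 : ℕ) : ℤ) :=
    (lett_sh_one (lett_up m)).trans (Ico_subset_Ico (by omega) (by simp))
  have ht : lett (theta (m + 1)) ⊆ Ico 0 ((m + 1 : ℕ) : ℤ) := by
    rw [theta, lett_mul]
    exact union_subset (lett_up _) (lett_dn _)
  rw [Δb_eq, D_sq_succ, D_sq, map_pow, pr_mul ht (lett_pow_subset hu _), pr_pow hu, Δ₁b,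
    seg_one le_rfl, mul_inv_cancel_right]

end BraidOrder

namespace PosBraid
open PB Set

variable {G : Type*} [Group G] {φ : PB →* G} {le : G → G → Prop}

/-- Left multiplication by `α` has the same effect on the preorder as multiplication by `ζ`. -/
def LeEquiv (le : G → G → Prop) (α ζ : G) : Prop := ∀ x, le (α * x) (ζ * x) ∧ le (ζ * x) (α * x)

theorem lett_theta {n : ℕ} : lett (theta n) ⊆ Ico 0 (n : ℤ) := by
  rw [theta, lett_mul]
  exact union_subset (lett_up _) (lett_dn _)

namespace StrictPosOrder

variable (h : StrictPosOrder φ le)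
include h

theorem leEquiv_one {b : PB} (hb : lett b ⊆ Ici 1) : LeEquiv le (φ b) 1 := fun x => by
  rw [one_mul]
  exact ⟨h.fix_le hb x, h.le_mul_left b x⟩

theorem leEquiv_inv_one {b : PB} (hb : lett b ⊆ Ici 1) : LeEquiv le (φ b)⁻¹ 1 := fun x => by
  rw [one_mul]
  exact ⟨h.inv_fix_le x, h.le_inv_fix hb x⟩

theorem leEquiv_mul {α β ζ ξ : G} (hα : LeEquiv le α ζ) (hβ : LeEquiv le β ξ)
    (hc : Commute ζ β) : LeEquiv le (α * β) (ξ * ζ) := fun x => by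
  have h1 := hα (β * x)
  have h2 := hβ (ζ * x)
  rw [← mul_assoc ζ, hc.eq, mul_assoc β] at h1
  rw [mul_assoc, mul_assoc]
  exact ⟨h.trans h1.1 h2.1, h.trans h2.2 h1.2⟩

theorem zpow_le_zpow {z : PB} (hz : 0 ∈ lett z) {s t : ℤ} : le (φ z ^ s) (φ z ^ t) ↔ s ≤ t := by
  have key : le (φ z ^ s) (φ z ^ t) ↔ le 1 (φ z ^ (t - s)) := by
    constructor <;> intro h1
    · simpa [zpow_sub] using h.mul_right h1 (φ z ^ s)⁻¹
    · simpa [zpow_sub] using h.mul_right h1 (φ z ^ s)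
  rw [key]
  constructor
  · intro h1
    by_contra hlt
    obtain ⟨m, hm⟩ : ∃ m : ℕ, t - s = -(m : ℤ) := ⟨(s - t).toNat, by omega⟩
    rw [hm] at h1
    have h2 := h.mul_right h1 (φ z ^ m)
    rw [zpow_neg, zpow_natCast, inv_mul_cancel, one_mul] at h2
    exact h.pow_not_le hz (show 0 < m by omega) (by simpa using h2)
  · intro h1
    obtain ⟨m, hm⟩ : ∃ m : ℕ, t - s = m := ⟨(t - s).toNat, by omega⟩
    rw [hm, zpow_natCast, ← map_pow]
    simpa using h.le_mul_left (z ^ m) 1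

theorem not_le_mul {α β : G} (hαβ : ¬ le α β) (γ : G) : ¬ le (α * γ) (β * γ) := fun h1 =>
  hαβ (by simpa using h.mul_right h1 γ⁻¹)

theorem le_of_not_le {α β : G} (hαβ : ¬ le α β) : le β α := (h.total α β).resolve_left hαβ

theorem leEquiv_theta {n : ℕ} (hn : 1 ≤ n) : LeEquiv le (φ (theta n)) (φ (D n ^ 2)) := by
  obtain ⟨m, rfl⟩ : ∃ m, n = m + 1 := ⟨n - 1, by omega⟩
  have hs : lett (sh 1 (D m ^ 2)) ⊆ Ico 1 ((m + 1 : ℕ) : ℤ) := by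
    rw [sq, map_mul, lett_mul]
    simpa using lett_sh_one (lett_D m)
  have e := congrArg φ (D_sq_succ m)
  rw [map_mul] at e
  rw [show φ (theta (m + 1)) = φ (D (m + 1) ^ 2) * (φ (sh 1 (D m ^ 2)))⁻¹ by
    rw [e, mul_inv_cancel_right]]
  have hc : Commute (D (m + 1) ^ 2) (sh 1 (D m ^ 2)) :=
    D_sq_mul (hs.trans (Ico_subset_Ico (by omega) le_rfl))
  simpa using h.leEquiv_mul (fun x => ⟨h.refl _, h.refl _⟩)
    (h.leEquiv_inv_one (hs.trans fun i hi => hi.1)) (hc.map φ).inv_right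

theorem leEquiv_theta_pow_mul {n : ℕ} (hn : 1 ≤ n) (k : ℕ) {b : PB}
    (hb : lett b ⊆ Ico 1 (n : ℤ)) : LeEquiv le (φ (theta n ^ k * b)) (φ (D n ^ 2) ^ k) := by
  have hb0 : lett b ⊆ Ico 0 (n : ℤ) := hb.trans (Ico_subset_Ico (by omega) le_rfl)
  have hbc : Commute (φ (D n ^ 2)) (φ b) := Commute.map (D_sq_mul hb0) φ
  have htc : Commute (φ (D n ^ 2)) (φ (theta n)) := Commute.map (D_sq_mul lett_theta) φ
  induction k with
  | zero => simpa using h.leEquiv_one (hb.trans fun i hi => hi.1)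
  | succ k ih =>
    rw [pow_succ' (theta n), mul_assoc, map_mul, pow_succ]
    refine h.leEquiv_mul (h.leEquiv_theta hn) ih ?_
    rw [map_mul, map_pow φ (theta n)]
    exact (htc.pow_right k).mul_right hbc

end StrictPosOrder

end PosBraid

namespace BraidOrder
open GarsideOrder PosBraid PosBraid.PB Set

variable {n : ℕ} {G : Type*} [Group G] {φ : PB →* G} {le : G → G → Prop}

/-- The position of a positive braid with respect to the powers of the full twist: it is
equivalent to one of them (`false`), or lies strictly between two of them (`true`). -/
def AtLevel (le : G → G → Prop) (ζ α : G) (k : ℕ) : Bool → Prop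
  | false => LeEquiv le α (ζ ^ k)
  | true => ¬ le α (ζ ^ k) ∧ ¬ le (ζ ^ (k + 1)) α

theorem zero_mem_lett_D_sq (hn : 2 ≤ n) : 0 ∈ lett (D n ^ 2) := by
  rw [sq, lett_mul]
  exact Or.inl (zero_mem_lett_D (by omega))

theorem desc_Δb : desc n φ (Δb n) = φ (D n ^ 2) := by
  rw [Δb_eq, desc_pr φ (lett_pow_subset (lett_D n) 2)]

theorem commute_desc {a : Braid n} (ha : a ∈ Mb n) : Commute (φ (D n ^ 2)) (desc n φ a) := by
  obtain ⟨x, hx, rfl⟩ := isPos_Mb.mem_iff.1 ha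
  rw [desc_pr φ hx]
  exact Commute.map (D_sq_mul hx) φ

theorem mem_theta_iff (hn : 2 ≤ n) {a : Braid n} :
    a ∈ thetaSet (M₁b n) (Δb n * (Δ₁b n)⁻¹) ↔
      ∃ k, 1 ≤ k ∧ ∃ b, lett b ⊆ Ico 1 (n : ℤ) ∧ pr n (theta n ^ k * b) = a := by
  have key (k : ℕ) {b : PB} (hb : lett b ⊆ Ico 1 (n : ℤ)) :
      pr n (theta n ^ k * b) = (Δb n * (Δ₁b n)⁻¹) ^ k * pr n b := by
    rw [theta_eq (by omega), pr_mul (lett_pow_subset lett_theta k) (hb.trans isPos_M₁b.subset),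
      pr_pow lett_theta]
  constructor
  · rintro ⟨k, hk, b, hb, rfl⟩
    obtain ⟨b, hb', rfl⟩ := isPos_M₁b.mem_iff.1 hb
    exact ⟨k, hk, b, hb', key k hb'⟩
  · rintro ⟨k, hk, b, hb, rfl⟩
    exact ⟨k, hk, pr n b, isPos_M₁b.mem_iff.2 ⟨b, hb, rfl⟩, key k hb⟩

section

variable (h : StrictPosOrder φ le)
include h

theorem atLevel_of_mem_M₁b (hn : 2 ≤ n) {a : Braid n} (ha : a ∈ M₁b n) :
    AtLevel le (φ (D n ^ 2)) (desc n φ a) 0 false := by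
  obtain ⟨y, hy, rfl⟩ := isPos_M₁b.mem_iff.1 ha
  rw [desc_pr φ (hy.trans isPos_M₁b.subset)]
  have := h.leEquiv_theta_pow_mul (n := n) (by omega) 0 hy
  rwa [pow_zero (theta n), one_mul] at this

theorem atLevel_of_mem_theta (hn : 2 ≤ n) {a : Braid n}
    (ha : a ∈ thetaSet (M₁b n) (Δb n * (Δ₁b n)⁻¹)) :
    ∃ k, 1 ≤ k ∧ AtLevel le (φ (D n ^ 2)) (desc n φ a) k false := by
  obtain ⟨k, hk, b, hb, rfl⟩ := (mem_theta_iff hn).1 ha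
  refine ⟨k, hk, ?_⟩
  rw [desc_pr φ (by
    rw [lett_mul]
    exact union_subset (lett_pow_subset lett_theta k) (hb.trans isPos_M₁b.subset))]
  exact h.leEquiv_theta_pow_mul (by omega) k hb

theorem AtLevel.unique (hn : 2 ≤ n) {α : G} {k l : ℕ} {p q : Bool}
    (h1 : AtLevel le (φ (D n ^ 2)) α k p) (h2 : AtLevel le (φ (D n ^ 2)) α l q) :
    k = l ∧ p = q := by
  have key {s t : ℕ} : le (φ (D n ^ 2) ^ s) (φ (D n ^ 2) ^ t) ↔ s ≤ t := by
    simpa using h.zpow_le_zpow (zero_mem_lett_D_sq hn) (s := s) (t := t)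
  have bounds {k : ℕ} {p : Bool} (h1 : AtLevel le (φ (D n ^ 2)) α k p) :
      le (φ (D n ^ 2) ^ k) α ∧ ¬ le (φ (D n ^ 2) ^ (k + 1)) α ∧
        (le α (φ (D n ^ 2) ^ k) ↔ p = false) := by
    cases p with
    | false =>
      have := h1 1
      rw [mul_one, mul_one] at this
      refine ⟨this.2, fun h3 => ?_, by simpa using this.1⟩
      have := key.1 (h.trans h3 this.1)
      omega
    | true => exact ⟨h.le_of_not_le h1.1, h1.2, by simpa using h1.1⟩
  obtain ⟨a1, a2, a3⟩ := bounds h1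
  obtain ⟨b1, b2, b3⟩ := bounds h2
  have e1 : ¬ k + 1 ≤ l := fun e => a2 (h.trans (key.2 e) b1)
  have e2 : ¬ l + 1 ≤ k := fun e => b2 (h.trans (key.2 e) a1)
  obtain rfl : k = l := by omega
  refine ⟨rfl, ?_⟩
  have e := a3.symm.trans b3
  revert e
  cases p <;> cases q <;> simp

/-- The depth, and membership in the distinguished sets, are determined by the level. -/
theorem exists_atLevel (hn : 2 ≤ n) {a : Braid n} (ha : a ∈ Mb n) :
    ∃ (k : ℕ) (p : Bool), AtLevel le (φ (D n ^ 2)) (desc n φ a) k p ∧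
      dpt (Mb n) (M₁b n) (Nb n) a = (if k = 0 ∧ p = false then 0 else k + 1) ∧
      (a ∈ M₁b n ↔ k = 0 ∧ p = false) ∧
      (a ∈ thetaSet (M₁b n) (Δb n * (Δ₁b n)⁻¹) ↔ 1 ≤ k ∧ p = false) := by
  obtain ⟨x, hx, rfl⟩ := isPos_Mb.mem_iff.1 ha
  suffices hs : ∃ (k : ℕ) (p : Bool), AtLevel le (φ (D n ^ 2)) (φ x) k p ∧
      dpt (Mb n) (M₁b n) (Nb n) (pr n x) = (if k = 0 ∧ p = false then 0 else k + 1) ∧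
      (k = 0 ∧ p = false → pr n x ∈ M₁b n) ∧
      (1 ≤ k ∧ p = false → pr n x ∈ thetaSet (M₁b n) (Δb n * (Δ₁b n)⁻¹)) by
    obtain ⟨k, p, h1, h2, h3, h4⟩ := hs
    rw [← desc_pr φ hx] at h1
    refine ⟨k, p, h1, h2, ⟨fun hm => ?_, h3⟩, ⟨fun hm => ?_, h4⟩⟩
    · exact h1.unique h hn (atLevel_of_mem_M₁b h hn hm)
    · obtain ⟨l, hl, hl'⟩ := atLevel_of_mem_theta h hn hm
      obtain ⟨rfl, rfl⟩ := h1.unique h hn hl'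
      exact ⟨hl, rfl⟩
  by_cases hx1 : lett x ⊆ Ico 1 (n : ℤ)
  · refine ⟨0, false, ?_, by simpa using dpt_pr_of_lett hx1,
      fun _ => isPos_M₁b.mem_iff.2 ⟨x, hx1, rfl⟩, by simp⟩
    have := h.leEquiv_theta_pow_mul (n := n) (by omega) 0 hx1
    rwa [pow_zero (theta n), one_mul] at this
  obtain ⟨v, y, rfl, hvy⟩ := exists_isTail (Ico 1 (n : ℤ)) x
  have hv : lett v ⊆ Ico 0 (n : ℤ) := by
    rw [lett_mul, union_subset_iff] at hx
    exact hx.1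
  have hv1 : v ≠ 1 := by
    rintro rfl
    exact hx1 (by simpa using hvy.1)
  obtain ⟨k, hk⟩ := exists_chain hn hv1 (low_of_isTail hv hvy) hv
  have hd := dpt_pr_of_chain hk hv hvy
  have h1 := h.chain_le hn hk hv y
  have h2 := h.chain_not_le hn hk hv hvy.1
  by_cases h3 : le (φ (v * y)) (φ (D n) ^ (2 * k))
  · obtain ⟨b, hb, e⟩ := exists_theta_mul h hn k hx h3 h1
    have hk0 : k ≠ 0 := by
      rintro rfl
      exact hx1 (by simpa [e] using hb)
    refine ⟨k, false, ?_, by simpa [hk0] using hd, by simp [hk0], fun hk => ?_⟩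
    · rw [e]
      exact h.leEquiv_theta_pow_mul (by omega) k hb
    · exact (mem_theta_iff hn).2 ⟨k, hk.1, b, hb, by rw [e]⟩
  · refine ⟨k, true, ⟨?_, ?_⟩, by simpa using hd, by simp, by simp⟩
    · rwa [map_pow, ← pow_mul]
    · rwa [map_pow, ← pow_mul]

theorem AtLevel.mul {a b : Braid n} (ha : a ∈ Mb n) (hb : b ∈ Mb n)
    {k l : ℕ} {p q : Bool} (h1 : AtLevel le (φ (D n ^ 2)) (desc n φ a) k p)
    (h2 : AtLevel le (φ (D n ^ 2)) (desc n φ b) l q) (hpq : p = true ∨ q = true) :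
    ¬ le (desc n φ (a * b)) (φ (D n ^ 2) ^ (k + l)) ∧
      ¬ le (φ (D n ^ 2) ^ (k + l + (if p = true then 1 else 0) + (if q = true then 1 else 0)))
        (desc n φ (a * b)) := by
  have ca (k : ℕ) : φ (D n ^ 2) ^ k * desc n φ a = desc n φ a * φ (D n ^ 2) ^ k :=
    ((commute_desc ha).pow_left k).eq
  have cb (k : ℕ) : φ (D n ^ 2) ^ k * desc n φ b = desc n φ b * φ (D n ^ 2) ^ k :=
    ((commute_desc hb).pow_left k).eq
  rw [map_mul]
  generalize desc n φ a = α at *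
  generalize desc n φ b = β at *
  generalize φ (D n ^ 2) = ζ at *
  cases p <;> cases q
  · simp at hpq
  · have e := h1 β
    rw [cb] at e
    refine ⟨fun h0 => h.not_le_mul h2.1 (ζ ^ k) ?_, fun h0 => h.not_le_mul h2.2 (ζ ^ k) ?_⟩
    · rw [← pow_add, add_comm]
      exact h.trans e.2 h0
    · rw [← pow_add]
      refine h.trans ?_ e.1
      convert h0 using 2
      simp only [if_true, Bool.false_eq_true, if_false]
      omega
  · have e := h2 (ζ ^ k)
    have e' := h2 (ζ ^ (k + 1))
    rw [← cb, ← pow_add] at e e'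
    refine ⟨fun h0 => h.not_le_mul h1.1 β ?_, fun h0 => h.not_le_mul h1.2 β ?_⟩
    · exact h.trans h0 (by rw [add_comm]; exact e.2)
    · refine h.trans e'.1 ?_
      convert h0 using 2
      simp only [if_true, Bool.false_eq_true, if_false]
      omega
  · refine ⟨fun h0 => h.not_le_mul h1.1 β (h.trans h0 ?_),
      fun h0 => h.not_le_mul h1.2 β (h.trans ?_ h0)⟩
    · rw [cb, add_comm, pow_add]
      exact h.mul_right (h.le_of_not_le h2.1) _
    · rw [cb]
      convert h.mul_right (h.le_of_not_le h2.2) (ζ ^ (k + 1)) using 1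
      rw [← pow_add]
      congr 1
      simp only [if_true]
      omega

end

end BraidOrder

namespace BraidOrder
open GarsideOrder PosBraid PosBraid.PB Set

variable {n : ℕ} {G : Type*} [Group G] {φ : PB →* G} {le : G → G → Prop}

theorem condA_of_strictPosOrder (h : StrictPosOrder φ le) (hn : 2 ≤ n) :
    CondA (Mb n) (M₁b n) (Nb n) (Δb n) 1 := by
  intro k hk
  have hm : Δb n ^ k ∈ Mb n := by
    rw [Δb_eq]
    exact pow_mem (isPos_Mb.mem_iff.2 ⟨_, lett_pow_subset (lett_D n) 2, rfl⟩) k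
  obtain ⟨l, p, h1, h2, -⟩ := exists_atLevel h hn hm
  have h3 : AtLevel le (φ (D n ^ 2)) (desc n φ (Δb n ^ k)) k false := by
    rw [map_pow (desc n φ), desc_Δb]
    exact fun x => ⟨h.refl _, h.refl _⟩
  obtain ⟨rfl, rfl⟩ := h1.unique h hn h3
  rw [h2, if_neg (by omega)]
  omega

/-- The levels of `a`, `b` and `c` are additive up to a small defect when `a * b = c * Δ ^ t`. -/
theorem AtLevel.bounds_of_mul_eq (h : StrictPosOrder φ le) (hn : 2 ≤ n) {a b c : Braid n} {t : ℤ}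
    (ha : a ∈ Mb n) (hb : b ∈ Mb n) (e : a * b = c * Δb n ^ t) {k l m : ℕ} {p q r : Bool}
    (h1 : AtLevel le (φ (D n ^ 2)) (desc n φ a) k p)
    (h2 : AtLevel le (φ (D n ^ 2)) (desc n φ b) l q)
    (h3 : AtLevel le (φ (D n ^ 2)) (desc n φ c) m r) (hpq : p = true ∨ q = true) :
    (k + l : ℤ) < m + t + (if r = true then 1 else 0) ∧
      m + t < (k + l : ℤ) + (if p = true then 1 else 0) + (if q = true then 1 else 0) := by
  obtain ⟨h4, h5⟩ := h1.mul h ha hb h2 hpq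
  rw [e, map_mul, map_zpow, desc_Δb] at h4 h5
  have key {s t : ℤ} : le (φ (D n ^ 2) ^ s) (φ (D n ^ 2) ^ t) ↔ s ≤ t :=
    h.zpow_le_zpow (zero_mem_lett_D_sq hn)
  have low : le (φ (D n ^ 2) ^ (m + t)) (desc n φ c * φ (D n ^ 2) ^ t) := by
    rw [zpow_add, zpow_natCast]
    cases r with
    | false => exact (h3 _).2
    | true => exact h.mul_right (h.le_of_not_le h3.1) _
  have upp : le (desc n φ c * φ (D n ^ 2) ^ t)
      (φ (D n ^ 2) ^ (m + t + (if r = true then 1 else 0))) := by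
    cases r with
    | false => simpa [zpow_add] using (h3 _).1
    | true =>
      have := h.mul_right (h.le_of_not_le h3.2) (φ (D n ^ 2) ^ t)
      rw [← zpow_natCast, ← zpow_add] at this
      convert this using 2
      simp only [if_true]
      omega
  rw [← zpow_natCast] at h4 h5
  constructor
  · by_contra hc
    exact h4 (h.trans upp (key.2 (by push_cast; omega)))
  · by_contra hc
    exact h5 (h.trans (key.2 (by push_cast; omega)) low)

theorem condB_of_strictPosOrder (h : StrictPosOrder φ le) (hn : 2 ≤ n) :
    CondB (Mb n) (M₁b n) (Nb n) (Δb n) (Δb n * (Δ₁b n)⁻¹) 1 := by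
  intro a b c t ha hb hab hc e
  obtain ⟨k, p, h1, da, a1, a2⟩ := exists_atLevel h hn ha.1
  obtain ⟨l, q, h2, db, b1, b2⟩ := exists_atLevel h hn hb.1
  obtain ⟨m, r, h3, dc, c1, -⟩ := exists_atLevel h hn hc.1
  have hpq : p = true ∨ q = true := by
    by_contra! hpq
    refine hab ⟨?_, ?_⟩
    · rcases Nat.eq_zero_or_pos k with hk | hk
      · exact Or.inr (a1.2 ⟨hk, by simpa using hpq.1⟩)
      · exact Or.inl (a2.2 ⟨hk, by simpa using hpq.1⟩)
    · rcases Nat.eq_zero_or_pos l with hl | hl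
      · exact Or.inr (b1.2 ⟨hl, by simpa using hpq.2⟩)
      · exact Or.inl (b2.2 ⟨hl, by simpa using hpq.2⟩)
  obtain ⟨u1, u2⟩ := AtLevel.bounds_of_mul_eq h hn ha.1 hb.1 e h1 h2 h3 hpq
  rw [a2, b2, c1, da, db, dc]
  clear h1 h2 h3 da db dc a1 a2 b1 b2 c1
  obtain ⟨ε, hε⟩ : ∃ ε : ℕ, (if k = 0 ∧ p = false then 0 else k + 1 : ℕ) +
      (if l = 0 ∧ q = false then 0 else l + 1 : ℕ) - t -
      (if m = 0 ∧ r = false then 0 else m + 1 : ℕ) = (ε : ℤ) := by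
    refine Int.eq_ofNat_of_zero_le ?_
    cases p <;> cases q <;> cases r <;> simp at * <;> (try split_ifs) <;> omega
  refine ⟨ε, ?_, by omega, ?_⟩ <;>
    cases p <;> cases q <;> cases r <;> simp at * <;>
    (try split_ifs at hε) <;> intros <;> omega

end BraidOrder

open GarsideOrder BraidOrder in
/-- In the braid group `B_{n+1}` with its Garside structure `(G, M, Δ)` and the parabolic
substructures `(H, N, Λ)` and `(G₁, M₁, Δ₁)`, the pair `(H, G₁)` satisfies Condition A
with constant `ζ = 1` and Condition B with constant `ζ = 1` (here `θ = Δ Δ₁⁻¹`). -/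
theorem statement9 (n : ℕ) (hn : 2 ≤ n) :
    CondA (Mb n) (M₁b n) (Nb n) (Δb n) 1 ∧
    CondB (Mb n) (M₁b n) (Nb n) (Δb n) (Δb n * (Δ₁b n)⁻¹) 1 := by
  exact ⟨condA_of_strictPosOrder PosBraid.strictPosOrder_ordHom hn,
    condB_of_strictPosOrder PosBraid.strictPosOrder_ordHom hn⟩
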